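/- Let q be a power of an odd prime, F_q a finite field with q elements and E a finite field with q² elements, m ≥ 1, and let J ∈ M_{2m}(F_q) be any invertible symmetric matrix. Let H = SO(J) = {g ∈ GL(2m, F_q) : gᵀ J g = J, det g = 1} and G = GL(m, E). Let S be a complete set of irreducible complex representations of H and R a complete set of irreducible complex representations of G. Then Σ_{σ ∈ S, character of σ real-valued} dim σ = Σ_{k=0}^{m} q^{2k(m−k)} · binom(m,k)_{q²} = Σ_{ρ ∈ R, character of ρ real-valued} dim ρ (as real numbers). -/

import Mathlib

open Matrix CategoryTheory
open scoped Classical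

noncomputable section

/-- The Frobenius–Schur indicator of a complex-valued function on a finite group. -/
def fsIndicator (G : Type*) [Group G] [Fintype G] (χ : G → ℂ) : ℂ :=
  (Fintype.card G : ℂ)⁻¹ * ∑ g : G, χ (g * g)

/-- The twisted Frobenius–Schur indicator of a complex-valued function on a finite group,
with respect to a map `σ`. -/
def twistedFSIndicator (G : Type*) [Group G] [Fintype G] (σ : G → G) (χ : G → ℂ) : ℂ :=
  (Fintype.card G : ℂ)⁻¹ * ∑ g : G, χ (g * σ g)

/-- A complex-valued function is real-valued if all its values are real. -/
def IsRealValued {G : Type*} (χ : G → ℂ) : Prop := ∀ g : G, ∃ r : ℝ, χ g = (r : ℂ)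

/-- The Gaussian binomial coefficient `binom(m,k)_q` as a real number. -/
def gbinom (m k : ℕ) (q : ℝ) : ℝ := ∏ i ∈ Finset.Icc 1 k, (q ^ (m - k + i) - 1) / (q ^ i - 1)

section Groups

variable {N F : Type*} [Fintype N] [DecidableEq N] [Field F]

theorem sim_one (J : Matrix N N F) :
    ((1 : GL N F) : Matrix N N F)ᵀ * J * ((1 : GL N F) : Matrix N N F) = ((1 : Fˣ) : F) • J := by
  simp

theorem sim_mul {J : Matrix N N F} (a b : GL N F) (c d : Fˣ)
    (hc : (a : Matrix N N F)ᵀ * J * (a : Matrix N N F) = (c : F) • J)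
    (hd : (b : Matrix N N F)ᵀ * J * (b : Matrix N N F) = (d : F) • J) :
    ((a * b : GL N F) : Matrix N N F)ᵀ * J * ((a * b : GL N F) : Matrix N N F)
      = ((c * d : Fˣ) : F) • J := by
  calc ((a * b : GL N F) : Matrix N N F)ᵀ * J * ((a * b : GL N F) : Matrix N N F)
      = (b : Matrix N N F)ᵀ * ((a : Matrix N N F)ᵀ * J * (a : Matrix N N F)) *
          (b : Matrix N N F) := by
        rw [show ((a * b : GL N F) : Matrix N N F) = (a : Matrix N N F) * b from rfl,
          transpose_mul]
        simp only [Matrix.mul_assoc]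
    _ = (b : Matrix N N F)ᵀ * ((c : F) • J) * (b : Matrix N N F) := by rw [hc]
    _ = (c : F) • ((b : Matrix N N F)ᵀ * J * (b : Matrix N N F)) := by
        rw [Matrix.mul_smul, Matrix.smul_mul]
    _ = (c : F) • ((d : F) • J) := by rw [hd]
    _ = ((c * d : Fˣ) : F) • J := by rw [smul_smul, Units.val_mul]

theorem sim_inv {J : Matrix N N F} (a : GL N F) (c : Fˣ)
    (hc : (a : Matrix N N F)ᵀ * J * (a : Matrix N N F) = (c : F) • J) :
    ((a⁻¹ : GL N F) : Matrix N N F)ᵀ * J * ((a⁻¹ : GL N F) : Matrix N N F)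
      = ((c⁻¹ : Fˣ) : F) • J := by
  have ht : ((a⁻¹ : GL N F) : Matrix N N F)ᵀ * (a : Matrix N N F)ᵀ = 1 := by
    rw [← transpose_mul, a.mul_inv, transpose_one]
  have key : ((a⁻¹ : GL N F) : Matrix N N F)ᵀ * ((a : Matrix N N F)ᵀ * J * (a : Matrix N N F)) *
      ((a⁻¹ : GL N F) : Matrix N N F) = J := by
    calc ((a⁻¹ : GL N F) : Matrix N N F)ᵀ * ((a : Matrix N N F)ᵀ * J * (a : Matrix N N F)) *
        ((a⁻¹ : GL N F) : Matrix N N F)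
        = (((a⁻¹ : GL N F) : Matrix N N F)ᵀ * (a : Matrix N N F)ᵀ) * J *
          ((a : Matrix N N F) * ((a⁻¹ : GL N F) : Matrix N N F)) := by
          simp only [Matrix.mul_assoc]
      _ = J := by rw [ht, a.mul_inv, Matrix.one_mul, Matrix.mul_one]
  have key2 : ((a⁻¹ : GL N F) : Matrix N N F)ᵀ * ((c : F) • J) * ((a⁻¹ : GL N F) : Matrix N N F)
      = (c : F) • (((a⁻¹ : GL N F) : Matrix N N F)ᵀ * J * ((a⁻¹ : GL N F) : Matrix N N F)) := by
    rw [Matrix.mul_smul, Matrix.smul_mul]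
  have h3 : (c : F) • (((a⁻¹ : GL N F) : Matrix N N F)ᵀ * J *
      ((a⁻¹ : GL N F) : Matrix N N F)) = J := by rw [← key2, ← hc, key]
  calc ((a⁻¹ : GL N F) : Matrix N N F)ᵀ * J * ((a⁻¹ : GL N F) : Matrix N N F)
      = ((c⁻¹ : Fˣ) : F) • ((c : F) • (((a⁻¹ : GL N F) : Matrix N N F)ᵀ * J *
          ((a⁻¹ : GL N F) : Matrix N N F))) := by
        rw [smul_smul, ← Units.val_mul, inv_mul_cancel, Units.val_one, one_smul]
    _ = ((c⁻¹ : Fˣ) : F) • J := by rw [h3]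

/-- The similitude group of the bilinear form given by the matrix `J`:  all invertible
matrices `g` with `gᵀ * J * g = c • J` for some nonzero scalar `c` (the similitude of `g`). -/
def similitudeGroup (J : Matrix N N F) : Subgroup (GL N F) where
  carrier := {g | ∃ c : Fˣ, (g : Matrix N N F)ᵀ * J * (g : Matrix N N F) = (c : F) • J}
  one_mem' := ⟨1, sim_one J⟩
  mul_mem' := by rintro a b ⟨c, hc⟩ ⟨d, hd⟩; exact ⟨c * d, sim_mul a b c d hc hd⟩
  inv_mem' := by rintro a ⟨c, hc⟩; exact ⟨c⁻¹, sim_inv a c hc⟩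

/-- The isometry group of the bilinear form given by the matrix `J`:  all invertible
matrices `g` with `gᵀ * J * g = J`. -/
def fixGroup (J : Matrix N N F) : Subgroup (GL N F) where
  carrier := {g | (g : Matrix N N F)ᵀ * J * (g : Matrix N N F) = J}
  one_mem' := by simp
  mul_mem' := by
    intro a b ha hb
    have := sim_mul (J := J) a b 1 1 (by simpa using ha) (by simpa using hb)
    simpa using this
  inv_mem' := by
    intro a ha
    have := sim_inv (J := J) a 1 (by simpa using ha)
    simpa using this

/-- The group of isometries of determinant one of the bilinear form given by the matrix `J`. -/
def specialFixGroup (J : Matrix N N F) : Subgroup (GL N F) where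
  carrier := {g | (g : Matrix N N F)ᵀ * J * (g : Matrix N N F) = J ∧
    ((g : Matrix N N F)).det = 1}
  one_mem' := ⟨by simp, by simp⟩
  mul_mem' := by
    rintro a b ⟨ha1, ha2⟩ ⟨hb1, hb2⟩
    refine ⟨(fixGroup J).mul_mem ha1 hb1, ?_⟩
    rw [show ((a * b : GL N F) : Matrix N N F) = (a : Matrix N N F) * b from rfl,
      Matrix.det_mul, ha2, hb2, one_mul]
  inv_mem' := by
    rintro a ⟨ha1, ha2⟩
    refine ⟨(fixGroup J).inv_mem ha1, ?_⟩
    have h := congrArg Matrix.det a.mul_inv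
    rw [Matrix.det_mul, ha2, one_mul, Matrix.det_one] at h
    exact h

/-- The connected component of the similitude group of the symmetric bilinear form on a
`2 * m`-dimensional space given by the matrix `J`:  all similitudes `g`, with similitude
character `μ`, such that `det g = μ(g) ^ m`. -/
def connSimilitudeGroup (J : Matrix N N F) (m : ℕ) : Subgroup (GL N F) where
  carrier := {g | ∃ c : Fˣ, (g : Matrix N N F)ᵀ * J * (g : Matrix N N F) = (c : F) • J ∧
    ((g : Matrix N N F)).det = (c : F) ^ m}
  one_mem' := ⟨1, sim_one J, by simp⟩
  mul_mem' := by
    rintro a b ⟨c, hc1, hc2⟩ ⟨d, hd1, hd2⟩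
    refine ⟨c * d, sim_mul a b c d hc1 hd1, ?_⟩
    rw [show ((a * b : GL N F) : Matrix N N F) = (a : Matrix N N F) * b from rfl,
      Matrix.det_mul, hc2, hd2, Units.val_mul, mul_pow]
  inv_mem' := by
    rintro a ⟨c, hc1, hc2⟩
    refine ⟨c⁻¹, sim_inv a c hc1, ?_⟩
    have h := congrArg Matrix.det a.mul_inv
    rw [Matrix.det_mul, hc2, Matrix.det_one] at h
    have hc : ((c : F) ^ m)⁻¹ = ((c⁻¹ : Fˣ) : F) ^ m := by
      rw [← inv_pow]
      norm_cast
    rw [← hc]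
    exact (inv_eq_of_mul_eq_one_right h).symm

theorem neg_one_mem_similitudeGroup (J : Matrix N N F) : (-1 : GL N F) ∈ similitudeGroup J := by
  refine ⟨1, ?_⟩
  have h : ((-1 : GL N F) : Matrix N N F) = -1 := by simp
  rw [h]
  simp

/-- The standard symplectic form matrix `[[0, I], [-I, 0]]`. -/
def Jsp (n : ℕ) (F : Type*) [Field F] : Matrix (Fin n ⊕ Fin n) (Fin n ⊕ Fin n) F :=
  Matrix.fromBlocks 0 1 (-1) 0

/-- The standard split symmetric form matrix `[[0, I], [I, 0]]`. -/
def Jsplit (n : ℕ) (F : Type*) [Field F] : Matrix (Fin n ⊕ Fin n) (Fin n ⊕ Fin n) F :=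
  Matrix.fromBlocks 0 1 1 0

/-- A symmetric matrix `J` of size `2n` is split if it is congruent to `[[0, I], [I, 0]]`. -/
def IsSplit {n : ℕ} (J : Matrix (Fin n ⊕ Fin n) (Fin n ⊕ Fin n) F) : Prop :=
  ∃ P : GL (Fin n ⊕ Fin n) F,
    (P : Matrix (Fin n ⊕ Fin n) (Fin n ⊕ Fin n) F)ᵀ * J * P = Jsplit n F

/-- The symplectic similitude group `GSp(2n, F)`. -/
def GSp (n : ℕ) (F : Type*) [Field F] : Subgroup (GL (Fin n ⊕ Fin n) F) :=
  similitudeGroup (Jsp n F)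

/-- The symplectic group `Sp(2n, F)`. -/
def Sp (n : ℕ) (F : Type*) [Field F] : Subgroup (GL (Fin n ⊕ Fin n) F) :=
  fixGroup (Jsp n F)


/-- The underlying matrix of an element of a matrix subgroup. -/
def matOf {S : Subgroup (GL N F)} (g : ↥S) : Matrix N N F := ((g : GL N F) : Matrix N N F)

end Groups

noncomputable instance subgroupFintype {G : Type*} [Group G] [Finite G] (S : Subgroup G) :
    Fintype S := Fintype.ofFinite _

section TraceFiniteOrder

variable {V : Type*} [AddCommGroup V] [Module ℂ V] [FiniteDimensional ℂ V]

theorem isInternal_eigenspace_of_pow_eq_one {L : Module.End ℂ V} {n : ℕ} (hn : n ≠ 0)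
    (hL : L ^ n = 1) : DirectSum.IsInternal (fun μ : ℂ => L.eigenspace μ) := by
  have hss : L.IsSemisimple := by
    apply Module.End.isSemisimple_of_squarefree_aeval_eq_zero
      (p := (Polynomial.X ^ n - 1 : Polynomial ℂ))
    · have : (Polynomial.X ^ n - 1 : Polynomial ℂ).Separable := by
        have := Polynomial.separable_X_pow_sub_C (F := ℂ) (n := n) 1
          (by exact_mod_cast hn) one_ne_zero
        simpa using this
      exact this.squarefree
    · simp [hL]
  exact DirectSum.isInternal_submodule_of_iSupIndep_of_iSup_eq_top
    L.eigenspaces_iSupIndep hss.iSup_eigenspace_eq_top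

theorem trace_eq_sum_finrank_eigenspace {L : Module.End ℂ V} {n : ℕ} (hn : n ≠ 0)
    (hL : L ^ n = 1) : ∃ s : Finset ℂ, (∀ μ ∈ s, μ ^ n = 1) ∧
      ∀ (f : Module.End ℂ V) (c : ℂ → ℂ), (∀ μ, ∀ v ∈ L.eigenspace μ, f v = c μ • v) →
        LinearMap.trace ℂ V f = ∑ μ ∈ s, (Module.finrank ℂ (L.eigenspace μ) : ℂ) * c μ := by
  have hint := isInternal_eigenspace_of_pow_eq_one hn hL
  have hfin : {μ : ℂ | L.eigenspace μ ≠ ⊥}.Finite :=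
    WellFoundedGT.finite_ne_bot_of_iSupIndep L.eigenspaces_iSupIndep
  refine ⟨hfin.toFinset, ?_, ?_⟩
  · intro μ hμ
    rw [Set.Finite.mem_toFinset] at hμ
    obtain ⟨v, hv, hv0⟩ := Submodule.exists_mem_ne_zero_of_ne_bot hμ
    have h : (L ^ n) v = μ ^ n • v :=
      Module.End.HasEigenvector.pow_apply ⟨hv, hv0⟩ n
    rw [hL, Module.End.one_apply] at h
    have h2 : (μ ^ n - 1) • v = 0 := by rw [sub_smul, ← h, one_smul, sub_self]
    exact sub_eq_zero.1 ((smul_eq_zero.1 h2).resolve_right hv0)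
  · intro f c hf
    have hmaps : ∀ μ, Set.MapsTo f (L.eigenspace μ) (L.eigenspace μ) := fun μ v hv => by
      rw [hf μ v hv]
      exact Submodule.smul_mem _ _ hv
    rw [LinearMap.trace_eq_sum_trace_restrict' hint hfin hmaps]
    refine Finset.sum_congr rfl fun μ _ => ?_
    have : f.restrict (hmaps μ) = c μ • LinearMap.id := by
      ext v
      exact hf μ v v.2
    rw [this, map_smul, LinearMap.trace_id, smul_eq_mul, mul_comm]

theorem isIntegral_of_pow_eq_one {z : ℂ} {n : ℕ} (hn : n ≠ 0) (h : z ^ n = 1) :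
    IsIntegral ℤ z :=
  IsIntegral.of_pow (Nat.pos_of_ne_zero hn) (h ▸ isIntegral_one)

theorem isIntegral_trace_of_pow_eq_one {L : Module.End ℂ V} {n : ℕ} (hn : n ≠ 0)
    (hL : L ^ n = 1) : IsIntegral ℤ (LinearMap.trace ℂ V L) := by
  obtain ⟨s, hs, h⟩ := trace_eq_sum_finrank_eigenspace hn hL
  rw [h L id fun μ v hv => Module.End.mem_eigenspace_iff.1 hv]
  refine IsIntegral.sum _ fun μ hμ => IsIntegral.mul ?_ (isIntegral_of_pow_eq_one hn (hs μ hμ))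
  exact_mod_cast isIntegral_algebraMap (R := ℤ) (A := ℂ) (x := (Module.finrank ℂ _ : ℤ))

theorem trace_eq_conj_trace_of_pow_eq_one {L L' : Module.End ℂ V} {n : ℕ} (hn : n ≠ 0)
    (hL : L ^ n = 1) (hL' : L' * L = 1) :
    LinearMap.trace ℂ V L' = (starRingEnd ℂ) (LinearMap.trace ℂ V L) := by
  obtain ⟨s, hs, h⟩ := trace_eq_sum_finrank_eigenspace hn hL
  rw [h L id fun μ v hv => Module.End.mem_eigenspace_iff.1 hv, map_sum,
    h L' (fun μ => μ⁻¹)]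
  · refine Finset.sum_congr rfl fun μ hμ => ?_
    have : (starRingEnd ℂ) μ = μ⁻¹ :=
      (Complex.inv_eq_conj (Complex.norm_eq_one_of_pow_eq_one (hs μ hμ) hn)).symm
    simp [this]
  · intro μ v hv
    have h1 : L v = μ • v := Module.End.mem_eigenspace_iff.1 hv
    have h2 : L' (L v) = v := by rw [← Module.End.mul_apply, hL', Module.End.one_apply]
    by_cases h0 : μ = 0
    · rw [h1, h0, zero_smul, map_zero] at h2
      simp [← h2]
    · rw [h1, map_smul] at h2
      rw [← h2, smul_smul, inv_mul_cancel₀ h0, one_smul, h2]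

theorem even_finrank_of_conjLinear {W : Type*} [AddCommGroup W] [Module ℂ W]
    [FiniteDimensional ℂ W] (K : W →ₛₗ[starRingEnd ℂ] W) (hK : ∀ w, K (K w) = -w) :
    Even (Module.finrank ℂ W) := by
  let b := Module.finBasis ℂ W
  let M : Matrix (Fin (Module.finrank ℂ W)) (Fin (Module.finrank ℂ W)) ℂ :=
    Matrix.of fun i j => b.repr (K (b j)) i
  have hKb : ∀ j, K (b j) = ∑ i, M i j • b i := fun j => (b.sum_repr (K (b j))).symm
  have hM : M * M.map (starRingEnd ℂ) = -1 := by
    ext i j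
    have h := hK (b j)
    rw [hKb j, map_sum] at h
    simp_rw [map_smulₛₗ, hKb, Finset.smul_sum, smul_smul] at h
    rw [Finset.sum_comm] at h
    simp_rw [← Finset.sum_smul] at h
    have h2 := congrArg (fun w => b.repr w i) h
    simp only [map_sum, map_smul, map_neg, Module.Basis.repr_self, Finsupp.coe_finsetSum,
      Finset.sum_apply, Finsupp.smul_apply, smul_eq_mul, Finsupp.neg_apply] at h2
    simp only [Finsupp.single_apply, mul_ite, mul_one, mul_zero, Finset.sum_ite_eq',
      Finset.mem_univ, if_true] at h2
    rw [Matrix.mul_apply, Matrix.neg_apply, Matrix.one_apply]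
    simp_rw [Matrix.map_apply, mul_comm (M i _)]
    rw [h2]
    simp only [eq_comm]
  have hdet := congrArg Matrix.det hM
  rw [Matrix.det_mul, ← RingHom.mapMatrix_apply, ← RingHom.map_det, Complex.mul_conj,
    Matrix.det_neg, Matrix.det_one, mul_one, Fintype.card_fin] at hdet
  by_contra hodd
  rw [Nat.not_even_iff_odd] at hodd
  rw [hodd.neg_one_pow] at hdet
  have h3 : Complex.normSq M.det = -1 := by exact_mod_cast hdet
  linarith [Complex.normSq_nonneg M.det]

theorem exists_trace_eq_two_mul {L L' : Module.End ℂ V} {n : ℕ} (hn : n ≠ 0)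
    (hL : L ^ n = 1) (hL' : L' * L = 1) (K : V →ₛₗ[starRingEnd ℂ] V)
    (hK : ∀ v, K (K v) = -v) (hKL : ∀ v, K (L v) = L' (K v)) :
    ∃ α : ℂ, IsIntegral ℤ α ∧ LinearMap.trace ℂ V L = 2 * α := by
  obtain ⟨s, hs, h⟩ := trace_eq_sum_finrank_eigenspace hn hL
  have hLL' : L * L' = 1 := mul_eq_one_comm.1 hL'
  have heven : ∀ μ ∈ s, Even (Module.finrank ℂ (L.eigenspace μ)) := by
    intro μ hμ
    have hμ1 := Complex.norm_eq_one_of_pow_eq_one (hs μ hμ) hn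
    have hmem : ∀ v ∈ L.eigenspace μ, K v ∈ L.eigenspace μ := by
      intro v hv
      rw [Module.End.mem_eigenspace_iff] at hv ⊢
      have h1 := hKL v
      rw [hv, map_smulₛₗ, ← Complex.inv_eq_conj hμ1] at h1
      have hμ0 : μ ≠ 0 := by
        rintro rfl
        simp at hμ1
      have h2 : K v = μ • L' (K v) := by
        rw [← h1, smul_smul, mul_inv_cancel₀ hμ0, one_smul]
      conv_lhs => rw [h2]
      rw [map_smul, ← Module.End.mul_apply, hLL', Module.End.one_apply]
    let K' : L.eigenspace μ →ₛₗ[starRingEnd ℂ] L.eigenspace μ :=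
      { toFun := fun v => ⟨K v, hmem v v.2⟩
        map_add' := fun v w => by ext; simp
        map_smul' := fun c v => by ext; simp }
    exact even_finrank_of_conjLinear K' fun v => by ext; simp [K', hK]
  refine ⟨∑ μ ∈ s, ((Module.finrank ℂ (L.eigenspace μ) / 2 : ℕ) : ℂ) * μ, ?_, ?_⟩
  · refine IsIntegral.sum _ fun μ hμ => IsIntegral.mul ?_ (isIntegral_of_pow_eq_one hn (hs μ hμ))
    exact_mod_cast isIntegral_algebraMap (R := ℤ) (A := ℂ)
      (x := ((Module.finrank ℂ (L.eigenspace μ) / 2 : ℕ) : ℤ))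
  · rw [h L id fun μ v hv => Module.End.mem_eigenspace_iff.1 hv, Finset.mul_sum]
    refine Finset.sum_congr rfl fun μ hμ => ?_
    have h2 : (Module.finrank ℂ (L.eigenspace μ) : ℂ)
        = 2 * ((Module.finrank ℂ (L.eigenspace μ) / 2 : ℕ) : ℂ) := by
      exact_mod_cast (Nat.mul_div_cancel' (heven μ hμ).two_dvd).symm
    rw [h2, id, mul_assoc]

end TraceFiniteOrder

section SignedRepresentations

variable {A : Type*} [Group A]

/-- The elements of sign `1` in a subgroup. -/
def evenPart (sgn : A →* ℤˣ) (E : Subgroup A) : Subgroup A := E ⊓ sgn.ker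

theorem mem_evenPart {sgn : A →* ℤˣ} {E : Subgroup A} {g : A} :
    g ∈ evenPart sgn E ↔ g ∈ E ∧ sgn g = 1 := Iff.rfl

theorem evenPart_mono (sgn : A →* ℤˣ) {M E : Subgroup A} (h : M ≤ E) :
    evenPart sgn M ≤ evenPart sgn E := inf_le_inf_right _ h

theorem mul_inv_mem_evenPart {sgn : A →* ℤˣ} {E : Subgroup A} {y z : A} (hy : y ∈ E)
    (hz : z ∈ E) (hyz : sgn y = sgn z) : y * z⁻¹ ∈ evenPart sgn E :=
  ⟨E.mul_mem hy (E.inv_mem hz), by simp [hyz]⟩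

theorem conj_mem_evenPart {sgn : A →* ℤˣ} {E : Subgroup A} {y h : A} (hy : y ∈ E)
    (hh : h ∈ evenPart sgn E) : y * h * y⁻¹ ∈ evenPart sgn E :=
  ⟨E.mul_mem (E.mul_mem hy hh.1) (E.inv_mem hy), by
    have : sgn h = 1 := hh.2
    simp [this]⟩

theorem mul_self_mem_evenPart {sgn : A →* ℤˣ} {E : Subgroup A} {y : A} (hy : y ∈ E) :
    y * y ∈ evenPart sgn E :=
  ⟨E.mul_mem hy hy, by simp⟩

variable {U : Type} [AddCommGroup U] [Module ℂ U]

/-- A function which restricts to a representation of the subgroup `H`. -/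
structure IsRep (H : Subgroup A) (ρ : A → Module.End ℂ U) : Prop where
  one : ρ 1 = 1
  mul : ∀ g ∈ H, ∀ h ∈ H, ρ (g * h) = ρ g * ρ h

/-- A function which restricts to an irreducible representation of the subgroup `H`. -/
structure IsSimpleRep (H : Subgroup A) (ρ : A → Module.End ℂ U) : Prop extends IsRep H ρ where
  nontrivial : Nontrivial U
  eq_bot_or_eq_top : ∀ W : Submodule ℂ U, (∀ h ∈ H, ∀ w ∈ W, ρ h w ∈ W) → W = ⊥ ∨ W = ⊤

/-- The function `ρ`, a representation of the even part of `E`, carries a semilinear structure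
of type `ε` (real for `ε = 1`, quaternionic for `ε = -1`) relative to the odd part of `E`. -/
def HasStr (sgn : A →* ℤˣ) (E : Subgroup A) (ε : ℤ) (ρ : A → Module.End ℂ U) : Prop :=
  ∃ y ∈ E, sgn y = -1 ∧ ∃ J : U →ₛₗ[starRingEnd ℂ] U,
    (∀ h ∈ evenPart sgn E, ∀ u, J (ρ h u) = ρ (y * h * y⁻¹) (J u)) ∧
    ∀ u, J (J u) = ε • ρ (y * y) u

/-- No irreducible representation of the even part of `E` is of quaternionic type. -/
def NoQuat (sgn : A →* ℤˣ) (E : Subgroup A) : Prop :=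
  ∀ (U : Type) [AddCommGroup U] [Module ℂ U] [FiniteDimensional ℂ U]
    (ρ : A → Module.End ℂ U), IsSimpleRep (evenPart sgn E) ρ → ¬ HasStr sgn E (-1) ρ

/-- Every even element of `E` is inverted by an odd element of `E`. -/
def IsStronglyReal (sgn : A →* ℤˣ) (E : Subgroup A) : Prop :=
  ∀ h ∈ evenPart sgn E, ∃ y ∈ E, sgn y = -1 ∧ y * h * y⁻¹ = h⁻¹

theorem IsRep.mono {M H : Subgroup A} (h : M ≤ H) {ρ : A → Module.End ℂ U} (hρ : IsRep H ρ) :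
    IsRep M ρ := ⟨hρ.one, fun a ha b hb => hρ.mul a (h ha) b (h hb)⟩

theorem IsRep.mul_apply {H : Subgroup A} {ρ : A → Module.End ℂ U} (hρ : IsRep H ρ) {g h : A}
    (hg : g ∈ H) (hh : h ∈ H) (u : U) : ρ (g * h) u = ρ g (ρ h u) := by
  rw [hρ.mul g hg h hh, Module.End.mul_apply]

theorem IsRep.one_apply {H : Subgroup A} {ρ : A → Module.End ℂ U} (hρ : IsRep H ρ) (u : U) :
    ρ 1 u = u := by
  rw [hρ.one, Module.End.one_apply]

theorem IsRep.inv_mul {H : Subgroup A} {ρ : A → Module.End ℂ U} (hρ : IsRep H ρ) {g : A}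
    (hg : g ∈ H) : ρ g⁻¹ * ρ g = 1 := by
  rw [← hρ.mul _ (H.inv_mem hg) _ hg, inv_mul_cancel, hρ.one]

theorem IsRep.mul_inv {H : Subgroup A} {ρ : A → Module.End ℂ U} (hρ : IsRep H ρ) {g : A}
    (hg : g ∈ H) : ρ g * ρ g⁻¹ = 1 := by
  rw [← hρ.mul _ hg _ (H.inv_mem hg), mul_inv_cancel, hρ.one]

theorem IsRep.inv_apply_self {H : Subgroup A} {ρ : A → Module.End ℂ U} (hρ : IsRep H ρ) {g : A}
    (hg : g ∈ H) (u : U) : ρ g⁻¹ (ρ g u) = u := by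
  rw [← Module.End.mul_apply, hρ.inv_mul hg, Module.End.one_apply]

theorem IsRep.self_inv_apply {H : Subgroup A} {ρ : A → Module.End ℂ U} (hρ : IsRep H ρ) {g : A}
    (hg : g ∈ H) (u : U) : ρ g (ρ g⁻¹ u) = u := by
  rw [← Module.End.mul_apply, hρ.mul_inv hg, Module.End.one_apply]

theorem IsRep.pow {H : Subgroup A} {ρ : A → Module.End ℂ U} (hρ : IsRep H ρ) {g : A}
    (hg : g ∈ H) (n : ℕ) : ρ (g ^ n) = ρ g ^ n := by
  induction n with
  | zero => simp [hρ.one]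
  | succ n ih => rw [pow_succ, pow_succ, hρ.mul _ (H.pow_mem hg n) _ hg, ih]

/-- The representation of the group `H` underlying a function `ρ`. -/
def IsRep.toRepresentation {H : Subgroup A} {ρ : A → Module.End ℂ U} (hρ : IsRep H ρ) :
    Representation ℂ H U where
  toFun h := ρ h
  map_one' := hρ.one
  map_mul' g h := hρ.mul g g.2 h h.2

theorem IsSimpleRep.isIrreducible {H : Subgroup A} {ρ : A → Module.End ℂ U}
    (hρ : IsSimpleRep H ρ) : hρ.toIsRep.toRepresentation.IsIrreducible := by
  have := hρ.nontrivial
  have : Nontrivial (Subrepresentation hρ.toIsRep.toRepresentation) :=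
    ⟨⊥, ⊤, fun h => bot_ne_top (α := Submodule ℂ U) (congrArg Subrepresentation.toSubmodule h)⟩
  refine ⟨fun W => ?_⟩
  rcases hρ.eq_bot_or_eq_top W.toSubmodule
      (fun h hh w hw => W.apply_mem_toSubmodule ⟨h, hh⟩ hw) with h | h
  · exact Or.inl (Subrepresentation.toSubmodule_injective h)
  · exact Or.inr (Subrepresentation.toSubmodule_injective h)

theorem HasStr.change {sgn : A →* ℤˣ} {E : Subgroup A} {ε : ℤ} {ρ : A → Module.End ℂ U}
    (hρ : IsRep (evenPart sgn E) ρ) (hs : HasStr sgn E ε ρ) {y : A} (hy : y ∈ E)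
    (hys : sgn y = -1) : ∃ J : U →ₛₗ[starRingEnd ℂ] U,
      (∀ h ∈ evenPart sgn E, ∀ u, J (ρ h u) = ρ (y * h * y⁻¹) (J u)) ∧
      ∀ u, J (J u) = ε • ρ (y * y) u := by
  obtain ⟨z, hz, hzs, J, hJ, hJJ⟩ := hs
  have hh := mul_inv_mem_evenPart hy hz (hys.trans hzs.symm)
  refine ⟨(ρ (y * z⁻¹)).comp J, fun g hg u => ?_, fun u => ?_⟩
  · rw [LinearMap.comp_apply, LinearMap.comp_apply, hJ g hg,
      ← hρ.mul_apply hh (conj_mem_evenPart hz hg),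
      ← hρ.mul_apply (conj_mem_evenPart hy hg) hh]
    congr 2
    group
  · rw [LinearMap.comp_apply, LinearMap.comp_apply, hJ _ hh, hJJ, map_zsmul, map_zsmul,
      ← hρ.mul_apply (conj_mem_evenPart hz hh) (mul_self_mem_evenPart hz),
      ← hρ.mul_apply hh ((evenPart sgn E).mul_mem (conj_mem_evenPart hz hh)
        (mul_self_mem_evenPart hz))]
    congr 3
    group

theorem HasStr.mono {sgn : A →* ℤˣ} {M E : Subgroup A} {ε : ℤ} {ρ : A → Module.End ℂ U}
    (hρ : IsRep (evenPart sgn E) ρ) (hs : HasStr sgn E ε ρ) (hM : M ≤ E) {y : A} (hy : y ∈ M)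
    (hys : sgn y = -1) : HasStr sgn M ε ρ := by
  obtain ⟨J, h1, h2⟩ := hs.change hρ (hM hy) hys
  exact ⟨y, hy, hys, J, fun h hh => h1 h (evenPart_mono sgn hM hh), h2⟩

theorem IsRep.trace_conj {H : Subgroup A} {ρ : A → Module.End ℂ U} (hρ : IsRep H ρ) {g h : A}
    (hg : g ∈ H) (hh : h ∈ H) :
    LinearMap.trace ℂ U (ρ (g * h * g⁻¹)) = LinearMap.trace ℂ U (ρ h) := by
  rw [hρ.mul _ (H.mul_mem hg hh) _ (H.inv_mem hg), LinearMap.trace_mul_comm,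
    ← hρ.mul _ (H.inv_mem hg) _ (H.mul_mem hg hh), inv_mul_cancel_left]

variable [FiniteDimensional ℂ U]

theorem IsSimpleRep.eq_smul_of_commute {H : Subgroup A} {ρ : A → Module.End ℂ U}
    (hρ : IsSimpleRep H ρ) (f : Module.End ℂ U) (hf : ∀ h ∈ H, ∀ u, f (ρ h u) = ρ h (f u)) :
    ∃ c : ℂ, ∀ u, f u = c • u := by
  have := hρ.nontrivial
  obtain ⟨c, hc⟩ := Module.End.exists_eigenvalue f
  refine ⟨c, fun u => ?_⟩
  rcases hρ.eq_bot_or_eq_top (f.eigenspace c) (fun h hh w hw => by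
    rw [Module.End.mem_eigenspace_iff] at hw ⊢
    rw [hf h hh, hw, map_smul]) with h | h
  · exact absurd h hc
  · exact Module.End.mem_eigenspace_iff.1 (h ▸ Submodule.mem_top)

variable [Fintype A]

theorem sum_filter_mem_eq {M : Type*} [AddCommMonoid M] (H : Subgroup A) (f : A → M)
    [Fintype H] : ∑ g with g ∈ H, f g = ∑ h : H, f h :=
  Finset.sum_subtype _ (by simp) f

theorem IsRep.isIntegral_trace {H : Subgroup A} {ρ : A → Module.End ℂ U} (hρ : IsRep H ρ) {g : A}
    (hg : g ∈ H) : IsIntegral ℤ (LinearMap.trace ℂ U (ρ g)) :=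
  isIntegral_trace_of_pow_eq_one (Fintype.card_ne_zero (α := A))
    (by rw [← hρ.pow hg, pow_card_eq_one, hρ.one])

theorem IsRep.trace_inv {H : Subgroup A} {ρ : A → Module.End ℂ U} (hρ : IsRep H ρ) {g : A}
    (hg : g ∈ H) : LinearMap.trace ℂ U (ρ g⁻¹) = starRingEnd ℂ (LinearMap.trace ℂ U (ρ g)) :=
  trace_eq_conj_trace_of_pow_eq_one (Fintype.card_ne_zero (α := A))
    (by rw [← hρ.pow hg, pow_card_eq_one, hρ.one]) (hρ.inv_mul hg)

theorem IsRep.sum_trace_mul_trace {V : Type} [AddCommGroup V] [Module ℂ V]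
    [FiniteDimensional ℂ V] {H : Subgroup A} {σ : A → Module.End ℂ U} {θ : A → Module.End ℂ V}
    (hσ : IsRep H σ) (hθ : IsRep H θ) :
    ∑ h with h ∈ H, LinearMap.trace ℂ V (θ h) * starRingEnd ℂ (LinearMap.trace ℂ U (σ h))
      = Nat.card H * Module.finrank ℂ
        (Representation.IntertwiningMap hσ.toRepresentation hθ.toRepresentation) := by
  have hne : (Nat.card H : ℂ) ≠ 0 := by exact_mod_cast Nat.card_pos.ne'
  have : Invertible (Nat.card H : ℂ) := invertibleOfNonzero hne
  rw [← Representation.card_inv_mul_sum_char_mul_char_eq_finrank, mul_inv_cancel_left₀ hne,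
    sum_filter_mem_eq]
  refine Finset.sum_congr rfl fun h _ => ?_
  rw [← hσ.trace_inv h.2]
  rfl

theorem IsSimpleRep.sum_normSq {H : Subgroup A} {ρ : A → Module.End ℂ U} (hρ : IsSimpleRep H ρ) :
    ∑ h with h ∈ H, Complex.normSq (LinearMap.trace ℂ U (ρ h)) = Nat.card H := by
  have h := hρ.toIsRep.sum_trace_mul_trace hρ.toIsRep
  have := hρ.isIrreducible
  rw [Representation.IsIrreducible.finrank_intertwiningMap_self] at h
  simp_rw [Complex.mul_conj] at h
  simpa using (by exact_mod_cast h :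
    ∑ h with h ∈ H, Complex.normSq (LinearMap.trace ℂ U (ρ h)) = Nat.card H * 1)

end SignedRepresentations

section SignedSchur

variable {A : Type*} {U : Type} [AddCommGroup U] [Module ℂ U]

/-- The compression of a function `ρ` with values in endomorphisms to a subspace. -/
def compressRep (W : Submodule ℂ U) (ρ : A → Module.End ℂ U) (g : A) : Module.End ℂ W :=
  (Classical.choose (LinearMap.exists_leftInverse_of_injective W.subtype W.ker_subtype)).comp
    ((ρ g).comp W.subtype)

theorem compressRep_apply {W : Submodule ℂ U} {ρ : A → Module.End ℂ U} {g : A}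
    (hg : ∀ w ∈ W, ρ g w ∈ W) (w : W) : (compressRep W ρ g w : U) = ρ g w := by
  have h := Classical.choose_spec
    (LinearMap.exists_leftInverse_of_injective W.subtype W.ker_subtype)
  exact congrArg Subtype.val (LinearMap.congr_fun h ⟨ρ g w, hg w w.2⟩)

variable [Group A]

theorem IsRep.compress {H : Subgroup A} {ρ : A → Module.End ℂ U} (hρ : IsRep H ρ)
    {W : Submodule ℂ U} (hW : ∀ h ∈ H, ∀ w ∈ W, ρ h w ∈ W) : IsRep H (compressRep W ρ) := by
  refine ⟨?_, fun g hg h hh => ?_⟩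
  · ext w
    rw [compressRep_apply (hW 1 H.one_mem), hρ.one]
    rfl
  · ext w
    rw [compressRep_apply (hW _ (H.mul_mem hg hh)), hρ.mul g hg h hh, Module.End.mul_apply,
      Module.End.mul_apply, compressRep_apply (hW g hg), compressRep_apply (hW h hh)]

theorem exists_simple_sub [FiniteDimensional ℂ U] {H : Subgroup A} {ρ : A → Module.End ℂ U}
    (hρ : IsRep H ρ) {W₀ : Submodule ℂ U} (h0 : W₀ ≠ ⊥) (hW₀ : ∀ h ∈ H, ∀ w ∈ W₀, ρ h w ∈ W₀) :
    ∃ W ≤ W₀, W ≠ ⊥ ∧ (∀ h ∈ H, ∀ w ∈ W, ρ h w ∈ W) ∧ IsSimpleRep H (compressRep W ρ) := by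
  obtain ⟨W, ⟨hle, hne, hst⟩, hmin⟩ := (wellFounded_lt (α := Submodule ℂ U)).has_min
    {W | W ≤ W₀ ∧ W ≠ ⊥ ∧ ∀ h ∈ H, ∀ w ∈ W, ρ h w ∈ W} ⟨W₀, le_rfl, h0, hW₀⟩
  refine ⟨W, hle, hne, hst, hρ.compress hst, (Submodule.nontrivial_iff_ne_bot).2 hne,
    fun S hS => ?_⟩
  by_contra! hcon
  have hSW : S.map W.subtype ≤ W := Submodule.map_subtype_le W S
  refine hmin (S.map W.subtype) ⟨hSW.trans hle, ?_, ?_⟩ (lt_of_le_of_ne hSW ?_)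
  · exact ((Submodule.map_injective_of_injective W.injective_subtype).ne_iff'
      (Submodule.map_bot _)).2 hcon.1
  · rintro h hh _ ⟨w, hw, rfl⟩
    exact ⟨compressRep W ρ h w, hS h hh w hw, compressRep_apply (hst h hh) w⟩
  · intro heq
    refine hcon.2 (Submodule.map_injective_of_injective W.injective_subtype ?_)
    rw [heq, Submodule.map_subtype_top]

theorem IsStronglyReal.trace_eq {sgn : A →* ℤˣ} {E : Subgroup A} (hE : IsStronglyReal sgn E)
    {ρ : A → Module.End ℂ U} (hρ : IsRep (evenPart sgn E) ρ) {y : A} (hy : y ∈ E)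
    (hys : sgn y = -1) : ∀ h ∈ evenPart sgn E,
      LinearMap.trace ℂ U (ρ (y * h * y⁻¹)) = LinearMap.trace ℂ U (ρ h⁻¹) := by
  intro h hh
  obtain ⟨z, hz, hzs, hzh⟩ := hE h hh
  rw [← hzh, ← hρ.trace_conj (mul_inv_mem_evenPart hy hz (hys.trans hzs.symm))
    (conj_mem_evenPart hz hh)]
  congr 2
  group

variable [FiniteDimensional ℂ U] [Fintype A]

theorem IsSimpleRep.exists_semilinear {sgn : A →* ℤˣ} {E : Subgroup A} {ρ : A → Module.End ℂ U}
    (hρ : IsSimpleRep (evenPart sgn E) ρ) {y : A} (hy : y ∈ E)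
    (hχ : ∀ h ∈ evenPart sgn E,
      LinearMap.trace ℂ U (ρ (y * h * y⁻¹)) = LinearMap.trace ℂ U (ρ h⁻¹)) :
    ∃ J : U →ₛₗ[starRingEnd ℂ] U, J ≠ 0 ∧
      ∀ h ∈ evenPart sgn E, ∀ u, J (ρ h u) = ρ (y * h * y⁻¹) (J u) := by
  set H := evenPart sgn E with hH
  let avg : (U →ₛₗ[starRingEnd ℂ] U) → (U →ₛₗ[starRingEnd ℂ] U) := fun M =>
    ∑ h with h ∈ H, (ρ (y * h * y⁻¹)).comp (M.comp (ρ h⁻¹))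
  have havg : ∀ M, ∀ g ∈ H, ∀ u, avg M (ρ g u) = ρ (y * g * y⁻¹) (avg M u) := by
    intro M g hg u
    simp only [avg, LinearMap.sum_apply, map_sum, LinearMap.comp_apply]
    refine (Finset.sum_equiv (Equiv.mulLeft g) (fun h => ?_) (fun h hh => ?_)).symm
    · simp [H.mul_mem_cancel_left hg]
    · have hh' : h ∈ H := by simpa using hh
      rw [Equiv.coe_mulLeft, ← hρ.mul_apply (H.inv_mem (H.mul_mem hg hh')) hg,
        ← hρ.mul_apply (conj_mem_evenPart hy hg) (conj_mem_evenPart hy hh')]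
      simp [mul_assoc]
  by_contra! hcon
  have hzero : ∀ M, avg M = 0 := fun M => by
    by_contra hne
    obtain ⟨h, hh, u, hu⟩ := hcon (avg M) hne
    exact hu (havg M h hh u)
  let b := Module.finBasis ℂ U
  let M : (i j : Fin (Module.finrank ℂ U)) → (U →ₛₗ[starRingEnd ℂ] U) := fun k l =>
    { toFun := fun u => starRingEnd ℂ (b.repr u l) • b k
      map_add' := fun u v => by simp [add_smul]
      map_smul' := fun c u => by simp [mul_smul] }
  have hM : ∀ k l u, M k l u = starRingEnd ℂ (b.repr u l) • b k := fun _ _ _ => rfl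
  have htr : ∀ f : Module.End ℂ U, LinearMap.trace ℂ U f = ∑ k, b.repr (f (b k)) k := fun f => by
    rw [LinearMap.trace_eq_matrix_trace ℂ b, Matrix.trace]
    simp [LinearMap.toMatrix_apply]
  have h1 : ∑ k, ∑ l, b.repr (avg (M k l) (b l)) k = 0 := by simp [hzero]
  have h2 : ∀ k l, b.repr (avg (M k l) (b l)) k = ∑ h with h ∈ H,
      starRingEnd ℂ (b.repr (ρ h⁻¹ (b l)) l) * b.repr (ρ (y * h * y⁻¹) (b k)) k := by
    intro k l
    simp [avg, hM, LinearMap.sum_apply, map_sum, Finsupp.finsetSum_apply]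
  have h3 : ∑ h with h ∈ H, Complex.normSq (LinearMap.trace ℂ U (ρ h)) = 0 := by
    have h4 : ∑ h with h ∈ H, starRingEnd ℂ (LinearMap.trace ℂ U (ρ h⁻¹)) *
        LinearMap.trace ℂ U (ρ (y * h * y⁻¹)) = 0 := by
      rw [← h1]
      simp_rw [h2, htr, map_sum, Finset.sum_mul_sum]
      conv_rhs => rw [Finset.sum_comm]
      rw [Finset.sum_comm]
      refine Finset.sum_congr rfl fun k _ => ?_
      rw [Finset.sum_comm]
    have h5 : ∑ h with h ∈ H, (Complex.normSq (LinearMap.trace ℂ U (ρ h)) : ℂ) = 0 := by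
      rw [← h4]
      refine Finset.sum_congr rfl fun h hh => ?_
      have hh' : h ∈ H := by simpa using hh
      rw [hχ h hh', hρ.trace_inv hh', Complex.conj_conj, Complex.mul_conj]
    exact_mod_cast h5
  rw [hρ.sum_normSq] at h3
  exact Nat.card_pos.ne' (by exact_mod_cast h3 : Nat.card H = 0)

/-- A self-dual irreducible representation is of real or quaternionic type. -/
theorem IsSimpleRep.hasStr_or {sgn : A →* ℤˣ} {E : Subgroup A} {ρ : A → Module.End ℂ U}
    (hρ : IsSimpleRep (evenPart sgn E) ρ) {y : A} (hy : y ∈ E) (hys : sgn y = -1)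
    (hχ : ∀ h ∈ evenPart sgn E,
      LinearMap.trace ℂ U (ρ (y * h * y⁻¹)) = LinearMap.trace ℂ U (ρ h⁻¹)) :
    HasStr sgn E 1 ρ ∨ HasStr sgn E (-1) ρ := by
  obtain ⟨J, hJ0, hJ⟩ := hρ.exists_semilinear hy hχ
  have hyy := mul_self_mem_evenPart (sgn := sgn) hy
  have hinj : ∀ u, J u = 0 → u = 0 := by
    rcases hρ.eq_bot_or_eq_top (LinearMap.ker J) (fun h hh w hw => by
      rw [LinearMap.mem_ker] at hw ⊢
      rw [hJ h hh, hw, map_zero]) with h | h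
    · exact fun u hu => (Submodule.mem_bot ℂ).1 (h ▸ LinearMap.mem_ker.2 hu)
    · exact absurd (LinearMap.ker_eq_top.1 h) hJ0
  obtain ⟨c, hc⟩ := hρ.eq_smul_of_commute ((ρ (y * y)⁻¹).comp (J.comp J)) (fun h hh u => by
    rw [LinearMap.comp_apply, LinearMap.comp_apply, LinearMap.comp_apply, LinearMap.comp_apply,
      hJ h hh, hJ _ (conj_mem_evenPart hy hh),
      ← hρ.mul_apply (inv_mem hyy) (conj_mem_evenPart hy (conj_mem_evenPart hy hh)),
      ← hρ.mul_apply hh (inv_mem hyy)]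
    congr 2
    group)
  have hJJ : ∀ u, J (J u) = c • ρ (y * y) u := fun u => by
    have h := congrArg (ρ (y * y)) (hc u)
    rwa [LinearMap.comp_apply, LinearMap.comp_apply, hρ.self_inv_apply hyy, map_smul] at h
  have := hρ.nontrivial
  obtain ⟨u, hu⟩ := exists_ne (0 : U)
  have hJu : J u ≠ 0 := fun h => hu (hinj u h)
  have hc0 : c ≠ 0 := by
    rintro rfl
    have := hJJ u
    rw [zero_smul] at this
    exact hJu (hinj _ this)
  have hcr : starRingEnd ℂ c = c := by
    have h1 := hJJ (J u)
    rw [hJJ u, map_smulₛₗ, hJ _ hyy, show y * (y * y) * y⁻¹ = y * y by group] at h1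
    have h2 : ρ (y * y) (J u) ≠ 0 := fun h => hJu (by
      rw [← hρ.inv_apply_self hyy (J u), h, map_zero])
    rw [← sub_eq_zero, ← sub_smul] at h1
    exact sub_eq_zero.1 ((smul_eq_zero.1 h1).resolve_right h2)
  obtain ⟨r, rfl⟩ := Complex.conj_eq_iff_real.1 hcr
  have hr0 : r ≠ 0 := by exact_mod_cast hc0
  have hs : 0 < |r| := abs_pos.2 hr0
  have key : ∀ ε : ℤ, r = ε * |r| → HasStr sgn E ε ρ := by
    intro ε hε
    refine ⟨y, hy, hys, (((Real.sqrt |r|)⁻¹ : ℝ) : ℂ) • J, fun h hh u => ?_, fun u => ?_⟩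
    · rw [LinearMap.smul_apply, LinearMap.smul_apply, hJ h hh, map_smul]
    · rw [LinearMap.smul_apply, LinearMap.smul_apply, map_smulₛₗ, Complex.conj_ofReal, hJJ,
        smul_smul, smul_smul, ← Int.cast_smul_eq_zsmul ℂ]
      congr 1
      have h2 : (Real.sqrt |r|)⁻¹ * (Real.sqrt |r|)⁻¹ * r = ε := by
        rw [← mul_inv, Real.mul_self_sqrt hs.le]
        nth_rewrite 2 [hε]
        field_simp
      exact_mod_cast h2
  rcases lt_or_gt_of_ne hr0 with h | h
  · exact Or.inr (key (-1) (by rw [abs_of_neg h]; simp))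
  · exact Or.inl (key 1 (by rw [abs_of_pos h]; simp))

end SignedSchur

section SignTransfer

variable {A : Type*} [Group A] [Fintype A] {sgn : A →* ℤˣ}

theorem card_evenPart_le {M E : Subgroup A} (hME : M ≤ E)
    (hidx : ∀ g ∈ E, ∀ h ∈ E, g ∉ M → h ∉ M → g * h⁻¹ ∈ M) :
    Nat.card (evenPart sgn E) ≤ 2 * Nat.card (evenPart sgn M) := by
  simp only [Nat.card_eq_fintype_card, Fintype.card_subtype]
  have hsub : (Finset.univ.filter (· ∈ evenPart sgn M)).card +
      (Finset.univ.filter (fun g => g ∈ evenPart sgn E ∧ g ∉ M)).card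
        = (Finset.univ.filter (· ∈ evenPart sgn E)).card := by
    rw [← Finset.card_filter_add_card_filter_not (s := Finset.univ.filter (· ∈ evenPart sgn E))
      (· ∈ M), Finset.filter_filter, Finset.filter_filter]
    congr 2
    ext g
    simp only [Finset.mem_filter, mem_evenPart]
    constructor
    · rintro ⟨h0, h1, h2⟩
      exact ⟨h0, ⟨hME h1, h2⟩, h1⟩
    · rintro ⟨h0, ⟨-, h1⟩, h2⟩
      exact ⟨h0, h2, h1⟩
  rw [← hsub, two_mul]
  refine Nat.add_le_add_left ?_ _
  rcases (Finset.univ.filter (fun g => g ∈ evenPart sgn E ∧ g ∉ M)).eq_empty_or_nonempty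
    with h | ⟨g₀, hg₀⟩
  · simp [h]
  · refine Finset.card_le_card_of_injOn (· * g₀⁻¹) (fun g hg => ?_)
      (fun a _ b _ hab => mul_right_cancel hab)
    simp only [Finset.mem_filter, Finset.mem_univ, true_and, Finset.coe_filter,
      Set.mem_ofPred_eq] at hg hg₀ ⊢
    refine ⟨hidx g hg.1.1 g₀ hg₀.1.1 hg.2 hg₀.2, ?_⟩
    have h1 : sgn g = 1 := hg.1.2
    have h2 : sgn g₀ = 1 := hg₀.1.2
    simp [h1, h2]

variable {U V : Type} [AddCommGroup U] [Module ℂ U] [FiniteDimensional ℂ U]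
  [AddCommGroup V] [Module ℂ V] [FiniteDimensional ℂ V]

theorem finrank_intertwiningMap_le_one {M E : Subgroup A} (hME : M ≤ E)
    (hidx : ∀ g ∈ E, ∀ h ∈ E, g ∉ M → h ∉ M → g * h⁻¹ ∈ M)
    {σ : A → Module.End ℂ U} (hσ : IsSimpleRep (evenPart sgn M) σ)
    {θ : A → Module.End ℂ V} (hθ : IsSimpleRep (evenPart sgn E) θ) :
    Module.finrank ℂ (Representation.IntertwiningMap hσ.toIsRep.toRepresentation
      (hθ.toIsRep.mono (evenPart_mono sgn hME)).toRepresentation) ≤ 1 := by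
  set k := Module.finrank ℂ (Representation.IntertwiningMap hσ.toIsRep.toRepresentation
      (hθ.toIsRep.mono (evenPart_mono sgn hME)).toRepresentation) with hk
  have h1 := hσ.toIsRep.sum_trace_mul_trace (hθ.toIsRep.mono (evenPart_mono sgn hME))
  rw [← hk] at h1
  set n := Nat.card (evenPart sgn M) with hn
  have h2 : ((n * k : ℕ) : ℝ) ≤ ∑ h with h ∈ evenPart sgn M,
      ‖LinearMap.trace ℂ V (θ h)‖ * ‖LinearMap.trace ℂ U (σ h)‖ := by
    have h3 : ((n * k : ℕ) : ℝ) = ‖(n : ℂ) * k‖ := by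
      rw [← Nat.cast_mul, Complex.norm_natCast]
    rw [h3, ← h1]
    refine (norm_sum_le _ _).trans (Finset.sum_le_sum fun h _ => ?_)
    rw [norm_mul, Complex.norm_conj]
  have h4 : ∑ h with h ∈ evenPart sgn M, ‖LinearMap.trace ℂ U (σ h)‖ ^ 2 = n := by
    rw [← hσ.sum_normSq]
    exact Finset.sum_congr rfl fun h _ => (Complex.normSq_eq_norm_sq _).symm
  have h5 : ∑ h with h ∈ evenPart sgn M, ‖LinearMap.trace ℂ V (θ h)‖ ^ 2 ≤ 2 * n := by
    have h6 : (Nat.card (evenPart sgn E) : ℝ) ≤ 2 * n := by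
      exact_mod_cast card_evenPart_le hME hidx
    refine le_trans ?_ h6
    rw [← hθ.sum_normSq]
    simp_rw [Complex.normSq_eq_norm_sq]
    refine Finset.sum_le_sum_of_subset_of_nonneg (fun h hh => ?_) fun _ _ _ => sq_nonneg _
    simp only [Finset.mem_filter, Finset.mem_univ, true_and] at hh ⊢
    exact evenPart_mono sgn hME hh
  have h7 := Finset.sum_mul_sq_le_sq_mul_sq (Finset.univ.filter (· ∈ evenPart sgn M))
    (fun h => ‖LinearMap.trace ℂ V (θ h)‖) (fun h => ‖LinearMap.trace ℂ U (σ h)‖)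
  rw [h4] at h7
  have hn0 : 0 < n := Nat.card_pos
  have h8 : ((n * k : ℕ) : ℝ) ^ 2 ≤ 2 * n * n :=
    (pow_le_pow_left₀ (by positivity) h2 2).trans
      (h7.trans (mul_le_mul_of_nonneg_right h5 (by positivity)))
  have h9 : (n * k) ^ 2 ≤ 2 * n * n := by exact_mod_cast h8
  by_contra! hcon
  have : 4 * (n * n) ≤ (n * k) ^ 2 := by nlinarith [Nat.mul_le_mul_left n hcon]
  nlinarith

/-- Irreducible representations of a group and of a subgroup of index at most two which are linked
by a nonzero intertwining map have the same type. -/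
theorem hasStr_sign_eq {M E : Subgroup A} (hME : M ≤ E)
    (hidx : ∀ g ∈ E, ∀ h ∈ E, g ∉ M → h ∉ M → g * h⁻¹ ∈ M)
    {σ : A → Module.End ℂ U} (hσ : IsSimpleRep (evenPart sgn M) σ)
    {θ : A → Module.End ℂ V} (hθ : IsSimpleRep (evenPart sgn E) θ)
    {φ : U →ₗ[ℂ] V} (hφ0 : φ ≠ 0) (hφ : ∀ h ∈ evenPart sgn M, ∀ u, φ (σ h u) = θ h (φ u))
    {ε ε' : ℤ} (hε : ε' * ε = -1) (hσs : HasStr sgn M ε σ) (hθs : HasStr sgn E ε' θ) : False := by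
  have hle := finrank_intertwiningMap_le_one hME hidx hσ hθ
  obtain ⟨y, hy, hys, Jσ, hJσ, hJJσ⟩ := hσs
  obtain ⟨Jθ, hJθ, hJJθ⟩ := hθs.change hθ.toIsRep (hME hy) hys
  have hyy := mul_self_mem_evenPart (sgn := sgn) hy
  have hsub := evenPart_mono sgn hME
  set Hom := Representation.IntertwiningMap hσ.toIsRep.toRepresentation
      (hθ.toIsRep.mono (evenPart_mono sgn hME)).toRepresentation
  let φ₁ : Hom := LinearMap.intertwiningMap_of_isIntertwiningMap _ _ φ fun h u => hφ h h.2 u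
  let ψ : U →ₗ[ℂ] V := Jθ.comp (φ.comp (Jσ.comp (σ (y * y)⁻¹)))
  let ψ₁ : Hom := LinearMap.intertwiningMap_of_isIntertwiningMap _ _ ψ fun h u => by
    change Jθ (φ (Jσ (σ (y * y)⁻¹ (σ h u)))) = θ h (Jθ (φ (Jσ (σ (y * y)⁻¹ u))))
    have hh1 : y⁻¹ * h * y ∈ evenPart sgn M := by
      have := conj_mem_evenPart (M.inv_mem hy) h.2
      rwa [inv_inv] at this
    have hh2 := conj_mem_evenPart (M.inv_mem hy) hh1
    rw [inv_inv] at hh2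
    rw [← hσ.mul_apply (inv_mem hyy) h.2,
      show (y * y)⁻¹ * (h : A) = y⁻¹ * (y⁻¹ * h * y) * y * (y * y)⁻¹ by group,
      hσ.mul_apply hh2 (inv_mem hyy), hJσ _ hh2,
      show y * (y⁻¹ * (y⁻¹ * (h : A) * y) * y) * y⁻¹ = y⁻¹ * h * y by group, hφ _ hh1,
      hJθ _ (hsub hh1)]
    congr 2
    group
  have hφ₁ : φ₁ ≠ 0 := fun h => hφ0 (congrArg Representation.IntertwiningMap.toLinearMap h)
  obtain ⟨c, hc⟩ := (finrank_le_one_iff.1 hle : ∃ v : Hom, ∀ w : Hom, ∃ c : ℂ, c • v = w)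
  obtain ⟨a, ha⟩ := hc φ₁
  obtain ⟨b, hb⟩ := hc ψ₁
  have ha0 : a ≠ 0 := by
    rintro rfl
    exact hφ₁ (by rw [← ha, zero_smul])
  have hψφ : ∀ u, ψ u = (b / a) • φ u := fun u => by
    have : ψ₁ = (b / a) • φ₁ := by
      rw [← ha, ← hb, smul_smul, div_mul_cancel₀ _ ha0]
    exact congrArg (fun f : Hom => f.toLinearMap u) this
  set d := b / a
  have h1 : ∀ u, Jθ (φ (Jσ u)) = d • φ (σ (y * y) u) := fun u => by
    rw [← hψφ]
    change _ = Jθ (φ (Jσ (σ (y * y)⁻¹ (σ (y * y) u))))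
    rw [hσ.inv_apply_self hyy]
  obtain ⟨u, hu⟩ : ∃ u, φ u ≠ 0 := by
    by_contra! hcon
    exact hφ0 (LinearMap.ext hcon)
  have h2 : ∀ u, Jθ (Jθ (φ (Jσ (Jσ u)))) = (starRingEnd ℂ d * d) • φ (σ (y * y * (y * y)) u) := by
    intro u
    rw [h1, map_smulₛₗ, hφ _ hyy, hJθ _ (hsub hyy), h1, map_smul, smul_smul,
      show y * (y * y) * y⁻¹ = y * y by group, ← hφ _ hyy, ← hσ.mul_apply hyy hyy]
  have h3 := h2 (σ (y * y * (y * y))⁻¹ u)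
  have hyyyy := mul_mem hyy hyy
  rw [hJJθ, hJJσ, map_zsmul, map_zsmul, smul_smul, hε, hφ _ hyy,
    ← hθ.mul_apply (hsub hyy) (hsub hyy),
    ← hφ _ hyyyy, hσ.self_inv_apply hyyyy, mul_comm, Complex.mul_conj, neg_smul, one_smul,
    ← neg_one_smul ℂ, ← sub_eq_zero, ← sub_smul] at h3
  have h4 := (smul_eq_zero.1 h3).resolve_right hu
  have h5 : (-1 : ℝ) - Complex.normSq d = 0 := by exact_mod_cast h4
  linarith [Complex.normSq_nonneg d]

end SignTransfer

section NoQuatTransfer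

theorem noQuat_of_index_le_two {A : Type*} [Group A] [Fintype A] {sgn : A →* ℤˣ}
    {M E : Subgroup A} (hME : M ≤ E)
    (hidx : ∀ g ∈ E, ∀ h ∈ E, g ∉ M → h ∉ M → g * h⁻¹ ∈ M) {y : A} (hy : y ∈ M)
    (hys : sgn y = -1) (hreal : IsStronglyReal sgn M) (hM : NoQuat sgn M) : NoQuat sgn E := by
  intro U _ _ _ θ hθ hθs
  have hθM := hθ.toIsRep.mono (evenPart_mono sgn hME)
  have := hθ.nontrivial
  obtain ⟨W, -, hW0, hW, hσ⟩ := exists_simple_sub hθM (W₀ := ⊤) top_ne_bot (by simp)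
  rcases hσ.hasStr_or hy hys (hreal.trace_eq hσ.toIsRep hy hys) with h | h
  · refine hasStr_sign_eq hME hidx hσ hθ (φ := W.subtype) ?_
      (fun h hh u => compressRep_apply (hW h hh) u) (ε := 1) (ε' := -1) (by norm_num) h hθs
    intro h0
    obtain ⟨w, hw, hw0⟩ := Submodule.exists_mem_ne_zero_of_ne_bot hW0
    exact hw0 (LinearMap.congr_fun h0 ⟨w, hw⟩)
  · exact hM W _ hσ h

theorem exists_intertwiner_symm {A : Type*} [Group A] [Fintype A] {H : Subgroup A}
    {U V : Type} [AddCommGroup U] [Module ℂ U] [FiniteDimensional ℂ U]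
    [AddCommGroup V] [Module ℂ V] [FiniteDimensional ℂ V]
    {σ : A → Module.End ℂ U} (hσ : IsRep H σ) {θ : A → Module.End ℂ V} (hθ : IsRep H θ)
    {φ : U →ₗ[ℂ] V} (hφ0 : φ ≠ 0) (hφ : ∀ h ∈ H, ∀ u, φ (σ h u) = θ h (φ u)) :
    ∃ ψ : V →ₗ[ℂ] U, ψ ≠ 0 ∧ ∀ h ∈ H, ∀ u, ψ (θ h u) = σ h (ψ u) := by
  have h1 := hσ.sum_trace_mul_trace hθ
  have h2 := hθ.sum_trace_mul_trace hσ
  have h3 := congrArg (starRingEnd ℂ) h1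
  simp only [map_sum, map_mul, Complex.conj_conj, map_natCast] at h3
  have hc : (Nat.card H : ℂ) ≠ 0 := by exact_mod_cast Nat.card_pos.ne'
  have h4 : Module.finrank ℂ (Representation.IntertwiningMap hσ.toRepresentation
      hθ.toRepresentation) = Module.finrank ℂ (Representation.IntertwiningMap
      hθ.toRepresentation hσ.toRepresentation) := by
    have h5 := h3.symm.trans ((Finset.sum_congr rfl fun h _ => mul_comm _ _).trans h2)
    exact_mod_cast mul_left_cancel₀ hc h5
  let φ₁ : Representation.IntertwiningMap hσ.toRepresentation hθ.toRepresentation :=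
    LinearMap.intertwiningMap_of_isIntertwiningMap _ _ φ fun h u => hφ h h.2 u
  have hφ₁ : φ₁ ≠ 0 := fun h => hφ0 (congrArg Representation.IntertwiningMap.toLinearMap h)
  have h6 : Module.Finite ℂ (Representation.IntertwiningMap hσ.toRepresentation
      hθ.toRepresentation) := Module.Finite.equiv
    (Representation.invariantsEquivIntertwiningMap hσ.toRepresentation hθ.toRepresentation)
  have h7 := (Module.finrank_pos_iff_exists_ne_zero (R := ℂ)).2 ⟨φ₁, hφ₁⟩
  rw [h4] at h7
  have h8 := Module.nontrivial_of_finrank_pos h7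
  obtain ⟨ψ, hψ⟩ := exists_ne (0 : Representation.IntertwiningMap
      hθ.toRepresentation hσ.toRepresentation)
  refine ⟨ψ.toLinearMap, fun h => hψ (Representation.IntertwiningMap.ext h), fun h hh u => ?_⟩
  exact LinearMap.congr_fun (ψ.isIntertwining' ⟨h, hh⟩) u

theorem noQuat_of_le_index_two {A : Type} [Group A] [Fintype A] {sgn : A →* ℤˣ}
    {M E : Subgroup A} (hME : M ≤ E)
    (hidx : ∀ g ∈ E, ∀ h ∈ E, g ∉ M → h ∉ M → g * h⁻¹ ∈ M) {y : A} (hy : y ∈ M)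
    (hys : sgn y = -1) (hreal : IsStronglyReal sgn E) (hE : NoQuat sgn E) : NoQuat sgn M := by
  intro U _ _ _ σ hσ hσs
  let ρ : A → Module.End ℂ (A → U) := fun g => LinearMap.funLeft ℂ U (· * g)
  have hρ : IsRep (evenPart sgn E) ρ := by
    refine ⟨?_, fun g _ h _ => ?_⟩
    · ext f x
      simp [ρ, LinearMap.funLeft]
    · apply LinearMap.ext
      intro f
      funext x
      simp [ρ, LinearMap.funLeft, mul_assoc]
  let X : Submodule ℂ (A → U) :=
    { carrier := {f | (∀ g ∈ evenPart sgn M, ∀ x, f (g * x) = σ g (f x)) ∧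
        ∀ x, x ∉ evenPart sgn E → f x = 0}
      zero_mem' := by simp
      add_mem' := by
        rintro f f' ⟨h1, h2⟩ ⟨h3, h4⟩
        refine ⟨fun g hg x => ?_, fun x hx => ?_⟩
        · simp [h1 g hg, h3 g hg]
        · simp [h2 x hx, h4 x hx]
      smul_mem' := by
        rintro c f ⟨h1, h2⟩
        refine ⟨fun g hg x => ?_, fun x hx => ?_⟩
        · simp [h1 g hg]
        · simp [h2 x hx] }
  have hsub := evenPart_mono sgn hME
  have hX : ∀ h ∈ evenPart sgn E, ∀ f ∈ X, ρ h f ∈ X := by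
    rintro h hh f ⟨h1, h2⟩
    refine ⟨fun g hg x => ?_, fun x hx => ?_⟩
    · change f (g * x * h) = σ g (f (x * h))
      rw [mul_assoc, h1 g hg]
    · exact h2 _ (fun h3 => hx ((mul_mem_cancel_right hh).1 h3))
  have := hσ.nontrivial
  obtain ⟨u, hu⟩ := exists_ne (0 : U)
  have hX0 : X ≠ ⊥ := by
    intro h0
    have hf : (fun x => if x ∈ evenPart sgn M then σ x u else 0) ∈ X := by
      refine ⟨fun g hg x => ?_, fun x hx => ?_⟩
      · beta_reduce
        by_cases hxM : x ∈ evenPart sgn M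
        · rw [if_pos (mul_mem hg hxM), if_pos hxM, hσ.mul_apply hg hxM]
        · rw [if_neg (fun h => hxM ((mul_mem_cancel_left hg).1 h)), if_neg hxM, map_zero]
      · exact if_neg fun h => hx (hsub h)
    rw [h0, Submodule.mem_bot] at hf
    have := congrFun hf 1
    simp only [one_mem, if_true, hσ.one] at this
    exact hu this
  obtain ⟨W, hWX, hW0, hW, hθ⟩ := exists_simple_sub hρ hX0 hX
  have hyE := hME hy
  let ev : W →ₗ[ℂ] U := (LinearMap.proj 1).comp W.subtype
  have hev : ∀ f : W, ev f = (f : A → U) 1 := fun _ => rfl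
  have hev0 : ev ≠ 0 := by
    intro h0
    obtain ⟨f, hf, hf0⟩ := Submodule.exists_mem_ne_zero_of_ne_bot hW0
    refine hf0 (funext fun x => ?_)
    by_cases hx : x ∈ evenPart sgn E
    · have h1 : ρ x f 1 = 0 := LinearMap.congr_fun h0 ⟨ρ x f, hW x hx f hf⟩
      simpa [ρ, LinearMap.funLeft] using h1
    · exact (hWX hf).2 x hx
  obtain ⟨φ, hφ0, hφ⟩ := exists_intertwiner_symm (hθ.toIsRep.mono hsub) hσ.toIsRep hev0
    (fun h hh f => by
      rw [hev, hev, compressRep_apply (hW h (hsub hh)), ← (hWX f.2).1 h hh]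
      simp [ρ, LinearMap.funLeft])
  rcases hθ.hasStr_or hyE hys (hreal.trace_eq hθ.toIsRep hyE hys) with h | h
  · exact hasStr_sign_eq hME hidx hσ hθ hφ0 hφ (ε := -1) (ε' := 1) (by norm_num) hσs h
  · exact hE W _ hθ h

theorem noQuat_of_commute {A : Type*} [Group A] [Fintype A] {sgn : A →* ℤˣ}
    {E : Subgroup A} (hcomm : ∀ g ∈ evenPart sgn E, ∀ h ∈ evenPart sgn E, g * h = h * g) {y : A}
    (hy : y ∈ E) (hys : sgn y = -1) (hyy : y * y = 1) : NoQuat sgn E := by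
  intro U _ _ _ ρ hρ hs
  obtain ⟨J, hJ, hJJ⟩ := hs.change hρ.toIsRep hy hys
  have hscalar : ∀ g ∈ evenPart sgn E, ∃ c : ℂ, ∀ u, ρ g u = c • u := fun g hg =>
    hρ.eq_smul_of_commute (ρ g) fun h hh u => by
      rw [← hρ.mul_apply hg hh, ← hρ.mul_apply hh hg, hcomm g hg h hh]
  have := hρ.nontrivial
  obtain ⟨u, hu⟩ := exists_ne (0 : U)
  have htop : (ℂ ∙ u) = ⊤ := by
    refine (hρ.eq_bot_or_eq_top (ℂ ∙ u) fun h hh w hw => ?_).resolve_left (by simpa using hu)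
    obtain ⟨c, hc⟩ := hscalar h hh
    rw [hc]
    exact Submodule.smul_mem _ _ hw
  obtain ⟨c, hc⟩ := Submodule.mem_span_singleton.1 (htop ▸ Submodule.mem_top : J u ∈ ℂ ∙ u)
  have h1 := hJJ u
  rw [← hc, map_smulₛₗ, ← hc, hyy, hρ.one, Module.End.one_apply, smul_smul, mul_comm,
    Complex.mul_conj, neg_smul, one_smul, ← neg_one_smul ℂ, ← sub_eq_zero, ← sub_smul] at h1
  have h2 := (smul_eq_zero.1 h1).resolve_right hu
  have h3 : Complex.normSq c - (-1) = 0 := by exact_mod_cast h2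
  linarith [Complex.normSq_nonneg c]

end NoQuatTransfer

section RealOfQuaternionic

theorem IsRep.exists_stable_isCompl {A : Type*} [Group A] [Fintype A] {H : Subgroup A}
    {U : Type} [AddCommGroup U] [Module ℂ U] {ρ : A → Module.End ℂ U} (hρ : IsRep H ρ)
    {W : Submodule ℂ U} (hW : ∀ h ∈ H, ∀ w ∈ W, ρ h w ∈ W) :
    ∃ C : Submodule ℂ U, IsCompl W C ∧ ∀ h ∈ H, ∀ c ∈ C, ρ h c ∈ C := by
  have : NeZero (Nat.card H : ℂ) := ⟨by exact_mod_cast Nat.card_pos.ne'⟩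
  let W' : Subrepresentation hρ.toRepresentation := ⟨W, fun h v hv => hW h h.2 v hv⟩
  obtain ⟨C, hC⟩ := exists_isCompl W'
  refine ⟨C.toSubmodule, ?_, fun h hh c hc => C.apply_mem_toSubmodule ⟨h, hh⟩ hc⟩
  have h1 := hC.inf_eq_bot
  have h2 := hC.sup_eq_top
  refine ⟨disjoint_iff.2 ?_, codisjoint_iff.2 ?_⟩
  · exact congrArg Subrepresentation.toSubmodule h1
  · exact congrArg Subrepresentation.toSubmodule h2

theorem hasStr_one_of_isCompl {A : Type*} [Group A] {sgn : A →* ℤˣ} {E : Subgroup A}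
    {U : Type} [AddCommGroup U] [Module ℂ U] {ρ : A → Module.End ℂ U} {y : A}
    (hy : y ∈ E) (hys : sgn y = -1) {J : U →ₛₗ[starRingEnd ℂ] U}
    (hJ : ∀ h ∈ evenPart sgn E, ∀ u, J (ρ h u) = ρ (y * h * y⁻¹) (J u))
    (hJJ : ∀ u, J (J u) = (-1 : ℤ) • ρ (y * y) u) {N : Submodule ℂ U}
    (hN : ∀ h ∈ evenPart sgn E, ∀ w ∈ N, ρ h w ∈ N) (hc : IsCompl N (N.map J)) :
    HasStr sgn E 1 ρ := by
  let I : Module.End ℂ U := (2 : ℂ) • N.projection _ hc - 1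
  have hI1 : ∀ a ∈ N, I a = a := fun a ha => by
    simp [I, Submodule.projection_apply_of_mem_left hc ha, two_smul]
  have hI2 : ∀ b ∈ N, I (J b) = -J b := fun b hb => by
    have : N.projection _ hc (J b) = 0 :=
      (Submodule.projection_apply_eq_zero_iff hc).2 ⟨b, hb, rfl⟩
    simp [I, this]
  have hdec : ∀ u, ∃ a ∈ N, ∃ b ∈ N, u = a + J b := fun u => by
    have hu : u ∈ N ⊔ N.map J := hc.sup_eq_top ▸ Submodule.mem_top
    obtain ⟨a, ha, _, ⟨b, hb, rfl⟩, rfl⟩ := Submodule.mem_sup.1 hu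
    exact ⟨a, ha, b, hb, rfl⟩
  have hyy := mul_self_mem_evenPart (sgn := sgn) hy
  refine ⟨y, hy, hys, I.comp J, fun h hh u => ?_, fun u => ?_⟩
  · obtain ⟨a, ha, b, hb, rfl⟩ := hdec u
    have hyh := conj_mem_evenPart hy hh
    simp only [LinearMap.comp_apply, hJ h hh, map_add, hJJ, map_zsmul]
    rw [hI2 a ha, hI1 _ (hN _ hyy b hb), hI1 _ (hN _ hyh _ (hN _ hyy b hb)), map_neg]
    congr 1
    have h1 : ρ (y * h * y⁻¹) (J a) = J (ρ h a) := (hJ h hh a).symm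
    rw [h1, hI2 _ (hN h hh a ha)]
  · obtain ⟨a, ha, b, hb, rfl⟩ := hdec u
    have h1 : ρ (y * y) (J b) = J (ρ (y * y) b) := by
      rw [hJ _ hyy]
      congr 2
      group
    simp only [LinearMap.comp_apply, hJJ, map_add, hI2 a ha, map_neg,
      hI1 _ (hN _ hyy b hb), hI1 _ (hN _ hyy a ha), one_smul, h1, neg_smul,
      hI2 _ (hN _ hyy b hb), neg_neg]

theorem HasStr.one_of_noQuat {A : Type*} [Group A] [Fintype A] {sgn : A →* ℤˣ}
    {E : Subgroup A} (hE : NoQuat sgn E) {U : Type} [AddCommGroup U] [Module ℂ U]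
    [FiniteDimensional ℂ U] {ρ : A → Module.End ℂ U} (hρ : IsRep (evenPart sgn E) ρ)
    (hs : HasStr sgn E (-1) ρ) : HasStr sgn E 1 ρ := by
  obtain ⟨y, hy, hys, J, hJ, hJJ⟩ := hs
  have hyy := mul_self_mem_evenPart (sgn := sgn) hy
  obtain ⟨N, ⟨hN, hNJ⟩, hmax⟩ := (wellFounded_gt (α := Submodule ℂ U)).has_min
    {N | (∀ h ∈ evenPart sgn E, ∀ w ∈ N, ρ h w ∈ N) ∧ ∀ a ∈ N, J a ∈ N → a = 0}
    ⟨⊥, by simp, by simp⟩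
  set W := N ⊔ N.map J
  by_cases hW : W = ⊤
  · refine hasStr_one_of_isCompl hy hys hJ hJJ hN ⟨?_, codisjoint_iff.2 hW⟩
    rw [Submodule.disjoint_def]
    rintro _ hx ⟨a, ha, rfl⟩
    rw [hNJ a ha hx, map_zero]
  exfalso
  have hNW : N ≤ W := le_sup_left
  have hJW : ∀ w ∈ W, J w ∈ W := by
    intro w hw
    obtain ⟨a, ha, _, ⟨b, hb, rfl⟩, rfl⟩ := Submodule.mem_sup.1 hw
    rw [map_add, hJJ]
    exact W.add_mem (Submodule.mem_sup_right ⟨a, ha, rfl⟩)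
      (W.smul_of_tower_mem _ (hNW (hN _ hyy b hb)))
  have hρW : ∀ h ∈ evenPart sgn E, ∀ w ∈ W, ρ h w ∈ W := by
    intro h hh w hw
    obtain ⟨a, ha, _, ⟨b, hb, rfl⟩, rfl⟩ := Submodule.mem_sup.1 hw
    rw [map_add]
    refine W.add_mem (hNW (hN h hh a ha)) (Submodule.mem_sup_right ⟨ρ (y⁻¹ * h * y⁻¹⁻¹) b,
      hN _ (conj_mem_evenPart (E.inv_mem hy) hh) b hb, ?_⟩)
    rw [hJ _ (conj_mem_evenPart (E.inv_mem hy) hh)]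
    congr 2
    group
  obtain ⟨C, hWC, hC⟩ := hρ.exists_stable_isCompl hρW
  have hC0 : C ≠ ⊥ := fun h0 => hW (by simpa [h0] using hWC.sup_eq_top)
  obtain ⟨S, hSC, hS0, hS, hσ⟩ := exists_simple_sub hρ hC0 hC
  have hSW : ∀ s ∈ S, s ∈ W → s = 0 := fun s hs hw =>
    Submodule.disjoint_def.1 hWC.disjoint s hw (hSC hs)
  have hlt : N < N ⊔ S := by
    refine lt_of_le_of_ne le_sup_left fun h => ?_
    obtain ⟨s, hs, hs0⟩ := Submodule.exists_mem_ne_zero_of_ne_bot hS0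
    exact hs0 (hSW s hs (hNW (h ▸ Submodule.mem_sup_right hs)))
  have hex : ∃ s ∈ S, s ≠ 0 ∧ J s ∈ W ⊔ S := by
    by_contra! hcon
    refine hmax (N ⊔ S) ⟨fun h hh w hw => ?_, fun a ha hJa => ?_⟩ hlt
    · obtain ⟨a, ha, b, hb, rfl⟩ := Submodule.mem_sup.1 hw
      rw [map_add]
      exact Submodule.add_mem_sup (hN h hh a ha) (hS h hh b hb)
    · obtain ⟨n, hn, s, hs, rfl⟩ := Submodule.mem_sup.1 ha
      have hJs : J s ∈ W ⊔ S := by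
        have h1 : J s = J (n + s) - J n := by rw [map_add, add_sub_cancel_left]
        rw [h1]
        exact Submodule.sub_mem _ (sup_le_sup_right hNW S hJa)
          (Submodule.mem_sup_left (hJW n (hNW hn)))
      have hs0 : s = 0 := by
        by_contra hs0
        exact hcon s hs hs0 hJs
      subst hs0
      rw [add_zero] at hJa ⊢
      obtain ⟨n', hn', s', hs', h2⟩ := Submodule.mem_sup.1 hJa
      have h3 : s' = 0 := hSW s' hs' (by
        rw [← add_sub_cancel_left n' s', h2]
        exact W.sub_mem (hJW n (hNW hn)) (hNW hn'))
      refine hNJ n hn ?_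
      rw [← h2, h3, add_zero]
      exact hn'
  have hJS : ∀ s ∈ S, J s ∈ W ⊔ S := by
    let X : Submodule ℂ S := (W ⊔ S).comap (J.comp S.subtype)
    have hX : X = ⊤ := by
      refine (hσ.eq_bot_or_eq_top X fun h hh s hs => ?_).resolve_left fun h0 => ?_
      · change J _ ∈ W ⊔ S
        rw [Submodule.subtype_apply, compressRep_apply (hS h hh), hJ h hh]
        obtain ⟨w, hw, t, ht, h1⟩ := Submodule.mem_sup.1 (show J s ∈ W ⊔ S from hs)
        rw [← h1, map_add]
        exact Submodule.add_mem_sup (hρW _ (conj_mem_evenPart hy hh) w hw)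
          (hS _ (conj_mem_evenPart hy hh) t ht)
      · obtain ⟨s, hs, hs0, h1⟩ := hex
        have h2 : (⟨s, hs⟩ : S) ∈ X := h1
        rw [h0, Submodule.mem_bot] at h2
        exact hs0 (congrArg Subtype.val h2)
    intro s hs
    exact (hX ▸ Submodule.mem_top : (⟨s, hs⟩ : S) ∈ X)
  let P := C.projection W hWC.symm
  have hPW : ∀ w ∈ W, P w = 0 := fun w hw =>
    (Submodule.projection_apply_eq_zero_iff hWC.symm).2 hw
  have hPS : ∀ s ∈ S, P s = s := fun s hs =>
    Submodule.projection_apply_of_mem_left hWC.symm (hSC hs)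
  have hP : ∀ s ∈ S, ∃ w ∈ W, J s = w + P (J s) ∧ P (J s) ∈ S := fun s hs => by
    obtain ⟨w, hw, t, ht, h1⟩ := Submodule.mem_sup.1 (hJS s hs)
    have h2 : P (J s) = t := by rw [← h1, map_add, hPW w hw, hPS t ht, zero_add]
    exact ⟨w, hw, h2.symm ▸ h1.symm, h2.symm ▸ ht⟩
  let Q : S →ₛₗ[starRingEnd ℂ] S := LinearMap.codRestrict S (P.comp (J.comp S.subtype))
    fun s => by
      obtain ⟨-, -, -, h⟩ := hP s s.2
      exact h
  have hQ : ∀ s : S, (Q s : U) = P (J s) := fun _ => rfl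
  refine hE S _ hσ ⟨y, hy, hys, Q, fun h hh s => Subtype.ext ?_, fun s => Subtype.ext ?_⟩
  · have hyh := conj_mem_evenPart hy hh
    obtain ⟨w, hw, h1, h2⟩ := hP s s.2
    rw [hQ, compressRep_apply (hS h hh), compressRep_apply (hS _ hyh), hQ, hJ h hh, h1, map_add,
      map_add, hPW _ (hρW _ hyh w hw), map_add, hPW w hw, hPS _ h2, hPS _ (hS _ hyh _ h2),
      zero_add, zero_add]
  · obtain ⟨w, hw, h1, h2⟩ := hP s s.2
    rw [hQ, hQ, show P (J s) = J s - w by rw [eq_sub_iff_add_eq', ← h1], map_sub, map_sub, hJJ,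
      hPW _ (hJW w hw), sub_zero, map_zsmul, hPS _ (hS _ hyy s s.2), Submodule.coe_smul_of_tower,
      compressRep_apply (hS _ hyy)]

end RealOfQuaternionic

section EquivariantTrace

theorem trace_pi_comp {Ω M : Type*} [Fintype Ω] [AddCommGroup M] [Module ℂ M]
    [FiniteDimensional ℂ M] (f : Module.End ℂ M) (σ : Ω → Ω) :
    LinearMap.trace ℂ (Ω → M) (LinearMap.pi fun ω => f.comp (LinearMap.proj (σ ω)))
      = (Finset.univ.filter fun ω => σ ω = ω).card * LinearMap.trace ℂ M f := by
  have h1 : (LinearMap.pi fun ω => f.comp (LinearMap.proj (σ ω)) : Module.End ℂ (Ω → M))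
      = ∑ ω, (LinearMap.single ℂ (fun _ : Ω => M) ω).comp
        (f.comp (LinearMap.proj (σ ω))) := by
    apply LinearMap.ext
    intro φ
    funext ω
    simp [LinearMap.sum_apply, Finset.sum_apply, Pi.single_apply]
  rw [h1, map_sum, Finset.card_filter]
  push_cast
  rw [Finset.sum_mul]
  refine Finset.sum_congr rfl fun ω _ => ?_
  rw [LinearMap.trace_comp_comm', LinearMap.comp_assoc, ite_mul, one_mul, zero_mul]
  split_ifs with h
  · rw [h, LinearMap.proj_comp_single_same, LinearMap.comp_id]
  · rw [LinearMap.proj_comp_single_ne _ _ _ _ h, LinearMap.comp_zero, map_zero]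

theorem IsRep.card_mul_trace_restrict {B : Type*} [Group B] [Fintype B] {H : Subgroup B}
    {V : Type} [AddCommGroup V] [Module ℂ V] [FiniteDimensional ℂ V] {π : B → Module.End ℂ V}
    (hπ : IsRep H π) {L : Module.End ℂ V}
    {W : Submodule ℂ V} (hW : ∀ v, v ∈ W ↔ ∀ t ∈ H, π t v = v) (hLW : ∀ v ∈ W, L v ∈ W) :
    Nat.card H * LinearMap.trace ℂ W (L.restrict hLW)
      = ∑ t with t ∈ H, LinearMap.trace ℂ V (L * π t) := by
  have hmem : ∀ v, (L * ∑ t with t ∈ H, π t) v ∈ W := by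
    intro v
    refine hLW _ ((hW _).2 fun t ht => ?_)
    rw [sum_filter_mem_eq, LinearMap.sum_apply, map_sum]
    refine Fintype.sum_equiv (Equiv.mulLeft ⟨t, ht⟩) _ _ fun h => ?_
    rw [← hπ.mul_apply ht h.2]
    rfl
  have h1 := LinearMap.trace_restrict_eq_of_forall_mem W _ hmem
  have h2 : LinearMap.trace ℂ V (L * ∑ t with t ∈ H, π t)
      = ∑ t with t ∈ H, LinearMap.trace ℂ V (L * π t) := by
    rw [Finset.mul_sum, map_sum]
  rw [← h2, ← h1, ← nsmul_eq_mul, ← map_nsmul]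
  congr 1
  ext v
  change _ = L ((∑ t with t ∈ H, π t) v)
  rw [sum_filter_mem_eq, LinearMap.sum_apply,
    Finset.sum_congr rfl fun (t : H) _ => (hW v).1 v.2 t t.2]
  simp [Nat.card_eq_fintype_card]

theorem IsRep.trace_conjugation {B : Type*} [Group B] {H : Subgroup B}
    {U : Type} [AddCommGroup U] [Module ℂ U] [FiniteDimensional ℂ U] {ρ : B → Module.End ℂ U}
    (hρ : IsRep H ρ) {g : B} (hg : g ∈ H) :
    LinearMap.trace ℂ (Module.End ℂ U) (LinearMap.mulLeft ℂ (ρ g) * LinearMap.mulRight ℂ (ρ g⁻¹))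
      = LinearMap.trace ℂ U (ρ g) * LinearMap.trace ℂ U (ρ g⁻¹) := by
  have h := Representation.char_linHom hρ.toRepresentation hρ.toRepresentation ⟨g, hg⟩
  rw [mul_comm (LinearMap.trace ℂ U (ρ g))]
  refine Eq.trans ?_ h
  rfl

theorem IsRep.exists_sum_trace_eq {B : Type*} [Group B] [Fintype B] {s : B →* ℤˣ}
    {U : Type} [AddCommGroup U] [Module ℂ U] [FiniteDimensional ℂ U] {ρ : B → Module.End ℂ U}
    (hρ : IsRep s.ker ρ) {x : B} (hx : x ∈ s.ker) (hxc : ∀ g ∈ s.ker, g * x = x * g)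
    {τ : B} (hτx : τ * x * τ⁻¹ = x⁻¹) {T : Subgroup B} (hτT : τ ∈ T)
    {J J' : U →ₛₗ[starRingEnd ℂ] U} (hJ : ∀ h ∈ s.ker, ∀ u, J (ρ h u) = ρ (τ * h * τ⁻¹) (J u))
    (hJJ : ∀ u, J (J u) = -ρ (τ * τ) u)
    (hJ' : ∀ h ∈ evenPart s T, ∀ u, J' (ρ h u) = ρ (τ * h * τ⁻¹) (J' u))
    (hJ'x : ∀ u, J' (ρ x u) = ρ x⁻¹ (J' u)) (hJJ' : ∀ u, J' (J' u) = ρ (τ * τ) u)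
    {Ω : Type} [Fintype Ω] [MulAction B Ω] : ∃ α : ℂ, IsIntegral ℤ α ∧
      ∑ t with t ∈ evenPart s T, LinearMap.trace ℂ U (ρ (x * t)) *
        LinearMap.trace ℂ U (ρ (x * t)⁻¹) * (Finset.univ.filter fun ω : Ω => t • ω = ω).card
      = Nat.card (evenPart s T) * (2 * α) := by
  let c : B → Module.End ℂ (Module.End ℂ U) := fun g =>
    LinearMap.mulLeft ℂ (ρ g) * LinearMap.mulRight ℂ (ρ g⁻¹)
  have hc : ∀ g X u, c g X u = ρ g (X (ρ g⁻¹ u)) := fun g X u => rfl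
  have hcmul : ∀ g ∈ s.ker, ∀ h ∈ s.ker, c (g * h) = c g * c h := fun g hg h hh => by
    ext X u
    simp only [hc, Module.End.mul_apply, _root_.mul_inv_rev, hρ.mul_apply hg hh,
      hρ.mul_apply (inv_mem hh) (inv_mem hg)]
  have hcone : c 1 = 1 := by
    ext X u
    simp [hc, hρ.one]
  let π : B → Module.End ℂ (Ω → Module.End ℂ U) := fun g =>
    LinearMap.pi fun ω => (c g).comp (LinearMap.proj (g⁻¹ • ω))
  have hπ' : ∀ g φ ω, π g φ ω = c g (φ (g⁻¹ • ω)) := fun g φ ω => rfl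
  have hπ : IsRep (evenPart s T) π := by
    refine ⟨?_, fun g hg h hh => ?_⟩
    · apply LinearMap.ext
      intro φ
      funext ω
      simp [hπ', hcone]
    · apply LinearMap.ext
      intro φ
      funext ω
      simp [hπ', hcmul g hg.2 h hh.2, mul_smul]
  let L : Module.End ℂ (Ω → Module.End ℂ U) :=
    LinearMap.pi fun ω => (c x).comp (LinearMap.proj ω)
  have hLapp : ∀ φ ω, L φ ω = c x (φ ω) := fun φ ω => rfl
  let L' : Module.End ℂ (Ω → Module.End ℂ U) :=
    LinearMap.pi fun ω => (c x⁻¹).comp (LinearMap.proj ω)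
  have hL'app : ∀ φ ω, L' φ ω = c x⁻¹ (φ ω) := fun φ ω => rfl
  have hLπ : ∀ t ∈ evenPart s T, ∀ φ, L (π t φ) = π t (L φ) := by
    intro t ht φ
    funext ω
    simp only [hLapp, hπ', ← Module.End.mul_apply, ← hcmul x hx t ht.2, ← hcmul t ht.2 x hx,
      hxc t ht.2]
  have hL'π : ∀ t ∈ evenPart s T, ∀ φ, L' (π t φ) = π t (L' φ) := by
    intro t ht φ
    have hcomm : t * x⁻¹ = x⁻¹ * t := (Commute.inv_right (hxc t ht.2)).eq
    funext ω
    simp only [hL'app, hπ', ← Module.End.mul_apply, ← hcmul _ (inv_mem hx) t ht.2,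
      ← hcmul t ht.2 _ (inv_mem hx), hcomm]
  let W : Submodule ℂ (Ω → Module.End ℂ U) :=
    ⨅ t : evenPart s T, LinearMap.ker (π t - 1)
  have hW : ∀ φ, φ ∈ W ↔ ∀ t ∈ evenPart s T, π t φ = φ := by
    intro φ
    simp [W, Submodule.mem_iInf, sub_eq_zero]
  have hLW : ∀ φ ∈ W, L φ ∈ W := fun φ hφ => (hW _).2 fun t ht => by
    rw [← hLπ t ht, (hW φ).1 hφ t ht]
  have hL'W : ∀ φ ∈ W, L' φ ∈ W := fun φ hφ => (hW _).2 fun t ht => by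
    rw [← hL'π t ht, (hW φ).1 hφ t ht]
  have hττ : τ * τ ∈ evenPart s T := mul_self_mem_evenPart hτT
  let K : (Ω → Module.End ℂ U) →ₛₗ[starRingEnd ℂ] (Ω → Module.End ℂ U) :=
    { toFun := fun φ ω => J.comp ((φ (τ⁻¹ • ω)).comp (J'.comp (ρ (τ * τ)⁻¹)))
      map_add' := fun φ φ' => by
        funext ω
        ext u
        simp
      map_smul' := fun r φ => by
        funext ω
        ext u
        simp }
  have hK : ∀ φ ω u, K φ ω u = J (φ (τ⁻¹ • ω) (J' (ρ (τ * τ)⁻¹ u))) := fun _ _ _ => rfl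
  have hKπ : ∀ t ∈ evenPart s T, ∀ φ, K (π (τ⁻¹ * t * τ) φ) = π t (K φ) := by
    intro t ht φ
    have ht' : τ⁻¹ * t * τ ∈ evenPart s T := by
      simpa using conj_mem_evenPart (T.inv_mem hτT) ht
    have hti' : (τ⁻¹ * t * τ)⁻¹ ∈ evenPart s T := inv_mem ht'
    funext ω
    apply LinearMap.ext
    intro u
    have e1 : (τ⁻¹ * t * τ)⁻¹ • τ⁻¹ • ω = τ⁻¹ • t⁻¹ • ω := by
      simp only [← mul_smul]
      congr 1
      group
    have e2 : τ * (τ⁻¹ * t * τ) * τ⁻¹ = t := by group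
    have e3 : (τ⁻¹ * t * τ)⁻¹ = τ * ((τ * τ)⁻¹ * t⁻¹ * (τ * τ)) * τ⁻¹ := by group
    have hmid : (τ * τ)⁻¹ * t⁻¹ * (τ * τ) ∈ evenPart s T := by
      simpa using conj_mem_evenPart (T.inv_mem hττ.1) (inv_mem ht)
    have e4 : (τ * τ)⁻¹ * t⁻¹ * (τ * τ) * (τ * τ)⁻¹ = (τ * τ)⁻¹ * t⁻¹ := by group
    simp only [hK, hπ', hc]
    rw [hJ _ ht'.2, e1, e2, e3, ← hJ' _ hmid, ← hρ.mul_apply hmid.2 (inv_mem hττ.2), e4,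
      hρ.mul_apply (inv_mem hττ.2) (inv_mem ht.2)]
  have hKW : ∀ φ ∈ W, K φ ∈ W := fun φ hφ => (hW _).2 fun t ht => by
    have ht' : τ⁻¹ * t * τ ∈ evenPart s T := by
      simpa using conj_mem_evenPart (T.inv_mem hτT) ht
    rw [← hKπ t ht, (hW φ).1 hφ _ ht']
  have hKK : ∀ φ ∈ W, K (K φ) = -φ := by
    intro φ hφ
    funext ω
    apply LinearMap.ext
    intro u
    have h1 := congrFun ((hW φ).1 hφ _ hττ) ω
    rw [hπ'] at h1
    have e1 : τ⁻¹ • τ⁻¹ • ω = (τ * τ)⁻¹ • ω := by rw [← mul_smul, _root_.mul_inv_rev]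
    have e2 : τ * (τ * τ)⁻¹ * τ⁻¹ = (τ * τ)⁻¹ := by group
    simp only [hK]
    rw [hJJ, e1, hJ' _ (inv_mem hττ), e2, hJJ', hρ.inv_apply_self hττ.2]
    rw [Pi.neg_apply, LinearMap.neg_apply, ← h1, hc]
  have hKL : ∀ φ, K (L φ) = L' (K φ) := by
    intro φ
    funext ω
    apply LinearMap.ext
    intro u
    have hcomm : x * (τ * τ)⁻¹ = (τ * τ)⁻¹ * x :=
      (Commute.inv_left (hxc _ hττ.2)).eq.symm
    simp only [hK, hLapp, hL'app, hc]
    rw [hJ x hx, hτx, inv_inv, ← hJ'x, ← hρ.mul_apply hx (inv_mem hττ.2), hcomm,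
      hρ.mul_apply (inv_mem hττ.2) hx]
  let KW : W →ₛₗ[starRingEnd ℂ] W := LinearMap.codRestrict W (K.comp W.subtype)
    fun φ => hKW φ φ.2
  have hcpow : ∀ n : ℕ, (c x) ^ n = c (x ^ n) := by
    intro n
    induction n with
    | zero => simp [hcone]
    | succ n ih => rw [pow_succ, pow_succ, ih, hcmul _ (pow_mem hx n) _ hx]
  have hLn : L ^ Fintype.card B = 1 := by
    have h1 : ∀ n : ℕ, ∀ φ ω, (L ^ n) φ ω = ((c x) ^ n) (φ ω) := by
      intro n
      induction n with
      | zero => simp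
      | succ n ih =>
        intro φ ω
        rw [pow_succ, pow_succ, Module.End.mul_apply, Module.End.mul_apply, ih, hLapp]
    apply LinearMap.ext
    intro φ
    funext ω
    rw [h1, hcpow, pow_card_eq_one, hcone]
    rfl
  have hL'L : L' * L = 1 := by
    apply LinearMap.ext
    intro φ
    funext ω
    rw [Module.End.mul_apply, hL'app, hLapp, ← Module.End.mul_apply, ← hcmul _ (inv_mem hx) _ hx,
      inv_mul_cancel, hcone]
    rfl
  obtain ⟨α, hα, htr⟩ := exists_trace_eq_two_mul (L := L.restrict hLW) (L' := L'.restrict hL'W)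
    (n := Fintype.card B) Fintype.card_ne_zero (by
      rw [Module.End.pow_restrict]
      exact LinearMap.ext fun φ => Subtype.ext (LinearMap.congr_fun hLn φ))
    (LinearMap.ext fun φ => Subtype.ext (LinearMap.congr_fun hL'L φ)) KW
    (fun φ => Subtype.ext (hKK φ φ.2)) (fun φ => Subtype.ext (hKL φ))
  refine ⟨α, hα, ?_⟩
  rw [← htr, hπ.card_mul_trace_restrict hW hLW]
  refine Finset.sum_congr rfl fun t ht => ?_
  have ht' : t ∈ evenPart s T := by simpa using ht
  have h1 : L * π t = LinearMap.pi fun ω => (c (x * t)).comp (LinearMap.proj (t⁻¹ • ω)) := by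
    apply LinearMap.ext
    intro φ
    funext ω
    simp only [Module.End.mul_apply, hLapp, hπ', LinearMap.pi_apply, LinearMap.comp_apply,
      LinearMap.proj_apply, hcmul x hx t ht'.2]
  rw [h1, trace_pi_comp, hρ.trace_conjugation (mul_mem hx ht'.2), mul_comm]
  congr 3
  ext ω
  simp only [Finset.mem_filter, Finset.mem_univ, true_and]
  rw [inv_smul_eq_iff, eq_comm]

end EquivariantTrace

section TwoElements

variable {B : Type} [Group B] [Fintype B]

/-- The number of left cosets of `T` fixed by `c`. -/
def fixedCosets (T : Subgroup B) (c : B) : ℕ :=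
  (Finset.univ.filter fun ω : B ⧸ T => c • ω = ω).card

theorem fixedCosets_conj (T : Subgroup B) (g c : B) :
    fixedCosets T (g * c * g⁻¹) = fixedCosets T c := by
  refine (Finset.card_equiv (MulAction.toPerm g) fun ω => ?_).symm
  simp only [Finset.mem_filter, Finset.mem_univ, true_and, MulAction.toPerm_apply, mul_smul,
    inv_smul_smul, smul_left_cancel_iff]

theorem card_fixed_pi (T : Subgroup B) (c : B) (n : ℕ) :
    (Finset.univ.filter fun ω : Fin n → B ⧸ T => c • ω = ω).card = fixedCosets T c ^ n := by
  have h : (Finset.univ.filter fun ω : Fin n → B ⧸ T => c • ω = ω)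
      = Fintype.piFinset fun _ => Finset.univ.filter fun ω : B ⧸ T => c • ω = ω := by
    ext ω
    simp [Fintype.mem_piFinset, funext_iff]
  rw [h, Fintype.card_piFinset, Finset.prod_const, Finset.card_univ, Fintype.card_fin]
  rfl

theorem sum_ker_coset {s : B →* ℤˣ} {T : Subgroup B} {τ : B} (hτ : s τ = -1) (hτT : τ ∈ T)
    (f : B ⧸ T → ℂ) :
    ∑ g with g ∈ s.ker, f g = Nat.card (evenPart s T) * ∑ ω, f ω := by
  rw [← Finset.sum_fiberwise _ fun g : B => (g : B ⧸ T), Finset.mul_sum]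
  refine Finset.sum_congr rfl fun ω _ => ?_
  obtain ⟨g₀, hg₀, rfl⟩ : ∃ g₀ ∈ s.ker, (g₀ : B ⧸ T) = ω := by
    obtain ⟨b, rfl⟩ := QuotientGroup.mk_surjective ω
    rcases Int.units_eq_one_or (s b) with h | h
    · exact ⟨b, h, rfl⟩
    · refine ⟨b * τ, by simp [MonoidHom.mem_ker, h, hτ], ?_⟩
      rw [QuotientGroup.eq]
      simpa using hτT
  rw [Finset.sum_congr rfl fun g hg => by rw [(Finset.mem_filter.1 hg).2], Finset.sum_const,
    nsmul_eq_mul]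
  congr 2
  rw [Nat.card_eq_fintype_card, Fintype.card_subtype]
  have hk : s g₀ = 1 := hg₀
  refine (Finset.card_equiv (Equiv.mulLeft g₀) fun t => ?_).symm
  have h1 : ((g₀ * t : B) : B ⧸ T) = g₀ ↔ t ∈ T := by
    rw [eq_comm, QuotientGroup.eq, inv_mul_cancel_left]
  simp only [Finset.mem_filter, Finset.mem_univ, true_and, Equiv.coe_mulLeft, h1, mem_evenPart,
    MonoidHom.mem_ker, map_mul, hk, one_mul, and_comm]

theorem card_mul_sum_fixedCosets {s : B →* ℤˣ} {T : Subgroup B} {τ : B} (hτ : s τ = -1)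
    (hτT : τ ∈ T) {F : B → ℂ} (hF : ∀ g ∈ s.ker, ∀ c ∈ s.ker, F (g * c * g⁻¹) = F c) :
    Nat.card (evenPart s T) * ∑ c with c ∈ s.ker, F c * fixedCosets T c
      = Nat.card s.ker * ∑ t with t ∈ evenPart s T, F t := by
  have h1 : ∀ c, (Nat.card (evenPart s T) : ℂ) * fixedCosets T c
      = ∑ g with g ∈ s.ker, if c • (g : B ⧸ T) = g then 1 else 0 := by
    intro c
    rw [sum_ker_coset hτ hτT fun ω => if c • ω = ω then (1 : ℂ) else 0, fixedCosets,
      Finset.card_filter]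
    push_cast
    rfl
  have h2 : ∀ g ∈ s.ker, ∑ c with c ∈ s.ker, F c * (if c • (g : B ⧸ T) = g then 1 else 0)
      = ∑ t with t ∈ evenPart s T, F t := by
    intro g hg
    simp only [mul_ite, mul_one, mul_zero]
    rw [← Finset.sum_filter, Finset.filter_filter]
    have hk : s g = 1 := hg
    refine (Finset.sum_equiv (MulAut.conj g).toEquiv (fun t => ?_) fun t ht => ?_).symm
    · have h3 : (g * t * g⁻¹) • (g : B ⧸ T) = g ↔ t ∈ T := by
        rw [MulAction.Quotient.smul_coe, smul_eq_mul, inv_mul_cancel_right, eq_comm,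
          QuotientGroup.eq, inv_mul_cancel_left]
      simp only [Finset.mem_filter, Finset.mem_univ, true_and, MulEquiv.toEquiv_eq_coe,
        EquivLike.coe_coe, MulAut.conj_apply, h3, mem_evenPart, MonoidHom.mem_ker, map_mul, hk,
        map_inv, one_mul, inv_one, mul_one, and_comm]
    · exact (hF g hg t (Finset.mem_filter.1 ht).2.2).symm
  rw [Finset.mul_sum]
  simp_rw [mul_left_comm _ (F _), h1, Finset.mul_sum]
  rw [Finset.sum_comm, Finset.sum_congr rfl fun g hg => h2 g (Finset.mem_filter.1 hg).2,
    Finset.sum_const, nsmul_eq_mul, Nat.card_eq_fintype_card, Fintype.card_subtype, Finset.mul_sum]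

theorem odd_fixedCosets {T : Subgroup B} (hodd : Odd T.index) {c : B}
    (hc : ∃ k : ℕ, c ^ 2 ^ k = 1) :
    Odd (fixedCosets T c) := by
  have hp : IsPGroup 2 (Subgroup.zpowers c) := by
    obtain ⟨k, hk⟩ := hc
    rintro ⟨_, n, rfl⟩
    refine ⟨k, Subtype.ext ?_⟩
    change (c ^ n) ^ 2 ^ k = 1
    rw [← zpow_natCast, zpow_comm, zpow_natCast, hk, _root_.one_zpow]
  have h1 := hp.card_modEq_card_fixedPoints (B ⧸ T)
  have h2 : Nat.card (MulAction.fixedPoints (Subgroup.zpowers c) (B ⧸ T)) = fixedCosets T c := by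
    rw [Nat.card_eq_fintype_card, Fintype.card_subtype]
    unfold fixedCosets
    congr 1
    ext ω
    simp only [Finset.mem_filter, Finset.mem_univ, true_and, MulAction.mem_fixedPoints]
    refine ⟨fun h => h ⟨c, Subgroup.mem_zpowers c⟩, fun h m => ?_⟩
    have h3 : Subgroup.zpowers c ≤ MulAction.stabilizer B ω := by
      rw [Subgroup.zpowers_le]
      exact h
    exact h3 m.2
  rw [h2] at h1
  have h3 : T.index % 2 = fixedCosets T c % 2 := h1
  rw [Nat.odd_iff] at hodd ⊢
  omega

theorem fixedCosets_eq_zero {T : Subgroup B} (hT : IsPGroup 2 T) {c : B}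
    (hc : ¬∃ k : ℕ, c ^ 2 ^ k = 1) : fixedCosets T c = 0 := by
  unfold fixedCosets
  rw [Finset.card_eq_zero, Finset.filter_eq_empty_iff]
  intro ω _ hω
  obtain ⟨g, rfl⟩ := QuotientGroup.mk_surjective ω
  rw [MulAction.Quotient.smul_coe, smul_eq_mul, eq_comm, QuotientGroup.eq] at hω
  obtain ⟨k, hk⟩ := hT ⟨_, hω⟩
  refine hc ⟨k, ?_⟩
  have h1 : (g⁻¹ * (c * g)) ^ 2 ^ k = 1 := congrArg Subtype.val hk
  rw [← mul_assoc] at h1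
  have h2 := conj_pow (i := 2 ^ k) (a := g⁻¹) (b := c)
  rw [inv_inv] at h2
  rw [h2, mul_assoc, inv_mul_eq_one] at h1
  exact mul_eq_right.1 h1.symm

theorem exists_fixedCosets_pow {T : Subgroup B} (hodd : Odd T.index) {c : B}
    (hc : ∃ k : ℕ, c ^ 2 ^ k = 1) (k : ℕ) :
    ∃ m : ℤ, ((fixedCosets T c ^ 2 ^ k : ℕ) : ℤ) = 1 + 2 ^ k * m := by
  have h1 : fixedCosets T c ^ (2 ^ (k + 1)).totient ≡ 1 [MOD 2 ^ (k + 1)] :=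
    Nat.ModEq.pow_totient (Nat.Coprime.pow_right _ (odd_fixedCosets hodd hc).coprime_two_right)
  rw [Nat.totient_prime_pow_succ Nat.prime_two, Nat.add_one_sub_one, mul_one] at h1
  obtain ⟨m, hm⟩ := (Int.natCast_modEq_iff.2 h1).symm.dvd
  refine ⟨2 * m, ?_⟩
  push_cast at hm ⊢
  rw [pow_succ] at hm
  linarith

theorem IsRep.exists_sum_two_elements {s : B →* ℤˣ}
    {U : Type} [AddCommGroup U] [Module ℂ U] [FiniteDimensional ℂ U] {ρ : B → Module.End ℂ U}
    (hρ : IsRep s.ker ρ) {x : B} (hx : x ∈ s.ker) (hxc : ∀ g ∈ s.ker, g * x = x * g)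
    {τ : B} (hτ : s τ = -1) (hτx : τ * x * τ⁻¹ = x⁻¹) {T : Subgroup B} (hτT : τ ∈ T)
    (hT : IsPGroup 2 T) (hodd : Odd T.index)
    {J J' : U →ₛₗ[starRingEnd ℂ] U} (hJ : ∀ h ∈ s.ker, ∀ u, J (ρ h u) = ρ (τ * h * τ⁻¹) (J u))
    (hJJ : ∀ u, J (J u) = -ρ (τ * τ) u)
    (hJ' : ∀ h ∈ evenPart s T, ∀ u, J' (ρ h u) = ρ (τ * h * τ⁻¹) (J' u))
    (hJ'x : ∀ u, J' (ρ x u) = ρ x⁻¹ (J' u)) (hJJ' : ∀ u, J' (J' u) = ρ (τ * τ) u) (k : ℕ) :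
    ∃ α β : ℂ, IsIntegral ℤ α ∧ IsIntegral ℤ β ∧
      ∑ c with c ∈ s.ker ∧ ∃ i : ℕ, c ^ 2 ^ i = 1, LinearMap.trace ℂ U (ρ (x * c)) *
        LinearMap.trace ℂ U (ρ (x * c)⁻¹) = Nat.card s.ker * (2 * α) + 2 ^ k * β := by
  obtain ⟨n, hn⟩ : ∃ n, 2 ^ k = n + 1 := ⟨2 ^ k - 1, by have := Nat.one_le_two_pow (n := k); omega⟩
  obtain ⟨α, hα, h1⟩ := hρ.exists_sum_trace_eq hx hxc hτx hτT hJ hJJ hJ' hJ'x hJJ'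
    (Ω := Fin n → B ⧸ T)
  let F : B → ℂ := fun c => LinearMap.trace ℂ U (ρ (x * c)) * LinearMap.trace ℂ U (ρ (x * c)⁻¹)
  have hFconj : ∀ g ∈ s.ker, ∀ c ∈ s.ker, F (g * c * g⁻¹) = F c := by
    intro g hg c hc
    have e1 : x * (g * c * g⁻¹) = g * (x * c) * g⁻¹ := by
      rw [← mul_assoc, ← mul_assoc, ← hxc g hg, mul_assoc g x c]
    have e2 : (g * (x * c) * g⁻¹)⁻¹ = g * (x * c)⁻¹ * g⁻¹ := by group
    simp only [F]
    rw [e1, e2, hρ.trace_conj hg (mul_mem hx hc), hρ.trace_conj hg (inv_mem (mul_mem hx hc))]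
  have hFint : ∀ c ∈ s.ker, IsIntegral ℤ (F c) := fun c hc =>
    (hρ.isIntegral_trace (mul_mem hx hc)).mul (hρ.isIntegral_trace (inv_mem (mul_mem hx hc)))
  have h2 := card_mul_sum_fixedCosets hτ hτT (F := fun c => F c * (fixedCosets T c : ℂ) ^ n)
    fun g hg c hc => by simp only [hFconj g hg c hc, fixedCosets_conj]
  have h1' : ∑ t with t ∈ evenPart s T, F t * (fixedCosets T t : ℂ) ^ n
      = Nat.card (evenPart s T) * (2 * α) := by
    rw [← h1]
    refine Finset.sum_congr rfl fun t _ => ?_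
    rw [← Nat.cast_pow, ← card_fixed_pi]
    congr!
  rw [h1', mul_left_comm] at h2
  have hcard : (Nat.card (evenPart s T) : ℂ) ≠ 0 := by
    exact_mod_cast Nat.card_pos.ne'
  have h3 := mul_left_cancel₀ hcard h2
  choose! m hm using fun c hc => exists_fixedCosets_pow (T := T) hodd (c := c) hc k
  refine ⟨α, -∑ c with c ∈ s.ker ∧ ∃ i : ℕ, c ^ 2 ^ i = 1, F c * m c, hα, ?_, ?_⟩
  · refine (IsIntegral.sum _ fun c hc => ?_).neg
    exact (hFint c (Finset.mem_filter.1 hc).2.1).mul (isIntegral_algebraMap (R := ℤ) (x := m c))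
  · rw [← h3, mul_neg, ← sub_eq_add_neg, eq_sub_iff_add_eq, Finset.mul_sum,
      ← Finset.sum_add_distrib, ← Finset.filter_filter, Finset.sum_filter]
    refine Finset.sum_congr rfl fun c _ => ?_
    split_ifs with hc
    · have h4 : (fixedCosets T c : ℂ) ^ 2 ^ k = 1 + 2 ^ k * m c := by exact_mod_cast hm c hc
      rw [mul_assoc (F c) (_ ^ n), ← pow_succ, ← hn, h4]
      ring
    · rw [fixedCosets_eq_zero hT hc, Nat.cast_zero, mul_zero]

end TwoElements

section OddParts

theorem sum_card_centralizer_mul {G : Type*} [Group G] [Fintype G] (f : ConjClasses G → ℂ) :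
    ∑ x : G, (Nat.card (Subgroup.centralizer {x}) : ℂ) * f (ConjClasses.mk x)
      = Fintype.card G * ∑ κ, f κ := by
  have h1 : ∀ x : G, Nat.card (Subgroup.centralizer {x})
      = (Finset.univ.filter fun h : G => h * (ConjClasses.mk x).out * h⁻¹ = x).card := by
    intro x
    obtain ⟨h₀, h⟩ : ∃ h₀ : G, h₀ * (ConjClasses.mk x).out * h₀⁻¹ = x := by
      rw [← isConj_iff, ← ConjClasses.mk_eq_mk_iff_isConj]
      exact Quotient.out_eq _
    rw [Nat.card_eq_fintype_card, Fintype.card_subtype]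
    refine Finset.card_equiv (Equiv.mulRight h₀) fun t => ?_
    simp only [Finset.mem_filter, Finset.mem_univ, true_and, Equiv.coe_mulRight,
      Subgroup.mem_centralizer_singleton_iff]
    have e : t * h₀ * (ConjClasses.mk x).out * (t * h₀)⁻¹ = t * x * t⁻¹ := by
      conv_rhs => rw [← h]
      group
    rw [e, mul_inv_eq_iff_eq_mul, eq_comm]
  simp only [h1, Finset.card_filter]
  push_cast
  simp only [Finset.sum_mul, ite_mul, one_mul, zero_mul]
  rw [Finset.sum_comm, ← nsmul_eq_mul, ← Finset.card_univ, ← Finset.sum_const]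
  refine Finset.sum_congr rfl fun h _ => ?_
  rw [← Finset.sum_filter]
  symm
  refine Finset.sum_bij (fun κ _ => h * κ.out * h⁻¹) (fun κ _ => ?_) (fun κ _ κ' _ hκ => ?_)
    (fun x hx => ⟨ConjClasses.mk x, Finset.mem_univ _, (Finset.mem_filter.1 hx).2⟩) fun κ _ => ?_
  · have h2 : ConjClasses.mk (h * κ.out * h⁻¹) = κ := by
      conv_rhs => rw [← Quotient.out_eq κ]
      exact (ConjClasses.mk_eq_mk_iff_isConj.2 (isConj_iff.2 ⟨h, rfl⟩)).symm
    simp [h2]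
  · have h3 : κ.out = κ'.out := by simpa using hκ
    exact (Quotient.out_eq κ).symm.trans ((congrArg _ h3).trans (Quotient.out_eq κ'))
  · congr 1
    conv_lhs => rw [← Quotient.out_eq κ]
    exact (ConjClasses.mk_eq_mk_iff_isConj.2 (isConj_iff.2 ⟨h, rfl⟩))

theorem not_isIntegral_of_two_mul_eq {m : ℕ} (hm : Odd m) {γ : ℂ} (h : 2 * γ = m) :
    ¬IsIntegral ℤ γ := by
  intro hγ
  have h1 : γ = algebraMap ℚ ℂ (m / 2) := by
    push_cast [map_div₀]
    simp
    linear_combination h / 2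
  rw [h1, isIntegral_algebraMap_iff (algebraMap ℚ ℂ).injective] at hγ
  obtain ⟨z, hz⟩ := IsIntegrallyClosed.isIntegral_iff.1 hγ
  have h2 : (m : ℚ) = 2 * z := by
    have : (z : ℚ) = m / 2 := hz
    linarith
  have h3 : (m : ℤ) = 2 * z := by exact_mod_cast h2
  rw [Nat.odd_iff] at hm
  omega

theorem sum_eq_sum_odd_mul_two {G : Type*} [Group G] [Fintype G] (ψ : G → ℂ) :
    ∑ g, ψ g = ∑ x : G with Odd (orderOf x),
      ∑ c with c ∈ Subgroup.centralizer {x} ∧ ∃ i : ℕ, c ^ 2 ^ i = 1, ψ (x * c) := by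
  obtain ⟨e, m, hm, hn⟩ := Nat.exists_eq_two_pow_mul_odd (Fintype.card_ne_zero (α := G))
  obtain ⟨a, ha2, ham⟩ := Nat.chineseRemainder
    (Nat.Coprime.pow_left e (Nat.coprime_two_left.2 hm)) 0 1
  obtain ⟨a₂, ha₂⟩ : 2 ^ e ∣ a := (Nat.modEq_zero_iff_dvd.1 ha2)
  obtain ⟨z, hz⟩ := ham.dvd
  have hpow : ∀ g : G, g ^ (2 ^ e * m) = 1 := fun g => by rw [← hn, pow_card_eq_one]
  have hpow2 : ∀ c : G, (∃ i : ℕ, c ^ 2 ^ i = 1) → c ^ 2 ^ e = 1 := by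
    rintro c ⟨i, hi⟩
    obtain ⟨j, hj, hj'⟩ := (Nat.dvd_prime_pow Nat.prime_two).1 (orderOf_dvd_of_pow_eq_one hi)
    rw [← orderOf_dvd_iff_pow_eq_one, hj']
    have h1 : 2 ^ j ∣ 2 ^ e * m := by
      rw [← hj', orderOf_dvd_iff_pow_eq_one, hpow]
    exact (Nat.Coprime.pow_left j (Nat.coprime_two_left.2 hm)).dvd_of_dvd_mul_right h1
  rw [← Finset.sum_fiberwise _ fun g : G => g ^ a, Finset.sum_filter]
  refine Finset.sum_congr rfl fun x _ => ?_
  split_ifs with hx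
  · have hxm : x ^ m = 1 := by
      rw [← orderOf_dvd_iff_pow_eq_one]
      have h1 : orderOf x ∣ 2 ^ e * m := by rw [orderOf_dvd_iff_pow_eq_one, hpow]
      exact (Nat.Coprime.pow_right e (Nat.coprime_two_right.2 hx)).dvd_of_dvd_mul_left h1
    have hxa : x ^ a = x := by
      conv_rhs => rw [← pow_one x]
      rw [pow_eq_pow_iff_modEq]
      exact ham.of_dvd (orderOf_dvd_of_pow_eq_one hxm)
    refine (Finset.sum_equiv (Equiv.mulLeft x) (fun c => ?_) fun c _ => rfl).symm
    simp only [Finset.mem_filter, Finset.mem_univ, true_and, Equiv.coe_mulLeft,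
      Subgroup.mem_centralizer_singleton_iff]
    constructor
    · rintro ⟨hc, hc2⟩
      have hc' : Commute x c := hc.symm
      rw [hc'.mul_pow, hxa, ha₂, pow_mul c, hpow2 c hc2, one_pow, mul_one]
    · intro h
      have hcx : Commute (x * c) x := by
        conv_rhs => rw [← h]
        exact Commute.self_pow _ _
      have hcx' : Commute c x := by
        have := (Commute.refl x).inv_left.mul_left hcx
        rwa [inv_mul_cancel_left] at this
      refine ⟨hcx'.eq, e, ?_⟩
      have h1 : c = (x * c) ^ (m * z : ℤ) := by
        rw [← hz, _root_.zpow_sub]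
        simp [h]
        rw [← hcx'.eq]
        simp
      rw [h1, ← zpow_natCast, ← _root_.zpow_mul, mul_right_comm]
      have h2 : ((m : ℤ) * ((2 ^ e : ℕ) : ℤ)) = ((2 ^ e * m : ℕ) : ℤ) := by
        push_cast
        ring
      rw [h2, _root_.zpow_mul, zpow_natCast, hpow, _root_.one_zpow]
  · refine Finset.sum_eq_zero fun g hg => (hx ?_).elim
    have hg' : g ^ a = x := (Finset.mem_filter.1 hg).2
    refine Odd.of_dvd_nat hm (orderOf_dvd_of_pow_eq_one ?_)
    rw [← hg', ← pow_mul, ha₂, mul_right_comm, pow_mul, hpow, one_pow]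

theorem false_of_sum_two_elements {G : Type*} [Group G] [Fintype G] {ψ : G → ℂ}
    (hψ : ∀ g h, ψ (g * h * g⁻¹) = ψ h) (hsum : ∑ g, ψ g = Fintype.card G)
    (h : ∀ x : G, Odd (orderOf x) → ∀ k : ℕ, ∃ α β : ℂ, IsIntegral ℤ α ∧ IsIntegral ℤ β ∧
      ∑ c with c ∈ Subgroup.centralizer {x} ∧ ∃ i : ℕ, c ^ 2 ^ i = 1, ψ (x * c)
        = Nat.card (Subgroup.centralizer {x}) * (2 * α) + 2 ^ k * β) : False := by
  obtain ⟨e, m, hm, hn⟩ := Nat.exists_eq_two_pow_mul_odd (Fintype.card_ne_zero (α := G))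
  let S : G → ℂ := fun x =>
    ∑ c with c ∈ Subgroup.centralizer {x} ∧ ∃ i : ℕ, c ^ 2 ^ i = 1, ψ (x * c)
  have hcent : ∀ g x c : G, g * c * g⁻¹ ∈ Subgroup.centralizer {g * x * g⁻¹}
      ↔ c ∈ Subgroup.centralizer {x} := by
    intro g x c
    simp only [Subgroup.mem_centralizer_singleton_iff]
    have e1 : g * c * g⁻¹ * (g * x * g⁻¹) = g * (c * x) * g⁻¹ := by group
    have e2 : g * x * g⁻¹ * (g * c * g⁻¹) = g * (x * c) * g⁻¹ := by group
    rw [e1, e2, mul_left_inj, mul_right_inj]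
  have hS : ∀ g x, S (g * x * g⁻¹) = S x := by
    intro g x
    refine (Finset.sum_equiv (MulAut.conj g).toEquiv (fun c => ?_) fun c _ => ?_).symm
    · simp only [Finset.mem_filter, Finset.mem_univ, true_and, MulEquiv.toEquiv_eq_coe,
        EquivLike.coe_coe, MulAut.conj_apply, hcent, conj_pow, conj_eq_one_iff]
    · simp only [MulEquiv.toEquiv_eq_coe, EquivLike.coe_coe, MulAut.conj_apply]
      rw [← hψ g]
      congr 1
      group
  have hC : ∀ g x : G, Nat.card (Subgroup.centralizer {g * x * g⁻¹})
      = Nat.card (Subgroup.centralizer {x}) := by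
    intro g x
    simp only [Nat.card_eq_fintype_card, Fintype.card_subtype]
    refine (Finset.card_equiv (MulAut.conj g).toEquiv fun c => ?_).symm
    simp only [Finset.mem_filter, Finset.mem_univ, true_and, MulEquiv.toEquiv_eq_coe,
      EquivLike.coe_coe, MulAut.conj_apply, hcent]
  choose! α β hα hβ hαβ using fun x hx => h x hx (e + 1)
  have hout : ∀ x : G, ∃ g, g * (ConjClasses.mk x).out * g⁻¹ = x := by
    intro x
    rw [← isConj_iff, ← ConjClasses.mk_eq_mk_iff_isConj]
    exact Quotient.out_eq _
  have hodd : ∀ x : G, Odd (orderOf x) ↔ Odd (orderOf (ConjClasses.mk x).out) := by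
    intro x
    obtain ⟨g, hg⟩ := hout x
    conv_lhs => rw [← hg, ← MulAut.conj_apply, MulEquiv.orderOf_eq]
  let a : ConjClasses G → ℂ := fun κ => if Odd (orderOf κ.out) then α κ.out else 0
  let b : ConjClasses G → ℂ := fun κ => if Odd (orderOf κ.out) then β κ.out else 0
  have ha : ∀ κ, IsIntegral ℤ (a κ) := fun κ => by
    simp only [a]
    split_ifs with h1
    exacts [hα _ h1, isIntegral_zero]
  have hb : ∀ κ, IsIntegral ℤ (b κ) := fun κ => by
    simp only [b]
    split_ifs with h1
    exacts [hβ _ h1, isIntegral_zero]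
  have h1 : (Fintype.card G : ℂ) = Fintype.card G * (2 * ∑ κ, a κ)
      + 2 ^ (e + 1) * ∑ x : G, b (ConjClasses.mk x) := by
    refine (hsum.symm.trans (sum_eq_sum_odd_mul_two ψ)).trans ?_
    rw [mul_left_comm, ← sum_card_centralizer_mul,
      Finset.mul_sum, Finset.mul_sum, ← Finset.sum_add_distrib, Finset.sum_filter]
    refine Finset.sum_congr rfl fun x _ => ?_
    simp only [a, b, ← hodd x]
    split_ifs with h2
    · obtain ⟨g, hg⟩ := hout x
      have h3 := hαβ _ ((hodd x).1 h2)
      have h4 := hS g (ConjClasses.mk x).out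
      have h5 := hC g (ConjClasses.mk x).out
      rw [hg] at h4 h5
      rw [h5]
      refine (h4.trans h3).trans ?_
      ring
    · simp
  rw [hn] at h1
  push_cast at h1
  have h2 : (2 : ℂ) ^ e ≠ 0 := pow_ne_zero _ two_ne_zero
  refine not_isIntegral_of_two_mul_eq hm
    (γ := m * ∑ κ, a κ + ∑ x : G, b (ConjClasses.mk x)) (mul_left_cancel₀ h2 ?_) ?_
  · rw [h1]
    ring
  · refine IsIntegral.add (IsIntegral.mul ?_ (IsIntegral.sum _ fun κ _ => ha κ))
      (IsIntegral.sum _ fun x _ => hb _)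
    exact isIntegral_algebraMap (R := ℤ) (x := (m : ℤ))

end OddParts

section BrauerCriterion

/-- The elements of `E` which centralize `x` or conjugate it to its inverse according to their
sign. -/
def signedCentralizer {A : Type*} [Group A] (sgn : A →* ℤˣ) (E : Subgroup A) (x : A) :
    Subgroup A where
  carrier := {g | g ∈ E ∧ g * x * g⁻¹ = x ^ (sgn g : ℤ)}
  one_mem' := ⟨E.one_mem, by simp⟩
  mul_mem' := by
    rintro g h ⟨hg, hg'⟩ ⟨hh, hh'⟩
    refine ⟨E.mul_mem hg hh, ?_⟩
    have e : g * h * x * (g * h)⁻¹ = g * (h * x * h⁻¹) * g⁻¹ := by group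
    rw [e, hh', ← conj_zpow, hg', ← _root_.zpow_mul, map_mul, Units.val_mul]
  inv_mem' := by
    rintro g ⟨hg, hg'⟩
    refine ⟨E.inv_mem hg, ?_⟩
    have h1 : (sgn g⁻¹ : ℤ) = sgn g := by
      rw [map_inv, Int.units_inv_eq_self]
    have h2 : (sgn g : ℤ) * sgn g = 1 := by
      rw [← Units.val_mul, Int.units_mul_self, Units.val_one]
    have h3 : x = g⁻¹ * x ^ (sgn g : ℤ) * g := by
      rw [← hg']
      group
    have h4 : g⁻¹ * x * g⁻¹⁻¹ = (g⁻¹ * x ^ (sgn g : ℤ) * g⁻¹⁻¹) ^ (sgn g : ℤ) := by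
      rw [conj_zpow, ← _root_.zpow_mul, h2, zpow_one]
    rw [h4, inv_inv, ← h3, h1]

theorem IsSimpleRep.not_hasStr_neg_one {A : Type} [Group A] [Fintype A] {sgn : A →* ℤˣ}
    {E : Subgroup A} {U : Type} [AddCommGroup U] [Module ℂ U] [FiniteDimensional ℂ U]
    {ρ : A → Module.End ℂ U} (hρ : IsSimpleRep (evenPart sgn E) ρ)
    (h : ∀ x ∈ evenPart sgn E, Odd (orderOf x) → ∃ T E' : Subgroup A, T ≤ E' ∧ E' ≤ E ∧ x ∈ E' ∧
      T ≤ signedCentralizer sgn E x ∧ IsPGroup 2 T ∧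
      Odd (T.relIndex (signedCentralizer sgn E x)) ∧ (∃ τ ∈ T, sgn τ = -1) ∧
      HasStr sgn E' 1 ρ) : ¬HasStr sgn E (-1) ρ := by
  intro hs
  have hR := hρ.toIsRep
  refine false_of_sum_two_elements (G := evenPart sgn E)
    (ψ := fun g => LinearMap.trace ℂ U (ρ g) * LinearMap.trace ℂ U (ρ (g : A)⁻¹)) ?_ ?_ ?_
  · intro g h
    have e : ((g : A) * h * (g : A)⁻¹)⁻¹ = g * (h : A)⁻¹ * (g : A)⁻¹ := by group
    simp only [Subgroup.coe_mul, Subgroup.coe_inv]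
    rw [e, hR.trace_conj g.2 h.2, hR.trace_conj g.2 (inv_mem h.2)]
  · have h1 := hρ.sum_normSq
    rw [sum_filter_mem_eq] at h1
    rw [← Nat.card_eq_fintype_card, ← Complex.ofReal_natCast, ← h1]
    push_cast
    refine Finset.sum_congr rfl fun g _ => ?_
    rw [hR.trace_inv g.2, Complex.mul_conj]
  intro x hx k
  obtain ⟨T, E', hTE', hE'E, hxE', hTC, hT, hodd, ⟨τ, hτT, hτ⟩, hplus⟩ :=
    h x x.2 (by simpa using hx)
  have hxs : sgn (x : A) = 1 := x.2.2
  obtain ⟨J, hJ, hJJ⟩ := hs.change hR (hE'E (hTE' hτT)) hτ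
  obtain ⟨J', hJ', hJJ'⟩ := hplus.change (hR.mono (evenPart_mono sgn hE'E)) (hTE' hτT) hτ
  let C := signedCentralizer sgn E x
  have hmem : ∀ c : A, c ∈ C ∧ sgn c = 1 ↔ c ∈ evenPart sgn E ∧ c * x = x * c := by
    intro c
    constructor
    · rintro ⟨⟨hc, hc'⟩, hc1⟩
      rw [hc1, Units.val_one, zpow_one, mul_inv_eq_iff_eq_mul] at hc'
      exact ⟨⟨hc, hc1⟩, hc'⟩
    · rintro ⟨⟨hc, hc1⟩, hc'⟩
      have hc2 : sgn c = 1 := hc1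
      refine ⟨⟨hc, ?_⟩, hc1⟩
      rw [hc2, Units.val_one, zpow_one, mul_inv_eq_iff_eq_mul, hc']
  have hxC : (x : A) ∈ C := ((hmem x).2 ⟨x.2, rfl⟩).1
  let s : C →* ℤˣ := sgn.comp C.subtype
  have hker : ∀ c : C, c ∈ s.ker → (c : A) ∈ evenPart sgn E := fun c hc =>
    ((hmem c).1 ⟨c.2, hc⟩).1
  have hτC := hTC hτT
  have hτx : τ * x * τ⁻¹ = (x : A)⁻¹ := by
    rw [hτC.2, hτ]
    simp
  have hρC : IsRep s.ker fun c : C => ρ c :=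
    ⟨hR.one, fun g hg h hh => hR.mul g (hker g hg) h (hker h hh)⟩
  obtain ⟨α, β, hα, hβ, hsum⟩ := hρC.exists_sum_two_elements (x := ⟨x, hxC⟩) (τ := ⟨τ, hτC⟩)
    (T := T.subgroupOf C) (J := J) (J' := J') hxs
    (fun g hg => Subtype.ext ((hmem g).1 ⟨g.2, hg⟩).2) hτ (Subtype.ext hτx) hτT
    (hT.comap_of_injective C.subtype C.subtype_injective) hodd
    (fun h hh => hJ h (hker h hh)) (fun u => by simpa using hJJ u)
    (fun h hh => hJ' h ⟨hTE' hh.1, hh.2⟩)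
    (fun u => by
      rw [hJ' x ⟨hxE', hxs⟩, hτx]
      rfl)
    (fun u => by simpa using hJJ' u) k
  refine ⟨α, β, hα, hβ, ?_⟩
  let f : s.ker ≃ Subgroup.centralizer {x} :=
    { toFun := fun c => ⟨⟨c, hker c c.2⟩, by
        rw [Subgroup.mem_centralizer_singleton_iff]
        exact Subtype.ext ((hmem c).1 ⟨c.1.2, c.2⟩).2⟩
      invFun := fun c => ⟨⟨c, ((hmem c).2 ⟨c.1.2, congrArg Subtype.val
        (Subgroup.mem_centralizer_singleton_iff.1 c.2)⟩).1⟩, c.1.2.2⟩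
      left_inv := fun c => rfl
      right_inv := fun c => rfl }
  rw [← Nat.card_congr f]
  rw [← hsum]
  symm
  refine Finset.sum_bij (fun c hc => (f ⟨c, (Finset.mem_filter.1 hc).2.1⟩ : evenPart sgn E))
    (fun c hc => ?_) (fun c _ d _ h => ?_) (fun c hc => ?_)
    fun c _ => rfl
  · obtain ⟨-, hc, i, hi⟩ := Finset.mem_filter.1 hc
    have hi' := congrArg Subtype.val hi
    exact Finset.mem_filter.2 ⟨Finset.mem_univ _, (f ⟨c, hc⟩).2, i, Subtype.ext hi'⟩
  · have h' := congrArg Subtype.val h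
    exact Subtype.ext h'
  · obtain ⟨-, hc, i, hi⟩ := Finset.mem_filter.1 hc
    have hi' := congrArg Subtype.val hi
    exact ⟨f.symm ⟨c, hc⟩, Finset.mem_filter.2 ⟨Finset.mem_univ _, (f.symm ⟨c, hc⟩).2, i,
      Subtype.ext hi'⟩, rfl⟩

end BrauerCriterion

section FiniteMonogenicRings

theorem exists_pow_isIdempotentElem {B : Type*} [Monoid B] [Finite B] (b : B) :
    ∃ n, 0 < n ∧ IsIdempotentElem (b ^ n) := by
  obtain ⟨i, j, hij, h⟩ := Set.finite_univ.exists_lt_map_eq_of_forall_mem (f := fun n : ℕ => b ^ n)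
    fun n => Set.mem_univ _
  obtain ⟨d, rfl⟩ := Nat.exists_eq_add_of_lt hij
  have h1 : ∀ k m, i ≤ m → b ^ (m + k * (d + 1)) = b ^ m := by
    intro k
    induction k with
    | zero => simp
    | succ k ih =>
      intro m hm
      obtain ⟨r, rfl⟩ := Nat.exists_eq_add_of_le hm
      rw [← ih _ hm, add_one_mul, ← add_assoc, pow_add _ _ (d + 1)]
      have e : i + r + k * (d + 1) = i + (r + k * (d + 1)) := by ring
      rw [e, add_comm i, pow_add, mul_assoc, ← pow_add, ← add_assoc, ← h]
  refine ⟨(i + 1) * (d + 1), by positivity, ?_⟩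
  rw [IsIdempotentElem, ← pow_add]
  exact h1 _ _ (by nlinarith)

/-- A ring which is generated by one element over a subring on which some power map is trivial. -/
def IsMonogenicOverReduced (B : Type*) [CommRing B] : Prop :=
  ∃ (K : Subring B) (x : B) (N : ℕ), 2 ≤ N ∧ (∀ b ∈ K, b ^ N = b) ∧
    Subring.closure (K ∪ {x}) = ⊤

theorem IsMonogenicOverReduced.of_surjective {B C : Type*} [CommRing B] [CommRing C]
    (hB : IsMonogenicOverReduced B) (f : B →+* C) (hf : Function.Surjective f) :
    IsMonogenicOverReduced C := by
  obtain ⟨K, x, N, hN, hK, h⟩ := hB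
  refine ⟨K.map f, f x, N, hN, ?_, ?_⟩
  · rintro _ ⟨b, hb, rfl⟩
    rw [← map_pow, hK b hb]
  · have h1 := congrArg (Subring.map f) h
    rw [RingHom.map_closure, Set.image_union, Set.image_singleton, ← RingHom.range_eq_map,
      RingHom.range_eq_top.2 hf] at h1
    simpa using h1

theorem IsMonogenicOverReduced.isPrincipalIdealRing {B : Type*} [CommRing B]
    (hB : IsMonogenicOverReduced B) (hidem : ∀ e : B, IsIdempotentElem e → e = 0 ∨ e = 1) :
    IsPrincipalIdealRing B := by
  nontriviality B
  obtain ⟨K, x, N, hN, hK, h⟩ := hB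
  have hfield : IsField K := by
    refine ⟨⟨0, 1, zero_ne_one⟩, mul_comm, fun {a} ha => ?_⟩
    obtain ⟨n, rfl⟩ := Nat.exists_eq_add_of_le hN
    have h1 : (a : B) ^ (n + 2) = a := by
      rw [add_comm]
      exact hK a a.2
    refine ⟨a ^ n, Subtype.ext ?_⟩
    have h2 : IsIdempotentElem ((a : B) ^ (n + 1)) := by
      have e : (a : B) ^ (n + 1) * a ^ (n + 1) = a ^ (n + 2) * a ^ n := by ring
      rw [IsIdempotentElem, e, h1]
      ring
    have h3 : ((a * a ^ n : K) : B) = (a : B) ^ (n + 1) := by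
      push_cast
      ring
    rw [h3]
    refine (hidem _ h2).resolve_left fun h4 => ha (Subtype.ext ?_)
    rw [← h1, pow_succ, h4, zero_mul]
    rfl
  have hpir : IsPrincipalIdealRing (Polynomial K) := by
    let := hfield.toField
    infer_instance
  refine IsPrincipalIdealRing.of_surjective (Polynomial.eval₂RingHom K.subtype x) ?_
  rw [← RingHom.range_eq_top, eq_top_iff, ← h, Subring.closure_le]
  rintro b (hb | hb)
  · exact ⟨Polynomial.C ⟨b, hb⟩, by simp⟩
  · refine ⟨Polynomial.X, ?_⟩
    rw [Set.mem_singleton_iff.1 hb]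
    simp

theorem IsMonogenicOverReduced.dvd_total {B : Type*} [CommRing B] [Finite B]
    (hB : IsMonogenicOverReduced B) (hidem : ∀ e : B, IsIdempotentElem e → e = 0 ∨ e = 1)
    (b c : B) : b ∣ c ∨ c ∣ b := by
  have := hB.isPrincipalIdealRing hidem
  have hnil : ∀ b : B, ¬IsUnit b → IsNilpotent b := by
    intro b hb
    obtain ⟨n, hn, h⟩ := exists_pow_isIdempotentElem b
    refine ⟨n, (hidem _ h).resolve_right fun h1 => hb ?_⟩
    exact IsUnit.of_pow_eq_one h1 hn.ne'
  obtain ⟨d, hd⟩ := (inferInstance : (Ideal.span {b, c}).IsPrincipal)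
  have hd' : Ideal.span {b, c} = Ideal.span {d} := hd
  obtain ⟨b', hb'⟩ : d ∣ b := by
    rw [← Ideal.mem_span_singleton, ← hd']
    exact Ideal.subset_span (by simp)
  obtain ⟨c', hc'⟩ : d ∣ c := by
    rw [← Ideal.mem_span_singleton, ← hd']
    exact Ideal.subset_span (by simp)
  have h1 : d ∈ Ideal.span {b, c} := hd' ▸ Ideal.mem_span_singleton_self d
  obtain ⟨r, t, hrt⟩ := Ideal.mem_span_pair.1 h1
  by_cases hbu : IsUnit b'
  · left
    rw [hb', hc']
    exact (hbu.mul_right_dvd.2 dvd_rfl).trans (dvd_mul_right _ _)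
  by_cases hcu : IsUnit c'
  · right
    rw [hb', hc']
    exact (hcu.mul_right_dvd.2 dvd_rfl).trans (dvd_mul_right _ _)
  have h2 : IsNilpotent (r * b' + t * c') :=
    (Commute.all _ _).isNilpotent_add ((Commute.all _ _).isNilpotent_mul_left (hnil _ hbu))
      ((Commute.all _ _).isNilpotent_mul_left (hnil _ hcu))
  have h3 : d * (1 - (r * b' + t * c')) = 0 := by
    rw [hb', hc'] at hrt
    linear_combination -hrt
  have h4 : d = 0 := by
    rwa [h2.isUnit_one_sub.mul_left_eq_zero] at h3
  left
  rw [hc', h4, zero_mul]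
  exact dvd_zero _

theorem IsMonogenicOverReduced.exists_socle {B : Type*} [CommRing B] [Finite B]
    (hB : IsMonogenicOverReduced B) {e : B} (he : IsIdempotentElem e) (he0 : e ≠ 0)
    (hprim : ∀ f : B, IsIdempotentElem f → f * e = 0 ∨ f * e = e) :
    (∀ b c : B, e * b ∣ e * c ∨ e * c ∣ e * b) ∧
      ∃ s : B, s ≠ 0 ∧ e * s = s ∧ ∀ b : B, e * b ≠ 0 → e * b ∣ s := by
  have htot : ∀ b c : B, e * b ∣ e * c ∨ e * c ∣ e * b := by
    intro b c
    let I : Ideal B := Ideal.span {1 - e}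
    have hI : ∀ b, b ∈ I ↔ e * b = 0 := by
      intro b
      rw [Ideal.mem_span_singleton]
      constructor
      · rintro ⟨d, rfl⟩
        rw [← mul_assoc, mul_sub, mul_one, he.eq, sub_self, zero_mul]
      · intro h
        exact ⟨b, by rw [sub_mul, one_mul, h, sub_zero]⟩
    have hidem : ∀ f : B ⧸ I, IsIdempotentElem f → f = 0 ∨ f = 1 := by
      intro f hf
      obtain ⟨b, rfl⟩ := Ideal.Quotient.mk_surjective f
      have h1 : e * (b * b - b) = 0 := by
        rw [← hI, ← Ideal.Quotient.eq_zero_iff_mem, map_sub, map_mul, hf.eq, sub_self]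
      have h2 : IsIdempotentElem (e * b) := by
        have := he.eq
        rw [IsIdempotentElem]
        linear_combination b * b * this + h1
      rcases hprim _ h2 with h3 | h3
      · left
        rw [Ideal.Quotient.eq_zero_iff_mem, hI]
        have := he.eq
        linear_combination h3 - b * this
      · right
        rw [← map_one (Ideal.Quotient.mk I), Ideal.Quotient.eq, hI]
        have := he.eq
        linear_combination h3 - b * this
    have key : ∀ b c : B, Ideal.Quotient.mk I b ∣ Ideal.Quotient.mk I c → e * b ∣ e * c := by
      rintro b c ⟨d, hd⟩
      obtain ⟨d, rfl⟩ := Ideal.Quotient.mk_surjective d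
      rw [← map_mul, Ideal.Quotient.eq, hI] at hd
      exact ⟨d, by linear_combination hd⟩
    have : Finite (B ⧸ I) := Finite.of_surjective _ Ideal.Quotient.mk_surjective
    exact ((hB.of_surjective _ Ideal.Quotient.mk_surjective).dvd_total hidem _ _).imp
      (key b c) (key c b)
  refine ⟨htot, ?_⟩
  obtain ⟨s, hs, hmin⟩ := Set.Finite.exists_minimalFor (fun b : B => Nat.card (Ideal.span {b}))
    {b | b ≠ 0 ∧ e * b = b} (Set.toFinite _) ⟨e, he0, he.eq⟩
  refine ⟨s, hs.1, hs.2, fun b hb => ?_⟩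
  have h0 := htot b s
  rw [hs.2] at h0
  rcases h0 with h1 | h1
  · exact h1
  have h2 : Ideal.span {e * b} ≤ Ideal.span {s} := Ideal.span_singleton_le_span_singleton.2 h1
  have h3 : Nat.card (Ideal.span {s}) ≤ Nat.card (Ideal.span {e * b}) := by
    rcases le_total (Nat.card (Ideal.span {s})) (Nat.card (Ideal.span {e * b})) with h | h
    · exact h
    · exact hmin (j := e * b) ⟨hb, by rw [← mul_assoc, he.eq]⟩ h
  have h4 : Ideal.span {e * b} = Ideal.span {s} :=
    SetLike.coe_injective (Set.eq_of_subset_of_ncard_le h2 h3)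
  exact Ideal.span_singleton_le_span_singleton.1 h4.ge

end FiniteMonogenicRings

section AdaptedForms

variable {F B V : Type*} [Field F] [CommRing B] [Algebra F B] [AddCommGroup V] [Module F V]
  [Module B V]

/-- A nondegenerate bilinear form on a `B`-module for which the involution `σ` of `B` gives the
adjoints, and whose asymmetry is the scalar `u`. -/
structure IsAdapted (σ : B →ₐ[F] B) (u : B) (A : V →ₗ[F] V →ₗ[F] F) : Prop where
  invol : ∀ b, σ (σ b) = b
  smul_left : ∀ b v w, A (b • v) w = A v (σ b • w)
  swap : ∀ v w, A v w = A w (u • v)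
  nondeg : ∀ v, v ≠ 0 → ∃ w, A w v ≠ 0

/-- The existence of a `σ`-semilinear involution which is an anti-isometry of `A`. -/
def HasAntiInvolution (σ : B →ₐ[F] B) (A : V →ₗ[F] V →ₗ[F] F) : Prop :=
  ∃ y : V →ₗ[F] V, (∀ v, y (y v) = v) ∧ (∀ (b : B) v, y (b • v) = σ b • y v) ∧
    ∀ v w, A (y v) (y w) = A w v

/-- A submodule on which the form is nondegenerate. -/
def IsNondegenerateOn (A : V →ₗ[F] V →ₗ[F] F) (W : Submodule B V) : Prop :=
  ∀ t ∈ W, t ≠ 0 → ∃ t' ∈ W, A t' t ≠ 0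

variable {σ : B →ₐ[F] B} {u : B} {A : V →ₗ[F] V →ₗ[F] F}

theorem IsAdapted.smul_right (h : IsAdapted σ u A) (b : B) (v w : V) :
    A v (b • w) = A (σ b • v) w := by
  rw [h.smul_left, h.invol]

theorem IsAdapted.hasAntiInvolution_of_cyclic [IsScalarTower F B V] (h : IsAdapted σ u A)
    (hfaith : ∀ b : B, (∀ v : V, b • v = 0) → b = 0) {z : V}
    (hz : Submodule.span B {z} = ⊤) : HasAntiInvolution σ A := by
  have hsurj : ∀ v : V, ∃ b : B, b • z = v := fun v =>
    Submodule.mem_span_singleton.1 (hz ▸ Submodule.mem_top)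
  have hinj : ∀ b : B, b • z = 0 → b = 0 := by
    intro b hb
    refine hfaith b fun v => ?_
    obtain ⟨c, rfl⟩ := hsurj v
    rw [smul_comm, hb, smul_zero]
  let f : B →ₗ[F] V := (LinearMap.toSpanSingleton B V z).restrictScalars F
  have hf : ∀ b, f b = b • z := fun b => rfl
  let e : B ≃ₗ[F] V := LinearEquiv.ofBijective f
    ⟨(injective_iff_map_eq_zero f).2 fun b hb => hinj b hb, hsurj⟩
  have he : ∀ b, e b = b • z := fun b => rfl
  have hy : ∀ b, (e.toLinearMap ∘ₗ σ.toLinearMap ∘ₗ e.symm.toLinearMap) (b • z) = σ b • z := by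
    intro b
    simp only [LinearMap.comp_apply, LinearEquiv.coe_coe, AlgHom.toLinearMap_apply, ← he,
      LinearEquiv.symm_apply_apply]
  refine ⟨e.toLinearMap ∘ₗ σ.toLinearMap ∘ₗ e.symm.toLinearMap, fun v => ?_, fun b v => ?_,
    fun v w => ?_⟩
  · obtain ⟨b, rfl⟩ := hsurj v
    rw [hy, hy, h.invol]
  · obtain ⟨c, rfl⟩ := hsurj v
    rw [← mul_smul, hy, hy, map_mul, mul_smul]
  · obtain ⟨b, rfl⟩ := hsurj v
    obtain ⟨c, rfl⟩ := hsurj w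
    rw [hy, hy, h.smul_left, h.smul_left, h.invol, smul_smul, smul_smul, mul_comm]

theorem IsAdapted.idempotent_cases (h : IsAdapted σ u A)
    (hfaith : ∀ b : B, (∀ v : V, b • v = 0) → b = 0)
    (hind : ∀ W : Submodule B V, IsNondegenerateOn A W → W = ⊥ ∨ W = ⊤) {e : B}
    (he : IsIdempotentElem e) : e = 0 ∨ e = 1 ∨ σ e = 1 - e := by
  have key : ∀ f : B, IsIdempotentElem f → σ f = f → f = 0 ∨ f = 1 := by
    intro f hf hσ
    have h1 : ∀ v : V, f • f • v = f • v := fun v => by rw [smul_smul, hf.eq]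
    rcases hind (LinearMap.range (LinearMap.lsmul B V f)) (by
      rintro _ ⟨v, rfl⟩ hv
      obtain ⟨w, hw⟩ := h.nondeg _ hv
      refine ⟨f • w, ⟨w, rfl⟩, ?_⟩
      rw [h.smul_left, hσ]
      simpa [h1] using hw) with h2 | h2
    · left
      refine hfaith f fun v => ?_
      have h3 : f • v ∈ LinearMap.range (LinearMap.lsmul B V f) := ⟨v, rfl⟩
      rwa [h2, Submodule.mem_bot] at h3
    · right
      refine (sub_eq_zero.1 (hfaith (1 - f) fun v => ?_)).symm
      have h3 : v ∈ LinearMap.range (LinearMap.lsmul B V f) := h2 ▸ Submodule.mem_top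
      obtain ⟨w, rfl⟩ := h3
      rw [sub_smul, one_smul, LinearMap.lsmul_apply, h1, sub_self]
  have he1 := he.eq
  have he2 : σ e * σ e = σ e := by rw [← map_mul, he1]
  rcases key (e * σ e) (by
    rw [IsIdempotentElem]
    linear_combination (σ e * σ e) * he1 + e * he2)
      (by rw [map_mul, h.invol, mul_comm]) with h1 | h1
  · rcases key (e + σ e) (by
      rw [IsIdempotentElem]
      linear_combination he1 + he2 + 2 * h1) (by rw [map_add, h.invol, add_comm]) with h2 | h2
    · left
      linear_combination e * h2 - h1 - he1
    · right; right
      linear_combination h2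
  · right; left
    linear_combination (1 - e) * h1 + σ e * he1

theorem IsAdapted.hasAntiInvolution_of_hyperbolic [Finite B] [IsScalarTower F B V]
    (h : IsAdapted σ u A) (hB : IsMonogenicOverReduced B)
    (hfaith : ∀ b : B, (∀ v : V, b • v = 0) → b = 0)
    (hind : ∀ W : Submodule B V, IsNondegenerateOn A W → W = ⊥ ∨ W = ⊤) {e : B}
    (he : IsIdempotentElem e) (he0 : e ≠ 0) (hσe : σ e = 1 - e) : HasAntiInvolution σ A := by
  have he1 := he.eq
  obtain ⟨-, s, hs0, hes, hs⟩ := hB.exists_socle he he0 (by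
    intro f hf
    rcases h.idempotent_cases hfaith hind (hf.mul he) with h1 | h1 | h1
    · exact Or.inl h1
    · right
      linear_combination e * h1 - f * he1
    · right
      rw [map_mul, hσe] at h1
      linear_combination e * h1 + (σ f - f) * he1)
  obtain ⟨v, hv⟩ : ∃ v : V, s • v ≠ 0 := by
    by_contra! hc
    exact hs0 (hfaith s hc)
  obtain ⟨w, hw⟩ := h.nondeg _ hv
  obtain ⟨v, w, hev, hew, hw⟩ : ∃ v w : V, e • v = v ∧ e • w = 0 ∧ A w (s • v) ≠ 0 := by
    refine ⟨e • v, (1 - e) • w, by rw [smul_smul, he1], ?_, ?_⟩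
    · rw [smul_smul, mul_sub, mul_one, he1, sub_self, zero_smul]
    · have h1 : σ (1 - e) = e := by rw [map_sub, map_one, hσe]; ring
      rw [h.smul_left, h1, smul_smul, smul_smul]
      have h2 : e * s * e = s := by rw [mul_assoc, mul_comm s, ← mul_assoc, he1, hes]
      rwa [h2]
  have hww : ∀ b : B, A w (b • w) = 0 := by
    intro b
    have h1 : w = σ e • w := by rw [hσe, sub_smul, one_smul, hew, sub_zero]
    conv_lhs => rw [h1]
    rw [h.smul_left, h.invol, ← h1, smul_comm, hew, smul_zero, map_zero]
  have hez : e • (v + w) = v := by rw [smul_add, hev, hew, add_zero]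
  have hez' : (1 - e) • (v + w) = w := by rw [sub_smul, one_smul, hez, add_sub_cancel_left]
  refine h.hasAntiInvolution_of_cyclic hfaith (z := v + w) ((hind _ ?_).resolve_left ?_)
  · intro t ht ht0
    obtain ⟨b, rfl⟩ := Submodule.mem_span_singleton.1 ht
    by_cases hb : e * b = 0
    · have h1 : b • (v + w) = b • w := by
        rw [smul_add, ← hev, smul_smul, mul_comm, hb, zero_smul, zero_add]
      have h2 : e * σ b = σ b := by
        have h3 := congrArg σ hb
        rw [map_mul, hσe, map_zero] at h3
        linear_combination -h3
      have h3 : e * σ b ≠ 0 := by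
        intro h4
        rw [h2] at h4
        have h5 := h.invol b
        rw [h4, map_zero] at h5
        exact ht0 (by rw [← h5, zero_smul])
      obtain ⟨d, hd⟩ := hs _ h3
      refine ⟨(σ u * d * e) • (v + w), Submodule.smul_mem _ _
        (Submodule.mem_span_singleton_self _), ?_⟩
      rw [mul_smul, hez, h1, mul_smul, h.smul_left, h.invol, ← h.swap, h.smul_left, smul_smul]
      rwa [← h2, ← hd]
    · obtain ⟨d, hd⟩ := hs _ hb
      refine ⟨(σ d * (1 - e)) • (v + w), Submodule.smul_mem _ _
        (Submodule.mem_span_singleton_self _), ?_⟩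
      rw [mul_smul, hez', h.smul_left, h.invol, smul_smul, smul_add, map_add, hww, add_zero]
      have h1 : d * b * e = s := by rw [hd]; ring
      rwa [← hev, smul_smul, h1]
  · intro h1
    rw [Submodule.span_singleton_eq_bot] at h1
    rw [h1, smul_zero] at hez
    rw [← hez, smul_zero, map_zero] at hw
    exact hw rfl

theorem IsAdapted.hasAntiInvolution_of_local [Finite B]
    [FiniteDimensional F B] [IsScalarTower F B V]
    [Nontrivial B]
    (h : IsAdapted σ u A) (hB : IsMonogenicOverReduced B) (h2 : (2 : F) ≠ 0)
    (hfaith : ∀ b : B, (∀ v : V, b • v = 0) → b = 0)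
    (hind : ∀ W : Submodule B V, IsNondegenerateOn A W → W = ⊥ ∨ W = ⊤)
    (hidem : ∀ e : B, IsIdempotentElem e → e = 0 ∨ e = 1) : HasAntiInvolution σ A := by
  obtain ⟨htot, s, hs0, -, hs⟩ := hB.exists_socle (e := 1) IsIdempotentElem.one one_ne_zero (by
    intro f hf
    simpa using hidem f hf)
  simp only [one_mul] at htot hs
  by_cases hcyc : ∃ (b : B) (v : V), A (b • v) (s • v) ≠ 0
  · obtain ⟨b, v, hv⟩ := hcyc
    refine h.hasAntiInvolution_of_cyclic hfaith (z := v) ((hind _ ?_).resolve_left ?_)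
    · intro t ht ht0
      obtain ⟨c, rfl⟩ := Submodule.mem_span_singleton.1 ht
      obtain ⟨d, hd⟩ := hs c (by rintro rfl; exact ht0 (zero_smul _ _))
      refine ⟨(σ d * b) • v, Submodule.smul_mem _ _ (Submodule.mem_span_singleton_self _), ?_⟩
      rw [mul_smul, h.smul_left, h.invol, smul_smul, mul_comm d, ← hd]
      exact hv
    · intro h1
      rw [Submodule.span_singleton_eq_bot] at h1
      rw [h1, smul_zero, smul_zero, map_zero] at hv
      exact hv rfl
  push Not at hcyc
  have hpol : ∀ (b : B) (v w : V), A (b • v) (s • w) + A (b • w) (s • v) = 0 := by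
    intro b v w
    have h1 := hcyc b (v + w)
    simpa [smul_add, hcyc] using h1
  have hanti : ∀ b, σ s * u * b + σ b * s = 0 := by
    intro b
    refine hfaith _ fun v => ?_
    by_contra hc
    obtain ⟨w, hw⟩ := h.nondeg _ hc
    apply hw
    rw [add_smul, map_add, mul_smul (σ b), mul_assoc, mul_smul (σ s), ← h.smul_left,
      ← h.smul_left, mul_smul u, ← h.swap]
    exact hpol b v w
  have hs1 : σ s * u = -s := by
    have h1 := hanti 1
    rw [map_one] at h1
    linear_combination h1
  have hu : σ u * u = 1 := by
    rw [← sub_eq_zero]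
    refine hfaith _ fun v => ?_
    by_contra hc
    obtain ⟨w, hw⟩ := h.nondeg _ hc
    apply hw
    rw [sub_smul, map_sub, one_smul, mul_smul, ← h.smul_left, ← h.swap, ← h.swap, sub_self]
  obtain ⟨v, w, hs', hN⟩ : ∃ v w : V, A v (s • w) ≠ 0 ∧
      ∀ d : B, A v ((σ d * u) • w) = -A v (d • w) := by
    obtain ⟨w, hw⟩ : ∃ w : V, s • w ≠ 0 := by
      by_contra! hc
      exact hs0 (hfaith s hc)
    obtain ⟨v, hv⟩ := h.nondeg _ hw
    let ℓ : B →ₗ[F] F := A v ∘ₗ (LinearMap.toSpanSingleton B V w).restrictScalars F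
    have hℓ : ∀ b, ℓ b = A v (b • w) := fun b => rfl
    let Φ : B →ₗ[F] Module.Dual F B := (LinearMap.mul F B).compr₂ ℓ
    have hΦ : ∀ t d, Φ t d = ℓ (t * d) := fun t d => rfl
    have hΦi : Function.Injective Φ := by
      refine (injective_iff_map_eq_zero Φ).2 fun t ht => ?_
      by_contra h0
      obtain ⟨d, hd⟩ := hs t h0
      apply hv
      rw [← hℓ, hd, ← hΦ, ht, LinearMap.zero_apply]
    obtain ⟨t, ht⟩ := (LinearMap.injective_iff_surjective_of_finrank_eq_finrank
      (Subspace.dual_finrank_eq (K := F) (V := B)).symm).1 hΦi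
      (ℓ - ℓ ∘ₗ LinearMap.mulRight F u ∘ₗ σ.toLinearMap)
    have ht' : ∀ d, A v (d • t • w) = A v (d • w) - A v ((σ d * u) • w) := by
      intro d
      rw [smul_smul, mul_comm, ← hℓ, ← hΦ, ht]
      rfl
    refine ⟨v, t • w, ?_, fun d => ?_⟩
    · rw [ht', hs1, neg_smul, map_neg, sub_neg_eq_add, ← two_mul]
      exact mul_ne_zero h2 hv
    · rw [ht', ht', map_mul, h.invol, mul_assoc, hu, mul_one]
      ring
  have hwv : ∀ d : B, A w (d • v) = -A v (d • w) := by
    intro d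
    rw [← hN, mul_smul, ← h.smul_left, ← h.swap]
  have hself : ∀ (r : B) (x : V), A x ((r * s) • x) = 0 := by
    intro r x
    rw [mul_smul, h.smul_right, hcyc]
  have key : ∀ b b' : B, (b ≠ 0 ∨ b' ≠ 0) →
      ∃ c : B, A (c • v) (b • v + b' • w) ≠ 0 ∨ A (c • w) (b • v + b' • w) ≠ 0 := by
    intro b b' hbb
    rcases htot b b' with ⟨r, hr⟩ | ⟨r, hr⟩
    · obtain ⟨d, hd⟩ := hs b (by
        rintro rfl
        rw [zero_mul] at hr
        exact hbb.elim (fun h => h rfl) fun h => h hr)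
      refine ⟨σ d, Or.inr ?_⟩
      rw [h.smul_left, h.invol, smul_add, smul_smul, smul_smul, map_add]
      have h3 : d * b' = r * s := by rw [hr, hd]; ring
      rw [h3, hself, add_zero, mul_comm, ← hd, hwv]
      exact neg_ne_zero.2 hs'
    · obtain ⟨d, hd⟩ := hs b' (by
        rintro rfl
        rw [zero_mul] at hr
        exact hbb.elim (fun h => h hr) fun h => h rfl)
      refine ⟨σ d, Or.inl ?_⟩
      rw [h.smul_left, h.invol, smul_add, smul_smul, smul_smul, map_add]
      have h3 : d * b = r * s := by rw [hr, hd]; ring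
      rwa [h3, hself, zero_add, mul_comm, ← hd]
  let f : B × B →ₗ[B] V :=
    (LinearMap.toSpanSingleton B V v).coprod (LinearMap.toSpanSingleton B V w)
  have hf : ∀ b b', f (b, b') = b • v + b' • w := fun b b' => rfl
  have hrange : LinearMap.range f = ⊤ := by
    refine (hind _ ?_).resolve_left ?_
    · rintro _ ⟨⟨b, b'⟩, rfl⟩ h0
      rw [hf] at h0
      obtain ⟨c, hc⟩ := key b b' (by
        by_contra! hc
        rw [hc.1, hc.2] at h0
        simp at h0)
      rcases hc with hc | hc
      · exact ⟨_, ⟨(c, 0), rfl⟩, by simpa [hf] using hc⟩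
      · exact ⟨_, ⟨(0, c), rfl⟩, by simpa [hf] using hc⟩
    · intro h0
      have h3 : f (1, 0) ∈ LinearMap.range f := ⟨_, rfl⟩
      rw [h0, Submodule.mem_bot, hf, one_smul, zero_smul, add_zero] at h3
      rw [h3] at hs'
      simp at hs'
  have hsurj : ∀ x : V, ∃ b b' : B, b • v + b' • w = x := by
    intro x
    obtain ⟨⟨b, b'⟩, hb⟩ := LinearMap.range_eq_top.1 hrange x
    exact ⟨b, b', hb⟩
  let e : (B × B) ≃ₗ[F] V := LinearEquiv.ofBijective (f.restrictScalars F)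
    ⟨(injective_iff_map_eq_zero _).2 fun ⟨b, b'⟩ hb => by
      by_contra hne
      obtain ⟨c, hc⟩ := key b b' (by
        by_contra! hc
        exact hne (by rw [hc.1, hc.2]; rfl))
      have hb' : b • v + b' • w = 0 := hb
      rw [hb'] at hc
      simp at hc, fun x => LinearMap.range_eq_top.1 hrange x⟩
  have he : ∀ b b', e (b, b') = b • v + b' • w := fun b b' => rfl
  let y : V →ₗ[F] V :=
    e.toLinearMap ∘ₗ (σ.toLinearMap.prodMap (-σ.toLinearMap)) ∘ₗ e.symm.toLinearMap
  have hy : ∀ b b', y (b • v + b' • w) = σ b • v + (-σ b') • w := by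
    intro b b'
    rw [← he]
    simp only [y, LinearMap.comp_apply, LinearEquiv.coe_coe, LinearEquiv.symm_apply_apply]
    exact he _ _
  refine ⟨y, fun x => ?_, fun d x => ?_, fun x x' => ?_⟩
  · obtain ⟨b, b', rfl⟩ := hsurj x
    rw [hy, hy, map_neg, neg_neg, h.invol, h.invol]
  · obtain ⟨b, b', rfl⟩ := hsurj x
    rw [smul_add, smul_smul, smul_smul, hy, hy, map_mul, map_mul, smul_add, smul_smul, smul_smul,
      mul_neg]
  · obtain ⟨b, b', rfl⟩ := hsurj x
    obtain ⟨c, c', rfl⟩ := hsurj x'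
    rw [hy, hy]
    simp only [map_add, LinearMap.add_apply, neg_smul, map_neg, LinearMap.neg_apply, h.smul_left,
      h.invol, smul_smul, hwv]
    rw [mul_comm b, mul_comm b, mul_comm b', mul_comm b']
    ring

end AdaptedForms

section AdaptedFormsInduction

variable {F B V : Type*} [Field F] [CommRing B] [Algebra F B] [AddCommGroup V] [Module F V]
  [Module B V] [IsScalarTower F B V] {σ : B →ₐ[F] B} {u : B} {A : V →ₗ[F] V →ₗ[F] F}

theorem IsAdapted.hasAntiInvolution_of_faithful [Finite B] (h : IsAdapted σ u A)
    (hB : IsMonogenicOverReduced B) (h2 : (2 : F) ≠ 0)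
    (hfaith : ∀ b : B, (∀ v : V, b • v = 0) → b = 0)
    (hind : ∀ W : Submodule B V, IsNondegenerateOn A W → W = ⊥ ∨ W = ⊤) :
    HasAntiInvolution σ A := by
  have : Module.Finite F B := Module.Finite.of_finite
  by_cases h1 : ∃ e : B, IsIdempotentElem e ∧ e ≠ 0 ∧ σ e = 1 - e
  · obtain ⟨e, he, he0, hσe⟩ := h1
    exact h.hasAntiInvolution_of_hyperbolic hB hfaith hind he he0 hσe
  · rcases subsingleton_or_nontrivial B with hB1 | hB1
    · have : Subsingleton V := Module.subsingleton B V
      exact ⟨0, fun _ => Subsingleton.elim _ _, fun _ _ => Subsingleton.elim _ _, fun v w => by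
        rw [Subsingleton.elim w 0, Subsingleton.elim v 0]; simp⟩
    · refine h.hasAntiInvolution_of_local hB h2 hfaith hind fun e he => ?_
      rcases h.idempotent_cases hfaith hind he with h3 | h3 | h3
      · exact Or.inl h3
      · exact Or.inr h3
      · by_contra! hc
        exact h1 ⟨e, he, hc.1, h3⟩

theorem IsAdapted.hasAntiInvolution_of_indecomposable [Finite B] (h : IsAdapted σ u A)
    (hB : IsMonogenicOverReduced B) (h2 : (2 : F) ≠ 0)
    (hind : ∀ W : Submodule B V, IsNondegenerateOn A W → W = ⊥ ∨ W = ⊤) :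
    HasAntiInvolution σ A := by
  let I := Module.annihilator B V
  let := Module.quotientAnnihilator (R := B) (M := V)
  have hmk : ∀ (b : B) (v : V), Ideal.Quotient.mk I b • v = b • v := fun b v => rfl
  have : IsScalarTower F (B ⧸ I) V := by
    refine ⟨fun c b v => ?_⟩
    obtain ⟨b, rfl⟩ := Ideal.Quotient.mk_surjective b
    have h1 : c • Ideal.Quotient.mk I b = Ideal.Quotient.mk I (c • b) := rfl
    rw [h1, hmk, hmk, smul_assoc]
  have : Finite (B ⧸ I) := Finite.of_surjective _ Ideal.Quotient.mk_surjective
  have hI : I ≤ I.comap σ := by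
    intro b hb
    rw [Ideal.mem_comap, Module.mem_annihilator]
    intro v
    by_contra hv
    obtain ⟨w, hw⟩ := h.nondeg _ hv
    rw [← h.smul_left, Module.mem_annihilator.1 hb, map_zero] at hw
    exact hw rfl
  let σ' : B ⧸ I →ₐ[F] B ⧸ I := Ideal.quotientMapₐ I σ hI
  have hσ' : ∀ b, σ' (Ideal.Quotient.mk I b) = Ideal.Quotient.mk I (σ b) := fun b => rfl
  have h' : IsAdapted σ' (Ideal.Quotient.mk I u) A := by
    refine ⟨fun b => ?_, fun b v w => ?_, h.swap, h.nondeg⟩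
    · obtain ⟨b, rfl⟩ := Ideal.Quotient.mk_surjective b
      rw [hσ', hσ', h.invol]
    · obtain ⟨b, rfl⟩ := Ideal.Quotient.mk_surjective b
      rw [hσ', hmk, hmk, h.smul_left]
  obtain ⟨y, hy1, hy2, hy3⟩ := h'.hasAntiInvolution_of_faithful
    (hB.of_surjective _ Ideal.Quotient.mk_surjective) h2 (by
      intro b hb
      obtain ⟨b, rfl⟩ := Ideal.Quotient.mk_surjective b
      rw [Ideal.Quotient.eq_zero_iff_mem, Module.mem_annihilator]
      exact hb) (by
      intro W hW
      let W' : Submodule B V := 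
        { W.toAddSubmonoid with smul_mem' := fun b v hv => W.smul_mem (Ideal.Quotient.mk I b) hv }
      have h1 : ∀ v, v ∈ W' ↔ v ∈ W := fun v => Iff.rfl
      refine (hind W' hW).imp (fun h3 => ?_) fun h3 => ?_
      · ext v
        rw [← h1, h3, Submodule.mem_bot, Submodule.mem_bot]
      · ext v
        rw [← h1, h3]
        simp only [Submodule.mem_top])
  exact ⟨y, hy1, fun b v => hy2 (Ideal.Quotient.mk I b) v, hy3⟩

/-- The restriction of a bilinear form to a submodule. -/
def formRestrict (A : V →ₗ[F] V →ₗ[F] F) (W : Submodule B V) : W →ₗ[F] W →ₗ[F] F :=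
  A.compl₁₂ (W.subtype.restrictScalars F) (W.subtype.restrictScalars F)

theorem IsAdapted.restrict (h : IsAdapted σ u A) {W : Submodule B V}
    (hW : IsNondegenerateOn A W) : IsAdapted σ u (formRestrict A W) :=
  ⟨h.invol, fun b v w => h.smul_left b v w, fun v w => h.swap v w, fun v hv => by
    obtain ⟨w, hw, hne⟩ := hW v v.2 (by simpa using hv)
    exact ⟨⟨w, hw⟩, hne⟩⟩

theorem IsAdapted.exists_isCompl [FiniteDimensional F V] (h : IsAdapted σ u A)
    {W : Submodule B V} (hW : IsNondegenerateOn A W) :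
    ∃ W' : Submodule B V, IsCompl W W' ∧ IsNondegenerateOn A W' ∧
      (∀ w ∈ W, ∀ w' ∈ W', A w w' = 0) ∧ ∀ w ∈ W, ∀ w' ∈ W', A w' w = 0 := by
  let W' : Submodule B V :=
    { carrier := {v | ∀ w ∈ W, A w v = 0}
      add_mem' := fun {a b} ha hb w hw => by rw [map_add, ha w hw, hb w hw, add_zero]
      zero_mem' := fun w _ => map_zero _
      smul_mem' := fun b v hv w hw => by
        rw [h.smul_right]
        exact hv _ (W.smul_mem _ hw) }
  have hmem : ∀ v, v ∈ W' ↔ ∀ w ∈ W, A w v = 0 := fun v => Iff.rfl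
  have h1 : ∀ w ∈ W, ∀ w' ∈ W', A w w' = 0 := fun w hw w' hw' => hw' w hw
  have h2 : ∀ w ∈ W, ∀ w' ∈ W', A w' w = 0 := fun w hw w' hw' => by
    rw [h.swap]
    exact h1 w hw _ (W'.smul_mem _ hw')
  have hdis : Disjoint W W' := by
    rw [Submodule.disjoint_def]
    intro v hv hv'
    by_contra hne
    obtain ⟨w, hw, hne'⟩ := hW v hv hne
    exact hne' (h1 w hw v hv')
  have hex : ∀ v, ∃ w ∈ W, v - w ∈ W' := by
    intro v
    let W₀ := W.restrictScalars F
    let Φ : W₀ →ₗ[F] Module.Dual F W₀ := (A.domRestrict₁₂ W₀ W₀).flip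
    have hΦ : Function.Injective Φ := by
      refine (injective_iff_map_eq_zero Φ).2 fun w hw => ?_
      by_contra hne
      obtain ⟨w', hw', hne'⟩ := hW w w.2 (by simpa using hne)
      exact hne' (LinearMap.congr_fun hw ⟨w', hw'⟩)
    obtain ⟨w, hw⟩ := (LinearMap.injective_iff_surjective_of_finrank_eq_finrank
      (Subspace.dual_finrank_eq (K := F) (V := W₀)).symm).1 hΦ (A.flip v ∘ₗ W₀.subtype)
    refine ⟨w, w.2, (hmem _).2 fun w' hw' => ?_⟩
    rw [map_sub, sub_eq_zero]
    exact (LinearMap.congr_fun hw ⟨w', hw'⟩).symm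
  refine ⟨W', ⟨hdis, ?_⟩, ?_, h1, h2⟩
  · rw [codisjoint_iff, eq_top_iff]
    intro v _
    obtain ⟨w, hw, hw'⟩ := hex v
    exact Submodule.mem_sup.2 ⟨w, hw, _, hw', by abel⟩
  · intro t ht ht0
    obtain ⟨v, hv⟩ := h.nondeg t ht0
    obtain ⟨w, hw, hw'⟩ := hex v
    refine ⟨v - w, hw', ?_⟩
    rwa [map_sub, LinearMap.sub_apply, h1 w hw t ht, sub_zero]

theorem HasAntiInvolution.of_isCompl {W W' : Submodule B V} (hc : IsCompl W W')
    (h1 : ∀ w ∈ W, ∀ w' ∈ W', A w w' = 0) (h2 : ∀ w ∈ W, ∀ w' ∈ W', A w' w = 0)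
    (h : HasAntiInvolution σ (formRestrict A W)) (h' : HasAntiInvolution σ (formRestrict A W')) :
    HasAntiInvolution σ A := by
  obtain ⟨y, hy1, hy2, hy3⟩ := h
  obtain ⟨y', hy1', hy2', hy3'⟩ := h'
  let z : V →ₗ[F] V := (W.subtype.restrictScalars F) ∘ₗ y ∘ₗ
      (Submodule.projectionOnto W W' hc).restrictScalars F +
    (W'.subtype.restrictScalars F) ∘ₗ y' ∘ₗ
      (Submodule.projectionOnto W' W hc.symm).restrictScalars F
  have hz : ∀ (w : W) (w' : W'), z (w + w') = y w + y' w' := by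
    intro w w'
    simp [z]
  have hsurj : ∀ v : V, ∃ (w : W) (w' : W'), (w + w' : V) = v := by
    intro v
    obtain ⟨w, hw, w', hw', hv⟩ := Submodule.mem_sup.1
      (hc.sup_eq_top ▸ Submodule.mem_top : v ∈ W ⊔ W')
    exact ⟨⟨w, hw⟩, ⟨w', hw'⟩, hv⟩
  refine ⟨z, fun v => ?_, fun b v => ?_, fun v v' => ?_⟩
  · obtain ⟨w, w', rfl⟩ := hsurj v
    rw [hz, hz, hy1, hy1']
  · obtain ⟨w, w', rfl⟩ := hsurj v
    rw [smul_add, ← Submodule.coe_smul, ← Submodule.coe_smul, hz, hz, hy2, hy2', smul_add]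
    rfl
  · obtain ⟨w, w', rfl⟩ := hsurj v
    obtain ⟨t, t', rfl⟩ := hsurj v'
    have e1 : A (y w) (y t) = A t w := hy3 w t
    have e2 : A (y' w') (y' t') = A t' w' := hy3' w' t'
    rw [hz, hz]
    simp only [map_add, LinearMap.add_apply, e1, e2]
    rw [h1 _ (y w).2 _ (y' t').2, h2 _ (y t).2 _ (y' w').2, h1 _ t.2 _ w'.2, h2 _ w.2 _ t'.2]

end AdaptedFormsInduction

section AdaptedFormsMain

variable {F B : Type*} [Field F] [CommRing B] [Algebra F B] [Finite B] {σ : B →ₐ[F] B} {u : B}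

theorem IsAdapted.hasAntiInvolution_of_finrank_le (hB : IsMonogenicOverReduced B)
    (h2 : (2 : F) ≠ 0) (n : ℕ) : ∀ {V : Type*} [AddCommGroup V] [Module F V] [Module B V]
    [IsScalarTower F B V] [FiniteDimensional F V] {A : V →ₗ[F] V →ₗ[F] F},
    Module.finrank F V ≤ n → IsAdapted σ u A → HasAntiInvolution σ A := by
  induction n with
  | zero =>
    intro V _ _ _ _ _ A hn h
    have := Module.finrank_zero_iff.1 (Nat.le_zero.1 hn)
    exact ⟨0, fun _ => Subsingleton.elim _ _, fun _ _ => Subsingleton.elim _ _, fun v w => by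
      rw [Subsingleton.elim w 0, Subsingleton.elim v 0]; simp⟩
  | succ n ih =>
    intro V _ _ _ _ _ A hn h
    by_cases hind : ∀ W : Submodule B V, IsNondegenerateOn A W → W = ⊥ ∨ W = ⊤
    · exact h.hasAntiInvolution_of_indecomposable hB h2 hind
    · push Not at hind
      obtain ⟨W, hW, hbot, htop⟩ := hind
      obtain ⟨W', hc, hW', h3, h4⟩ := h.exists_isCompl hW
      have key : ∀ W : Submodule B V, W ≠ ⊤ → Module.finrank F W ≤ n := by
        intro W hW
        have h5 : W.restrictScalars F ≠ ⊤ := by simpa using hW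
        have h6 : Module.finrank F W < Module.finrank F V := Submodule.finrank_lt h5
        omega
      refine HasAntiInvolution.of_isCompl hc h3 h4 ?_ ?_
      · have : FiniteDimensional F W := 
          inferInstanceAs (FiniteDimensional F (W.restrictScalars F))
        exact ih (key W htop) (h.restrict hW)
      · have : FiniteDimensional F W' := 
          inferInstanceAs (FiniteDimensional F (W'.restrictScalars F))
        refine ih (key W' ?_) (h.restrict hW')
        rintro rfl
        exact hbot (eq_bot_of_isCompl_top hc)

theorem IsAdapted.hasAntiInvolution {V : Type*} [AddCommGroup V] [Module F V] [Module B V]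
    [IsScalarTower F B V] [FiniteDimensional F V] {A : V →ₗ[F] V →ₗ[F] F} (h : IsAdapted σ u A)
    (hB : IsMonogenicOverReduced B) (h2 : (2 : F) ≠ 0) : HasAntiInvolution σ A :=
  IsAdapted.hasAntiInvolution_of_finrank_le hB h2 _ le_rfl h

end AdaptedFormsMain

section GroupAlgebra

theorem isMonogenicOverReduced_monoidAlgebra {F C : Type*} [Field F] [Finite F] [CommGroup C]
    [Finite C] (h2 : (2 : F) ≠ 0) (S : Set C) (x : C) (hS : ∀ s ∈ S, ∃ k : ℕ, s ^ 2 ^ k = 1)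
    (hgen : Subgroup.closure (S ∪ {x}) = ⊤) : IsMonogenicOverReduced (MonoidAlgebra F C) := by
  have := Fintype.ofFinite F
  have hpow : ∀ s ∈ S, s ^ 2 ^ Nat.card C = 1 := by
    intro s hs
    obtain ⟨k, hk⟩ := hS s hs
    obtain ⟨j, -, hj⟩ := (Nat.dvd_prime_pow Nat.prime_two).1 (orderOf_dvd_of_pow_eq_one hk)
    rw [← orderOf_dvd_iff_pow_eq_one, hj]
    refine pow_dvd_pow _ (j.lt_two_pow_self.le.trans ?_)
    rw [← hj]
    exact orderOf_le_card
  let r := (2 ^ Nat.card C).totient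
  have hr : r ≠ 0 := (Nat.totient_pos.2 (by positivity)).ne'
  have hodd : Fintype.card F % 2 = 1 := FiniteField.odd_card_of_char_ne_two fun h => by
    have := ringChar.spec F 2
    rw [h] at this
    exact h2 (by exact_mod_cast this.2 dvd_rfl)
  have hmod : Fintype.card F ^ r ≡ 1 [MOD 2 ^ Nat.card C] :=
    Nat.ModEq.pow_totient ((Nat.coprime_two_right.2 (Nat.odd_iff.2 hodd)).pow_right _)
  have hSr : ∀ s ∈ S, s ^ Fintype.card F ^ r = s := by
    intro s hs
    have h1 : Fintype.card F ^ r ≡ 1 [MOD orderOf s] :=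
      hmod.of_dvd (orderOf_dvd_of_pow_eq_one (hpow s hs))
    simpa using pow_eq_pow_iff_modEq.2 h1
  let φ : MonoidAlgebra F C →ₐ[F] MonoidAlgebra F C :=
    FiniteField.frobeniusAlgHom F (MonoidAlgebra F C) ^ r
  have hφ : ∀ b, φ b = b ^ Fintype.card F ^ r := by
    suffices ∀ (k : ℕ) (b : MonoidAlgebra F C),
        (FiniteField.frobeniusAlgHom F (MonoidAlgebra F C) ^ k) b = b ^ Fintype.card F ^ k from
      this r
    intro k
    induction k with
    | zero => simp
    | succ k ih =>
      intro b
      rw [pow_succ, AlgHom.mul_apply, ih, FiniteField.frobeniusAlgHom_apply, ← pow_mul,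
        ← pow_succ']
  let K := RingHom.eqLocus (φ : MonoidAlgebra F C →+* MonoidAlgebra F C) (RingHom.id _)
  have hK : ∀ b, b ∈ K ↔ b ^ Fintype.card F ^ r = b := by
    intro b
    rw [← hφ]
    rfl
  refine ⟨K, MonoidAlgebra.of F C x, Fintype.card F ^ r, ?_, fun b hb => (hK b).1 hb, ?_⟩
  · exact Fintype.one_lt_card.trans_le (Nat.le_self_pow hr _)
  set R := Subring.closure ((K : Set (MonoidAlgebra F C)) ∪ {MonoidAlgebra.of F C x})
  have hKR : ∀ b ∈ K, b ∈ R := fun b hb => Subring.subset_closure (Or.inl hb)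
  have hC : ∀ c : C, MonoidAlgebra.of F C c ∈ R := by
    intro c
    have hc : c ∈ Subgroup.closure (S ∪ {x}) := hgen ▸ Subgroup.mem_top c
    induction hc using Subgroup.closure_induction with
    | mem c hc =>
      rcases hc with hc | hc
      · refine hKR _ ((hK _).2 ?_)
        rw [← map_pow, hSr c hc]
      · exact Subring.subset_closure (Or.inr (by rw [Set.mem_singleton_iff.1 hc]; rfl))
    | one => rw [map_one]; exact R.one_mem
    | mul a b _ _ ha hb => rw [map_mul]; exact R.mul_mem ha hb
    | inv a _ ha =>
      have h3 : a⁻¹ = a ^ (orderOf a - 1) := by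
        rw [inv_eq_iff_mul_eq_one, ← pow_succ', Nat.sub_add_cancel (orderOf_pos a),
          pow_orderOf_eq_one]
      rw [h3, map_pow]
      exact R.pow_mem ha _
  rw [eq_top_iff]
  intro b _
  induction b using MonoidAlgebra.induction_on with
  | of c => exact hC c
  | add a b ha hb => exact R.add_mem (ha trivial) (hb trivial)
  | smul c b hb =>
    rw [Algebra.smul_def]
    refine R.mul_mem (hKR _ ((hK _).2 ?_)) (hb trivial)
    rw [← map_pow, FiniteField.pow_card_pow]

theorem exists_antiInvolution {F C V : Type*} [Field F] [Finite F] [CommGroup C] [Finite C]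
    [AddCommGroup V] [Module F V] [FiniteDimensional F V] (h2 : (2 : F) ≠ 0) (S : Set C) (x : C)
    (hS : ∀ s ∈ S, ∃ k : ℕ, s ^ 2 ^ k = 1) (hgen : Subgroup.closure (S ∪ {x}) = ⊤)
    (φ : C →* Module.End F V) (u : C) {A : V →ₗ[F] V →ₗ[F] F}
    (hA : ∀ g v w, A (φ g v) (φ g w) = A v w) (hu : ∀ v w, A v w = A w (φ u v))
    (hnd : ∀ v, v ≠ 0 → ∃ w, A w v ≠ 0) :
    ∃ y : V →ₗ[F] V, (∀ v, y (y v) = v) ∧ (∀ g v, y (φ g v) = φ g⁻¹ (y v)) ∧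
      ∀ v w, A (y v) (y w) = A w v := by
  let φ' := MonoidAlgebra.lift F (Module.End F V) C φ
  let : Module (MonoidAlgebra F C) V := Module.compHom V φ'.toRingHom
  have hsm : ∀ (b : MonoidAlgebra F C) (v : V), b • v = φ' b v := fun b v => rfl
  have hof : ∀ (g : C) (v : V), MonoidAlgebra.of F C g • v = φ g v := by
    intro g v
    rw [hsm, MonoidAlgebra.lift_of]
  have : IsScalarTower F (MonoidAlgebra F C) V := ⟨fun c b v => by
    rw [hsm, hsm, map_smul, LinearMap.smul_apply]⟩
  let σ : MonoidAlgebra F C →ₐ[F] MonoidAlgebra F C :=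
    MonoidAlgebra.lift F _ C ((MonoidAlgebra.of F C).comp invMonoidHom)
  have hσ : ∀ g, σ (MonoidAlgebra.of F C g) = MonoidAlgebra.of F C g⁻¹ := by
    intro g
    rw [MonoidAlgebra.lift_of]
    rfl
  have hadj : IsAdapted σ (MonoidAlgebra.of F C u) A := by
    refine ⟨fun b => ?_, fun b v w => ?_, fun v w => by rw [hof, hu], hnd⟩
    · induction b using MonoidAlgebra.induction_on with
      | of c => rw [hσ, hσ, inv_inv]
      | add a b ha hb => rw [map_add, map_add, ha, hb]
      | smul c b hb => rw [map_smul, map_smul, hb]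
    · induction b using MonoidAlgebra.induction_on with
      | of c =>
        rw [hσ, hof, hof, ← hA c v, ← Module.End.mul_apply, ← map_mul, mul_inv_cancel, map_one,
          Module.End.one_apply]
      | add a b ha hb => rw [map_add, add_smul, add_smul, map_add, map_add,
        LinearMap.add_apply, ha, hb]
      | smul c b hb =>
        rw [smul_assoc, map_smul A, LinearMap.smul_apply, hb, map_smul σ, smul_assoc,
          map_smul (A v) c]
  have : Finite (MonoidAlgebra F C) := Module.finite_of_finite F
  obtain ⟨y, h3, h4, h5⟩ := hadj.hasAntiInvolution
    (isMonogenicOverReduced_monoidAlgebra h2 S x hS hgen) h2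
  refine ⟨y, h3, fun g v => ?_, h5⟩
  rw [← hof, ← hof, h4, hσ]

end GroupAlgebra

section MatrixAntiInvolution

variable {N F : Type*} [Fintype N] [DecidableEq N] [Field F] [Finite F]

theorem exists_matrix_antiInvolution (h2 : (2 : F) ≠ 0) (S : Set (GL N F)) (x u : GL N F)
    (hS : ∀ s ∈ S, ∃ k : ℕ, s ^ 2 ^ k = 1) (hcomm : ∀ s ∈ S, ∀ t ∈ S, s * t = t * s)
    (hx : ∀ s ∈ S, s * x = x * s) (huS : u ∈ Subgroup.closure (S ∪ {x})) (X : GL N F)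
    (hX : ∀ s ∈ S ∪ {x}, s ∈ fixGroup (X : Matrix N N F))
    (hu : (X : Matrix N N F) = ((X : Matrix N N F) * (u : Matrix N N F))ᵀ) :
    ∃ y : GL N F, y * y = 1 ∧ (∀ s ∈ S ∪ {x}, y * s * y⁻¹ = s⁻¹) ∧
      (y : Matrix N N F)ᵀ * X * y = (X : Matrix N N F)ᵀ := by
  have hc : IsMulCommutative (Subgroup.closure (S ∪ {x})) :=
    Subgroup.isMulCommutative_closure (by
      rintro s (hs | rfl) t (ht | rfl)
      · exact hcomm s hs t ht
      · exact hx s hs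
      · exact (hx t ht).symm
      · rfl)
  let : CommGroup (Subgroup.closure (S ∪ {x})) :=
    { (Subgroup.closure (S ∪ {x})).toGroup with mul_comm := hc.is_comm.comm }
  let φ : Subgroup.closure (S ∪ {x}) →* Module.End F (N → F) :=
    (Matrix.toLinAlgEquiv' : Matrix N N F ≃ₐ[F] _).toMonoidHom.comp
      ((Units.coeHom _).comp (Subgroup.closure (S ∪ {x})).subtype)
  have hφ : ∀ g v, φ g v = ((g : GL N F) : Matrix N N F) *ᵥ v := fun g v => rfl
  let A : (N → F) →ₗ[F] (N → F) →ₗ[F] F := Matrix.toLinearMap₂' F (X : Matrix N N F)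
  have hAdef : ∀ v w, A v w = v ⬝ᵥ (X : Matrix N N F) *ᵥ w := Matrix.toLinearMap₂'_apply' _
  have hX' : ∀ g ∈ Subgroup.closure (S ∪ {x}), (g : Matrix N N F)ᵀ * X * g = X :=
    fun g hg => (Subgroup.closure_le (fixGroup (X : Matrix N N F))).2 hX hg
  obtain ⟨y, hy1, hy2, hy3⟩ := exists_antiInvolution h2
    ((fun g : Subgroup.closure (S ∪ {x}) => (g : GL N F)) ⁻¹' S)
    ⟨x, Subgroup.subset_closure (Or.inr rfl)⟩ (by
      rintro s hs
      obtain ⟨k, hk⟩ := hS _ hs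
      exact ⟨k, Subtype.ext hk⟩) (by
      rw [← Subgroup.closure_closure_coe_preimage (k := S ∪ {x})]
      congr 1
      ext s
      simp [Subtype.ext_iff]) φ ⟨u, huS⟩ (A := A) (by
      intro g v w
      rw [hAdef, hAdef, hφ, hφ, ← Matrix.vecMul_transpose, ← Matrix.dotProduct_mulVec,
        Matrix.mulVec_mulVec, Matrix.mulVec_mulVec, hX' _ g.2]) (by
      intro v w
      rw [hAdef, hAdef, hφ, Matrix.mulVec_mulVec, dotProduct_comm, ← Matrix.vecMul_transpose,
        ← Matrix.dotProduct_mulVec]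
      congr 2
      rw [← Matrix.transpose_transpose ((X : Matrix N N F) * _), ← hu]) (by
      intro v hv
      by_contra! hc
      apply hv
      have h3 : (X : Matrix N N F) *ᵥ v = 0 := by
        refine dotProduct_eq _ _ fun w => ?_
        rw [dotProduct_comm, ← hAdef, hc, zero_dotProduct]
      have h4 := congrArg (fun w => ((X⁻¹ : GL N F) : Matrix N N F) *ᵥ w) h3
      simpa only [Matrix.mulVec_mulVec, X.inv_mul, Matrix.one_mulVec, Matrix.mulVec_zero] using h4)
  let Y := LinearMap.toMatrix' y
  have hY : ∀ v, Y *ᵥ v = y v := fun v => LinearMap.toMatrix'_mulVec y v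
  have hYY : Y * Y = 1 := by
    refine Matrix.toLin'.injective (LinearMap.ext fun v => ?_)
    rw [Matrix.toLin'_apply, Matrix.toLin'_apply, ← Matrix.mulVec_mulVec, hY, hY, hy1,
      Matrix.one_mulVec]
  refine ⟨⟨Y, Y, hYY, hYY⟩, Units.ext hYY, fun s hs => ?_, ?_⟩
  · rw [mul_inv_eq_iff_eq_mul]
    refine Units.ext (Matrix.toLin'.injective (LinearMap.ext fun v => ?_))
    have h3 := hy2 ⟨s, Subgroup.subset_closure hs⟩ v
    rw [hφ, hφ, ← hY, ← hY] at h3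
    rw [Matrix.toLin'_apply, Matrix.toLin'_apply, Units.val_mul, Units.val_mul,
      ← Matrix.mulVec_mulVec, ← Matrix.mulVec_mulVec]
    exact h3
  · refine (Matrix.toLinearMap₂' (S₁ := F) (S₂ := F) F).injective (LinearMap.ext₂ fun v w => ?_)
    have h3 := hy3 v w
    rw [hAdef, hAdef, ← hY, ← hY, ← Matrix.vecMul_transpose, ← Matrix.dotProduct_mulVec,
      Matrix.mulVec_mulVec, Matrix.mulVec_mulVec] at h3
    rw [Matrix.toLinearMap₂'_apply', Matrix.toLinearMap₂'_apply', Matrix.mulVec_transpose,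
      dotProduct_comm v (w ᵥ* _), ← Matrix.dotProduct_mulVec]
    exact h3

end MatrixAntiInvolution

section InvertingSubgroups

variable {G : Type} [Group G]

/-- Conjugation by `p.1` followed by inversion if the sign `p.2` is `-1`. -/
def signedConj (p : G × ℤˣ) (x : G) : G := (p.1 * x * p.1⁻¹) ^ (p.2 : ℤ)

theorem signedConj_one (x : G) : signedConj 1 x = x := by simp [signedConj]

theorem signedConj_mul (p q : G × ℤˣ) (x : G) :
    signedConj (p * q) x = signedConj p (signedConj q x) := by
  have e : p.1 * q.1 * x * (p.1 * q.1)⁻¹ = p.1 * (q.1 * x * q.1⁻¹) * p.1⁻¹ := by group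
  simp only [signedConj, Prod.fst_mul, Prod.snd_mul, Units.val_mul]
  rw [e, ← conj_zpow, ← _root_.zpow_mul, mul_comm (p.2 : ℤ)]

theorem signedConj_mul_right (p : G × ℤˣ) {x y : G} (h : Commute x y) :
    signedConj p (x * y) = signedConj p x * signedConj p y := by
  have e : p.1 * (x * y) * p.1⁻¹ = (p.1 * x * p.1⁻¹) * (p.1 * y * p.1⁻¹) := by group
  have h' : Commute (p.1 * x * p.1⁻¹) (p.1 * y * p.1⁻¹) := by
    rw [commute_iff_eq, ← e, h.eq]
    group
  rw [signedConj, e, h'.mul_zpow, signedConj, signedConj]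

theorem signedConj_eq_iff {p : G × ℤˣ} {x : G} :
    signedConj p x = x ↔ p.1 * x * p.1⁻¹ = x ^ (p.2 : ℤ) := by
  rcases Int.units_eq_one_or p.2 with h | h
  · simp [signedConj, h]
  · simp only [signedConj, h, Units.val_neg, Units.val_one, _root_.zpow_neg_one]
    exact inv_eq_iff_eq_inv

theorem signedConj_one_right {g x : G} : signedConj (g, 1) x = g * x * g⁻¹ := by
  simp [signedConj]

theorem signedConj_neg_one {g x : G} : signedConj (g, -1) x = (g * x * g⁻¹)⁻¹ := by
  simp [signedConj]

theorem signedConj_one_eq_iff {g x : G} : signedConj (g, 1) x = x ↔ Commute g x := by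
  rw [signedConj_one_right, mul_inv_eq_iff_eq_mul, commute_iff_eq]

theorem signedConj_inv_eq {p : G × ℤˣ} {x y : G} (h : signedConj p x = y) :
    signedConj p⁻¹ y = x := by
  rw [← h, ← signedConj_mul, inv_mul_cancel, signedConj_one]

/-- The signed elements of `H` which fix each member of `Γ` under signed conjugation. -/
def invertingSubgroup (H : Subgroup G) (Γ : Set G) : Subgroup (G × ℤˣ) where
  carrier := {p | p.1 ∈ H ∧ ∀ γ ∈ Γ, signedConj p γ = γ}
  one_mem' := ⟨H.one_mem, fun γ _ => signedConj_one γ⟩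
  mul_mem' := by
    rintro p q ⟨hp, hp'⟩ ⟨hq, hq'⟩
    refine ⟨H.mul_mem hp hq, fun γ hγ => ?_⟩
    rw [signedConj_mul, hq' γ hγ, hp' γ hγ]
  inv_mem' := by
    rintro p ⟨hp, hp'⟩
    exact ⟨H.inv_mem hp, fun γ hγ => signedConj_inv_eq (hp' γ hγ)⟩

theorem mem_invertingSubgroup {H : Subgroup G} {Γ : Set G} {p : G × ℤˣ} :
    p ∈ invertingSubgroup H Γ ↔ p.1 ∈ H ∧ ∀ γ ∈ Γ, signedConj p γ = γ := Iff.rfl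

theorem invertingSubgroup_anti {H : Subgroup G} {Γ Δ : Set G} (h : Γ ⊆ Δ) :
    invertingSubgroup H Δ ≤ invertingSubgroup H Γ :=
  fun _ hp => ⟨hp.1, fun γ hγ => hp.2 γ (h hγ)⟩

/-- The signed elements of `E` whose signed conjugation preserves `{b, b * ε}`. -/
def pairStabilizer (E : Subgroup (G × ℤˣ)) (b ε : G) (hε : ε * ε = 1) (hb : Commute b ε)
    (hE : ∀ p ∈ E, Commute p.1 ε) : Subgroup (G × ℤˣ) :=
  have hε' : ∀ p ∈ E, signedConj p ε = ε := fun p hp => by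
    rw [signedConj_eq_iff, (hE p hp).eq, mul_inv_cancel_right]
    rcases Int.units_eq_one_or p.2 with h | h <;> simp [h]
    exact eq_inv_of_mul_eq_one_left hε
  have key : ∀ p ∈ E, signedConj p (b * ε) = signedConj p b * ε := fun p hp => by
    rw [signedConj_mul_right p hb, hε' p hp]
  { carrier := {p | p ∈ E ∧ (signedConj p b = b ∨ signedConj p b = b * ε)}
    one_mem' := ⟨E.one_mem, Or.inl (signedConj_one b)⟩
    mul_mem' := by
      rintro p q ⟨hp, hp'⟩ ⟨hq, hq'⟩
      refine ⟨E.mul_mem hp hq, ?_⟩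
      rw [signedConj_mul]
      rcases hq' with h | h <;> rw [h]
      · exact hp'
      · rw [key p hp]
        rcases hp' with h | h <;> rw [h]
        · exact Or.inr rfl
        · exact Or.inl (by rw [mul_assoc, hε, mul_one])
    inv_mem' := by
      rintro p ⟨hp, hp'⟩
      refine ⟨E.inv_mem hp, ?_⟩
      rcases hp' with h | h
      · exact Or.inl (signedConj_inv_eq h)
      · refine Or.inr (signedConj_inv_eq ?_)
        rw [key p hp, h, mul_assoc, hε, mul_one] }

end InvertingSubgroups

section CentralElementModulo

theorem IsPGroup.exists_central_modulo {P : Type*} [Group P] [Finite P] (hP : IsPGroup 2 P)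
    {D K : Subgroup P} [D.Normal] [K.Normal] (hne : ¬K ≤ D) :
    ∃ a ∈ K, a ∉ D ∧ a * a ∈ D ∧ ∀ t : P, t * a * t⁻¹ * a⁻¹ ∈ D := by
  let L : Subgroup (P ⧸ D) := K.map (QuotientGroup.mk' D)
  have hLn : L.Normal := Subgroup.Normal.map inferInstance _ (QuotientGroup.mk'_surjective D)
  have hQ : IsPGroup 2 (P ⧸ D) := hP.to_quotient D
  have hLP : IsPGroup 2 L := hQ.to_subgroup L
  let act : MulAction (P ⧸ D) L := MulAction.compHom L (MulAut.conjNormal (H := L))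
  have hact : ∀ (t : P ⧸ D) (l : L), ((t • l : L) : P ⧸ D) = t * l * t⁻¹ := fun t l =>
    MulAut.conjNormal_apply t l
  have hLnt : Nontrivial L := by
    obtain ⟨k, hk, hkD⟩ := Set.not_subset.1 hne
    refine ⟨⟨⟨_, Subgroup.mem_map_of_mem _ hk⟩, 1, fun h => hkD ?_⟩⟩
    have := congrArg Subtype.val h
    simpa using this
  have hcard : 2 ∣ Nat.card L := by
    obtain ⟨n, hn, h⟩ := hLP.nontrivial_iff_card.1 hLnt
    rw [h]
    exact dvd_pow_self 2 hn.ne'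
  obtain ⟨c, hc, hc1⟩ := hQ.exists_fixed_point_of_prime_dvd_card_of_fixed_point L hcard
    (a := 1) (fun t => Subtype.ext (by simp [hact]))
  have hcc : ∀ t : P ⧸ D, t * (c : P ⧸ D) * t⁻¹ = c := fun t => by
    rw [← hact, hc t]
  obtain ⟨n, hn⟩ := hLP c
  have hex : ∃ n, c ^ 2 ^ n = 1 := ⟨n, hn⟩
  obtain ⟨k, hk⟩ : ∃ k, Nat.find hex = k + 1 := by
    refine Nat.exists_eq_succ_of_ne_zero fun h => hc1 ?_
    have := Nat.find_spec hex
    rw [h, pow_zero, pow_one] at this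
    exact this.symm
  have h1 : c ^ 2 ^ k ≠ 1 := Nat.find_min hex (by omega)
  have h2 : c ^ 2 ^ k * c ^ 2 ^ k = 1 := by
    have := Nat.find_spec hex
    rwa [hk, pow_succ, mul_two, pow_add] at this
  obtain ⟨a, haK, ha⟩ := (c ^ 2 ^ k).2
  have ha' : (a : P ⧸ D) = (c : P ⧸ D) ^ 2 ^ k := by simpa using ha
  refine ⟨a, haK, fun h => h1 (Subtype.ext ?_), ?_, fun t => ?_⟩
  · simpa [ha'] using (QuotientGroup.eq_one_iff a).2 h
  · rw [← QuotientGroup.eq_one_iff, QuotientGroup.mk_mul, ha']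
    simpa using congrArg Subtype.val h2
  · rw [← QuotientGroup.eq_one_iff]
    simp only [QuotientGroup.mk_mul, QuotientGroup.mk_inv, ha']
    rw [← conj_pow, hcc, mul_inv_cancel]

end CentralElementModulo

section CornerUnits

variable {R : Type*} [Ring R]

/-- The unit acting as `u` on the image of a commuting idempotent and as the identity on its
kernel. -/
def cornerUnit (P : R) (hP : P * P = P) (u : Rˣ) (hu : Commute P (u : R)) : Rˣ where
  val := P * u + (1 - P)
  inv := P * ((u⁻¹ : Rˣ) : R) + (1 - P)
  val_inv := by
    have e : P * (u : R) * P = P * u := by rw [mul_assoc, ← hu.eq, ← mul_assoc, hP]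
    have h1 : P * (u : R) * (P * ((u⁻¹ : Rˣ) : R)) = P := by
      rw [← mul_assoc, e, mul_assoc, u.mul_inv, mul_one]
    have h2 : P * (u : R) * (1 - P) = 0 := by rw [mul_sub, e, mul_one, sub_self]
    have h3 : (1 - P) * (P * ((u⁻¹ : Rˣ) : R)) = 0 := by
      rw [← mul_assoc, sub_mul, hP, one_mul, sub_self, zero_mul]
    have h4 : (1 - P) * (1 - P) = 1 - P := (show IsIdempotentElem P from hP).one_sub.eq
    rw [add_mul, mul_add, mul_add, h1, h2, h3, h4]
    abel
  inv_val := by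
    have hu' : Commute P ((u⁻¹ : Rˣ) : R) := hu.units_inv_right
    have e : P * ((u⁻¹ : Rˣ) : R) * P = P * ((u⁻¹ : Rˣ) : R) := by
      rw [mul_assoc, ← hu'.eq, ← mul_assoc, hP]
    have h1 : P * ((u⁻¹ : Rˣ) : R) * (P * (u : R)) = P := by
      rw [← mul_assoc, e, mul_assoc, u.inv_mul, mul_one]
    have h2 : P * ((u⁻¹ : Rˣ) : R) * (1 - P) = 0 := by rw [mul_sub, e, mul_one, sub_self]
    have h3 : (1 - P) * (P * (u : R)) = 0 := by
      rw [← mul_assoc, sub_mul, hP, one_mul, sub_self, zero_mul]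
    have h4 : (1 - P) * (1 - P) = 1 - P := (show IsIdempotentElem P from hP).one_sub.eq
    rw [add_mul, mul_add, mul_add, h1, h2, h3, h4]
    abel

theorem val_cornerUnit {P : R} (hP : P * P = P) {u : Rˣ} (hu : Commute P (u : R)) :
    (cornerUnit P hP u hu : R) = P * u + (1 - P) := rfl

theorem cornerUnit_pow {P : R} (hP : P * P = P) {u : Rˣ} (hu : Commute P (u : R)) {n : ℕ}
    (hn : u ^ n = 1) : cornerUnit P hP u hu ^ n = 1 := by
  have key : ∀ k : ℕ, (cornerUnit P hP u hu : R) ^ k = P * (u : R) ^ k + (1 - P) := by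
    intro k
    induction k with
    | zero => simp
    | succ k ih =>
      have h0 : P * (u : R) ^ k * P = P * (u : R) ^ k := by
        rw [mul_assoc, ← (hu.pow_right k).eq, ← mul_assoc, hP]
      have h1 : P * (u : R) ^ k * (P * (u : R)) = P * (u : R) ^ (k + 1) := by
        rw [← mul_assoc, h0, pow_succ, mul_assoc]
      have h2 : P * (u : R) ^ k * (1 - P) = 0 := by rw [mul_sub, h0, mul_one, sub_self]
      have h3 : (1 - P) * (P * (u : R)) = 0 := by
        rw [← mul_assoc, sub_mul, hP, one_mul, sub_self, zero_mul]
      have h4 : (1 - P) * (1 - P) = 1 - P := (show IsIdempotentElem P from hP).one_sub.eq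
      rw [pow_succ, ih, val_cornerUnit, add_mul, mul_add, mul_add, h1, h2, h3, h4]
      abel
  refine Units.ext ?_
  rw [Units.val_pow_eq_pow_val, key, ← Units.val_pow_eq_pow_val, hn]
  simp

theorem signedConj_cornerUnit {R : Type} [Ring R] {P : R} (hP : P * P = P) {u : Rˣ}
    (hu : Commute P (u : R)) {p : Rˣ × ℤˣ} (hp : Commute P (p.1 : R)) :
    ((signedConj p (cornerUnit P hP u hu) : Rˣ) : R) = P * (signedConj p u : Rˣ) + (1 - P) := by
  have h1 : (p.1 : R) * (P * u) * ((p.1⁻¹ : Rˣ) : R) = P * (p.1 * u * ((p.1⁻¹ : Rˣ) : R)) := by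
    simp only [← mul_assoc, hp.eq]
  have h2 : (p.1 : R) * (1 - P) * ((p.1⁻¹ : Rˣ) : R) = 1 - P := by
    rw [mul_sub, ← hp.eq, mul_one, sub_mul, mul_assoc, p.1.mul_inv, mul_one]
  have h3 : (p.1 : R) * (P * ((u⁻¹ : Rˣ) : R)) * ((p.1⁻¹ : Rˣ) : R) =
      P * (p.1 * ((u⁻¹ : Rˣ) : R) * ((p.1⁻¹ : Rˣ) : R)) := by
    simp only [← mul_assoc, hp.eq]
  obtain ⟨g, s⟩ := p
  rcases Int.units_eq_one_or s with rfl | rfl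
  · rw [signedConj_one_right, signedConj_one_right]
    simp only [Units.val_mul, val_cornerUnit]
    rw [mul_add, add_mul, h1, h2]
  · rw [signedConj_neg_one, signedConj_neg_one]
    rw [conj_inv, conj_inv]
    simp only [Units.val_mul]
    change (g : R) * (P * ((u⁻¹ : Rˣ) : R) + (1 - P)) * ((g⁻¹ : Rˣ) : R) = _
    rw [mul_add, add_mul, h3, h2]

end CornerUnits

section CornerElements

variable {N F : Type} [Fintype N] [DecidableEq N] [Field F]

theorem cornerUnit_mem_fixGroup {J P : Matrix N N F} (hP : P * P = P) (hPJ : Pᵀ * J = J * P)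
    {a : GL N F} (ha : a ∈ fixGroup J) (hPa : Commute P (a : Matrix N N F)) :
    cornerUnit P hP a hPa ∈ fixGroup J := by
  change (P * (a : Matrix N N F) + (1 - P))ᵀ * J * (P * (a : Matrix N N F) + (1 - P)) = J
  have ha' : (a : Matrix N N F)ᵀ * J * (a : Matrix N N F) = J := ha
  have h1 : (P * (a : Matrix N N F))ᵀ * J * (P * (a : Matrix N N F)) = J * P := by
    rw [Matrix.transpose_mul, hPa.eq]
    calc (a : Matrix N N F)ᵀ * Pᵀ * J * ((a : Matrix N N F) * P)
        = (a : Matrix N N F)ᵀ * (Pᵀ * J) * ((a : Matrix N N F) * P) := by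
          simp only [Matrix.mul_assoc]
      _ = (a : Matrix N N F)ᵀ * J * (P * (a : Matrix N N F)) * P := by
          rw [hPJ]; simp only [Matrix.mul_assoc]
      _ = ((a : Matrix N N F)ᵀ * J * (a : Matrix N N F)) * (P * P) := by
          rw [hPa.eq]; simp only [Matrix.mul_assoc]
      _ = J * P := by rw [ha', hP]
  have h2 : (1 - P)ᵀ * J = J * (1 - P) := by
    rw [Matrix.transpose_sub, Matrix.transpose_one, sub_mul, mul_sub, hPJ, one_mul, mul_one]
  have h3 : (1 - P) * (P * (a : Matrix N N F)) = 0 := by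
    rw [← mul_assoc, sub_mul, hP, one_mul, sub_self, zero_mul]
  have h4 : (1 - P) * (1 - P) = 1 - P := (show IsIdempotentElem P from hP).one_sub.eq
  have h5 : (P * (a : Matrix N N F))ᵀ * J * (1 - P) = 0 := by
    rw [Matrix.transpose_mul, mul_assoc, mul_assoc, ← mul_assoc _ J, hPJ, mul_assoc J,
      mul_sub, hP, mul_one, sub_self, mul_zero, mul_zero]
  rw [Matrix.transpose_add, add_mul, add_mul, mul_add, mul_add, h1, h5, h2, mul_assoc J,
    mul_assoc J, h3, h4, mul_zero, mul_sub, mul_one]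
  abel

theorem exists_corner [Finite F] (h2 : (2 : F) ≠ 0) {J : Matrix N N F}
    {E T : Subgroup (GL N F × ℤˣ)}
    (hTE : T ≤ E) {Z : Set (GL N F)} (hZ : ∀ e ∈ Z, e * e = 1)
    (hZJ : ∀ e ∈ Z, e ∈ fixGroup J) (hZ1 : ∀ e ∈ Z, (e, 1) ∈ E)
    (hZE : ∀ e ∈ Z, ∀ p ∈ E, Commute p.1 e) {a : GL N F}
    (haJ : a ∈ fixGroup J) (haE : (a, 1) ∈ E) (hT : ∀ p ∈ T, ∃ e ∈ Z, signedConj p a = a * e)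
    (hbad : ∃ p ∈ T, signedConj p a ≠ a) {k : ℕ} (hk : a ^ 2 ^ k = 1) :
    ∃ b ε : GL N F, b ∈ fixGroup J ∧ b ^ 2 ^ k = 1 ∧ ε * ε = 1 ∧ (∀ p ∈ E, Commute p.1 ε) ∧
      Commute b ε ∧ (∀ p ∈ T, signedConj p b = b ∨ signedConj p b = b * ε) ∧
      (∃ p ∈ T, signedConj p b ≠ b) ∧ ∀ p ∈ E, Commute p.1 a → Commute p.1 b := by
  let good : Matrix N N F → Prop := fun P => P * P = P ∧ Pᵀ * J = J * P ∧
    ∀ p ∈ E, Commute P (p.1 : Matrix N N F)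
  let bad : Set (Matrix N N F) := {P | good P ∧ ∃ p ∈ T,
    P * (signedConj p a : GL N F) ≠ P * (a : Matrix N N F)}
  have hbad1 : (1 : Matrix N N F) ∈ bad := by
    obtain ⟨p, hp, hpa⟩ := hbad
    refine ⟨⟨one_mul 1, by simp, fun p _ => Commute.one_left _⟩, p, hp, fun h => hpa ?_⟩
    exact Units.ext (by simpa using h)
  obtain ⟨P, hPbad, hmin⟩ := Set.Finite.exists_minimalFor
    (fun P : Matrix N N F => {X : Matrix N N F | P * X = X}) bad (Set.toFinite bad) ⟨1, hbad1⟩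
  obtain ⟨⟨hP, hPJ, hPE⟩, t, ht, htP⟩ := hPbad
  have hsplit : ∀ Q ∈ bad, P * Q = Q → Q * P = P := fun Q hQ hPQ =>
    hmin hQ (fun X (hX : Q * X = X) => by
      change P * X = X
      rw [← hX, ← mul_assoc, hPQ]) hP
  have h22 : (2 : F)⁻¹ + (2 : F)⁻¹ = 1 := by rw [← two_mul, mul_inv_cancel₀ h2]
  have hpm : ∀ e ∈ Z, P * (e : Matrix N N F) = P ∨ P * (e : Matrix N N F) = -P := by
    intro e he
    have hee : (e : Matrix N N F) * (e : Matrix N N F) = 1 := by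
      rw [← Units.val_mul, hZ e he, Units.val_one]
    have haux : ∀ f : Matrix N N F, f * f = 1 → fᵀ * J = J * f →
        (∀ p ∈ E, Commute f (p.1 : Matrix N N F)) → Commute P f →
        good ((2 : F)⁻¹ • (P * (1 + f))) ∧
          P * ((2 : F)⁻¹ • (P * (1 + f))) = (2 : F)⁻¹ • (P * (1 + f)) := by
      intro f hf hfJ hfE hfP
      refine ⟨⟨?_, ?_, fun p hp => ?_⟩, ?_⟩
      · rw [smul_mul_assoc, mul_smul_comm, smul_smul]
        have e1 : P * (1 + f) * (P * (1 + f)) = (2 : F) • (P * (1 + f)) := by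
          have e2 : (1 + f) * P = P * (1 + f) := by rw [add_mul, mul_add, hfP.eq]; simp
          have e3 : (1 + f) * (1 + f) = (2 : F) • (1 + f) := by
            rw [add_mul, mul_add, mul_add, hf, two_smul]
            simp only [one_mul, mul_one]
            abel
          calc P * (1 + f) * (P * (1 + f)) = P * ((1 + f) * P) * (1 + f) := by
                simp only [mul_assoc]
            _ = P * P * ((1 + f) * (1 + f)) := by rw [e2]; simp only [mul_assoc]
            _ = _ := by rw [hP, e3, mul_smul_comm]
        rw [e1, smul_smul, mul_assoc, inv_mul_cancel₀ h2, mul_one]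
      · rw [Matrix.transpose_smul, Matrix.transpose_mul, smul_mul_assoc, mul_smul_comm]
        congr 1
        have e2 : (1 + f) * P = P * (1 + f) := by rw [add_mul, mul_add, hfP.eq]; simp
        rw [← e2, mul_assoc, hPJ, Matrix.transpose_add, Matrix.transpose_one, ← mul_assoc,
          add_mul, hfJ, ← mul_assoc, mul_add]
        simp
      · exact ((hPE p hp).mul_left ((Commute.one_left _).add_left (hfE p hp))).smul_left _
      · rw [mul_smul_comm, ← mul_assoc, hP]
    have hPe : Commute P (e : Matrix N N F) := by
      exact hPE _ (hZ1 e he)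
    have heJ : (e : Matrix N N F)ᵀ * J = J * (e : Matrix N N F) := by
      have h : (e : Matrix N N F)ᵀ * J * (e : Matrix N N F) = J := hZJ e he
      nth_rewrite 2 [← h]
      rw [mul_assoc, hee, mul_one]
    have heE : ∀ p ∈ E, Commute (e : Matrix N N F) (p.1 : Matrix N N F) := fun p hp => by
      have := (hZE e he p hp).symm
      exact congrArg Units.val this.eq
    obtain ⟨g1, c1⟩ := haux e hee heJ heE hPe
    obtain ⟨g2, c2⟩ := haux (-e) (by simpa using hee)
      (by rw [Matrix.transpose_neg, neg_mul, heJ, mul_neg])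
      (fun p hp => (heE p hp).neg_left) hPe.neg_right
    have hsum : P = (2 : F)⁻¹ • (P * (1 + (e : Matrix N N F))) +
        (2 : F)⁻¹ • (P * (1 + -(e : Matrix N N F))) := by
      rw [← smul_add, ← mul_add]
      have : (1 + (e : Matrix N N F)) + (1 + -(e : Matrix N N F)) = (2 : F) • 1 := by
        rw [two_smul]; abel
      rw [this, mul_smul_comm, smul_smul, inv_mul_cancel₀ h2, one_smul, mul_one]
    have hfin : ∀ f : Matrix N N F, f * f = 1 → (2 : F)⁻¹ • (P * (1 + f)) * P = P →
        Commute P f → P * f = P := by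
      intro f hf h hc
      have e1 : P * (1 + f) * f = P * (1 + f) := by
        rw [mul_assoc, add_mul, hf, one_mul, add_comm]
      calc P * f = (2 : F)⁻¹ • (P * (1 + f)) * P * f := by rw [h]
        _ = (2 : F)⁻¹ • (P * (1 + f) * f) * P := by
          rw [mul_assoc, hc.eq, ← mul_assoc, smul_mul_assoc]
        _ = P := by rw [e1, h]
    by_cases hb1 : ∃ p ∈ T, (2 : F)⁻¹ • (P * (1 + (e : Matrix N N F))) * (signedConj p a : GL N F)
        ≠ (2 : F)⁻¹ • (P * (1 + (e : Matrix N N F))) * (a : Matrix N N F)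
    · exact Or.inl (hfin e hee (hsplit _ ⟨g1, hb1⟩ c1) hPe)
    · by_cases hb2 : ∃ p ∈ T, (2 : F)⁻¹ • (P * (1 + -(e : Matrix N N F))) *
          (signedConj p a : GL N F) ≠
          (2 : F)⁻¹ • (P * (1 + -(e : Matrix N N F))) * (a : Matrix N N F)
      · refine Or.inr ?_
        have := hfin (-e) (by simpa using hee) (hsplit _ ⟨g2, hb2⟩ c2) hPe.neg_right
        rw [mul_neg] at this
        rw [← neg_eq_iff_eq_neg, this]
      · push Not at hb1 hb2
        refine absurd ?_ htP
        rw [hsum, add_mul, add_mul, hb1 t ht, hb2 t ht]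
  have hPa : Commute P (a : Matrix N N F) := hPE _ haE
  let ε : GL N F := cornerUnit P hP (-1) (Commute.neg_one_right P)
  have hε : (ε : Matrix N N F) = P * (-1) + (1 - P) := rfl
  have hPε : Commute P (ε : Matrix N N F) := by
    rw [hε]
    exact ((Commute.refl P).mul_right (Commute.neg_one_right P)).add_right
      ((Commute.one_right P).sub_right (Commute.refl P))
  have hb : ((cornerUnit P hP a hPa : GL N F) : Matrix N N F) = P * a + (1 - P) := rfl
  have hcomm : ∀ g : GL N F, Commute P (g : Matrix N N F) → Commute g ε := by
    intro g hg
    refine Units.ext ?_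
    have : Commute (g : Matrix N N F) (ε : Matrix N N F) := by
      rw [hε]
      exact (hg.symm.mul_right (Commute.neg_one_right _)).add_right
        ((Commute.one_right _).sub_right hg.symm)
    exact this.eq
  refine ⟨cornerUnit P hP a hPa, ε, cornerUnit_mem_fixGroup hP hPJ haJ hPa,
    cornerUnit_pow hP hPa hk, ?_, fun p hp => hcomm _ (hPE p hp), ?_, fun p hp => ?_, ?_, ?_⟩
  · rw [← sq]
    exact cornerUnit_pow hP _ (by simp)
  · refine hcomm _ ?_
    rw [hb]
    exact ((Commute.refl P).mul_right hPa).add_right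
      ((Commute.one_right _).sub_right (Commute.refl P))
  · obtain ⟨e, he, hpe⟩ := hT p hp
    have hs := signedConj_cornerUnit hP hPa (hPE p (hTE hp))
    rw [hpe, Units.val_mul, ← mul_assoc, hPa.eq, mul_assoc] at hs
    rcases hpm e he with h | h
    · refine Or.inl (Units.ext ?_)
      rw [hs, h, hb, hPa.eq]
    · refine Or.inr (Units.ext ?_)
      rw [hs, h, Units.val_mul, hb, hε]
      have e1 : P * (a : Matrix N N F) * P = P * a := by
        rw [mul_assoc, ← hPa.eq, ← mul_assoc, hP]
      have e2 : (1 - P) * P = 0 := by rw [sub_mul, hP, one_mul, sub_self]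
      rw [mul_neg, ← hPa.eq, mul_neg, mul_one, mul_add, mul_neg, add_mul, add_mul, e2, e1,
        mul_sub, e1, mul_sub, e2]
      simp
  · refine ⟨t, ht, fun h => htP ?_⟩
    have hs := signedConj_cornerUnit hP hPa (hPE t (hTE ht))
    rw [h, hb] at hs
    exact (add_right_cancel hs).symm
  · intro p hp hpa
    refine Units.ext ?_
    have hpa' : Commute (p.1 : Matrix N N F) (a : Matrix N N F) := congrArg Units.val hpa.eq
    have : Commute (p.1 : Matrix N N F) (P * a + (1 - P)) :=
      ((hPE p hp).symm.mul_right hpa').add_right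
        ((Commute.one_right _).sub_right (hPE p hp).symm)
    exact this.eq

end CornerElements

section LocalCriterion

variable {A : Type} [Group A] [Fintype A] {sgn : A →* ℤˣ} {E : Subgroup A}

theorem noQuat_of_local
    (h : ∀ x ∈ evenPart sgn E, Odd (orderOf x) → ∃ T E' : Subgroup A, T ≤ E' ∧ E' ≤ E ∧ x ∈ E' ∧
      T ≤ signedCentralizer sgn E x ∧ IsPGroup 2 T ∧
      Odd (T.relIndex (signedCentralizer sgn E x)) ∧ (∃ τ ∈ T, sgn τ = -1) ∧ NoQuat sgn E') :
    NoQuat sgn E := by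
  intro U _ _ _ ρ hρ hs
  refine hρ.not_hasStr_neg_one (fun x hx hxo => ?_) hs
  obtain ⟨T, E', h1, h2, h3, h4, h5, h6, ⟨τ, hτ, hτs⟩, h8⟩ := h x hx hxo
  exact ⟨T, E', h1, h2, h3, h4, h5, h6, ⟨τ, hτ, hτs⟩, HasStr.one_of_noQuat h8
    (hρ.toIsRep.mono (evenPart_mono sgn h2))
    (hs.mono hρ.toIsRep h2 (h1 hτ) hτs)⟩

theorem exists_sylow_of_involution {C : Subgroup A} {τ : A} (hτ : τ ∈ C) (hτ2 : τ * τ = 1) :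
    ∃ T ≤ C, IsPGroup 2 T ∧ Odd (T.relIndex C) ∧ τ ∈ T := by
  have hp : IsPGroup 2 (Subgroup.zpowers (⟨τ, hτ⟩ : C)) := by
    rintro ⟨-, k, rfl⟩
    refine ⟨1, Subtype.ext ?_⟩
    have h : (⟨τ, hτ⟩ : C) ^ 2 = 1 := Subtype.ext (by simpa [sq] using hτ2)
    change ((⟨τ, hτ⟩ : C) ^ k) ^ 2 ^ 1 = 1
    rw [pow_one, ← zpow_natCast, ← _root_.zpow_mul, mul_comm, _root_.zpow_mul, zpow_natCast, h,
      _root_.one_zpow]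
  obtain ⟨Q, hQ⟩ := hp.exists_le_sylow
  refine ⟨Q.1.map C.subtype, Subgroup.map_subtype_le _, Q.2.map _, ?_, ?_⟩
  · have h : (Q.1.map C.subtype).relIndex C = Q.1.index := by
      rw [← Subgroup.relIndex_top_right, ← Subgroup.relIndex_map_map_of_injective _ _
        C.subtype_injective]
      simp [← MonoidHom.range_eq_map]
    rw [h, ← Nat.not_even_iff_odd, even_iff_two_dvd]
    exact Q.not_dvd_index
  · exact ⟨_, hQ (Subgroup.mem_zpowers _), rfl⟩

end LocalCriterion

section InvertingSubgroupsOfIsometries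

theorem signedConj_inv_right {G : Type} [Group G] (p : G × ℤˣ) (x : G) :
    signedConj p x⁻¹ = (signedConj p x)⁻¹ := by
  rw [signedConj, signedConj, ← _root_.inv_zpow, conj_inv]

theorem mem_invertingSubgroup_insert {G : Type} [Group G] {H : Subgroup G} {Γ : Set G} {b : G}
    {p : G × ℤˣ} : p ∈ invertingSubgroup H (insert b Γ) ↔
      p ∈ invertingSubgroup H Γ ∧ signedConj p b = b := by
  simp only [mem_invertingSubgroup, Set.forall_mem_insert]
  tauto

/-- A commuting set of elements of `H` of two-power order. -/
structure IsCommutingTwoSet {G : Type} [Group G] (H : Subgroup G) (Γ : Set G) : Prop where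
  mem : ∀ γ ∈ Γ, γ ∈ H
  comm : ∀ γ ∈ Γ, ∀ δ ∈ Γ, Commute γ δ
  pow : ∀ γ ∈ Γ, ∃ k : ℕ, γ ^ 2 ^ k = 1

theorem IsCommutingTwoSet.insert {G : Type} [Group G] {H : Subgroup G} {Γ : Set G}
    (hΓ : IsCommutingTwoSet H Γ) {b : G} (hb : b ∈ H) (hbΓ : ∀ γ ∈ Γ, Commute b γ)
    (hk : ∃ k : ℕ, b ^ 2 ^ k = 1) : IsCommutingTwoSet H (insert b Γ) where
  mem := by
    rintro γ (rfl | hγ)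
    exacts [hb, hΓ.mem γ hγ]
  comm := by
    rintro γ (rfl | hγ) δ (rfl | hδ)
    exacts [Commute.refl _, hbΓ δ hδ, (hbΓ γ hγ).symm, hΓ.comm γ hγ δ hδ]
  pow := by
    rintro γ (rfl | hγ)
    exacts [hk, hΓ.pow γ hγ]

variable {N F : Type} [Fintype N] [DecidableEq N] [Field F] [Finite F] {J : GL N F}

local notation "Iso" => fixGroup (J : Matrix N N F)
local notation "sg" => MonoidHom.snd (GL N F) ℤˣ

theorem exists_involution_inverting (h2 : (2 : F) ≠ 0) (hJ : (J : Matrix N N F)ᵀ = J)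
    {Γ : Set (GL N F)} (hΓ : IsCommutingTwoSet Iso Γ) {x : GL N F} (hx : x ∈ Iso)
    (hxΓ : ∀ γ ∈ Γ, Commute γ x) :
    ∃ y : GL N F, y * y = 1 ∧ (y, -1) ∈ invertingSubgroup Iso Γ ∧ y * x * y⁻¹ = x⁻¹ := by
  obtain ⟨y, hy, hyS, hyJ⟩ := exists_matrix_antiInvolution h2 Γ x 1 hΓ.pow
    (fun s hs t ht => hΓ.comm s hs t ht) (fun s hs => hxΓ s hs) (one_mem _) J
    (by
      rintro s (hs | rfl)
      exacts [hΓ.mem s hs, hx])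
    (by rw [Units.val_one, mul_one, hJ])
  refine ⟨y, hy, ⟨?_, fun γ hγ => ?_⟩, hyS x (Or.inr rfl)⟩
  · rw [hJ] at hyJ
    exact hyJ
  · rw [signedConj_neg_one, hyS γ (Or.inl hγ), inv_inv]

theorem isStronglyReal_invertingSubgroup (h2 : (2 : F) ≠ 0) (hJ : (J : Matrix N N F)ᵀ = J)
    {Γ : Set (GL N F)} (hΓ : IsCommutingTwoSet Iso Γ) :
    IsStronglyReal sg (invertingSubgroup Iso Γ) := by
  rintro ⟨x, s⟩ ⟨hx, hs⟩
  obtain rfl : s = 1 := hs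
  obtain ⟨y, -, hy, hyx⟩ := exists_involution_inverting h2 hJ hΓ hx.1
    fun γ hγ => (signedConj_one_eq_iff.1 (hx.2 γ hγ)).symm
  exact ⟨_, hy, rfl, Prod.ext hyx (by simp)⟩

end InvertingSubgroupsOfIsometries

section TwoSubgroups

variable {G : Type} [Group G]

theorem noQuat_sup_zpowers [Finite G] {T : Subgroup (G × ℤˣ)} {x y : G}
    (hTx : ∀ p ∈ T, signedConj p x = x)
    (hT : ∀ d, (d, 1) ∈ T → ∀ p ∈ T, signedConj p d = d)
    (hy : (y, -1) ∈ T) (hyy : y * y = 1) :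
    NoQuat (MonoidHom.snd G ℤˣ) (T ⊔ Subgroup.zpowers (x, 1)) := by
  let _ := Fintype.ofFinite (G × ℤˣ)
  have hconj : ∀ p ∈ T, p * (x, 1) * p⁻¹ = (x, 1) ^ (p.2 : ℤ) := fun p hp =>
    Prod.ext (signedConj_eq_iff.1 (hTx p hp)) (by simp)
  have hconj' : ∀ p ∈ T, ∀ z ∈ Subgroup.zpowers ((x, 1) : G × ℤˣ),
      p * z * p⁻¹ ∈ Subgroup.zpowers ((x, 1) : G × ℤˣ) := by
    rintro p hp - ⟨k, rfl⟩
    change p * (x, 1) ^ k * p⁻¹ ∈ _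
    rw [← conj_zpow, hconj p hp]
    exact zpow_mem (zpow_mem (Subgroup.mem_zpowers _) _) _
  have hnorm : T ≤ Subgroup.normalizer (Subgroup.zpowers ((x, 1) : G × ℤˣ)) := by
    intro p hp
    refine Subgroup.mem_normalizer_iff.2 fun z => ⟨hconj' p hp z, fun hz => ?_⟩
    have := hconj' p⁻¹ (inv_mem hp) _ hz
    have e : p⁻¹ * (p * z * p⁻¹) * p⁻¹⁻¹ = z := by group
    rwa [e] at this
  have hmem : ∀ g ∈ evenPart (MonoidHom.snd G ℤˣ) (T ⊔ Subgroup.zpowers (x, 1)), ∃ d, (d, 1) ∈ T ∧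
      ∃ k : ℤ, g = (d * x ^ k, 1) := by
    rintro ⟨g, s⟩ ⟨hg, hs⟩
    obtain rfl : s = 1 := hs
    replace hg : (g, 1) ∈ ((T ⊔ Subgroup.zpowers (x, 1) : Subgroup _) : Set (G × ℤˣ)) := hg
    rw [Subgroup.coe_mul_of_left_le_normalizer_right _ _ hnorm] at hg
    obtain ⟨⟨d, r⟩, hd, -, ⟨k, rfl⟩, hgk⟩ := hg
    have h1 : d * x ^ k = g := congrArg Prod.fst hgk
    have h2 : r * 1 ^ k = 1 := congrArg Prod.snd hgk
    rw [_root_.one_zpow, mul_one] at h2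
    subst h2
    exact ⟨d, hd, k, Prod.ext h1.symm rfl⟩
  have hcomm : ∀ d, (d, 1) ∈ T → Commute d x := fun d hd =>
    signedConj_one_eq_iff.1 (hTx _ hd)
  refine noQuat_of_commute ?_ (Subgroup.mem_sup_left hy) rfl (Prod.ext hyy (by simp))
  intro g hg h hh
  obtain ⟨d, hd, k, rfl⟩ := hmem g hg
  obtain ⟨e, he, l, rfl⟩ := hmem h hh
  refine Prod.ext ?_ rfl
  have hde : Commute d e := signedConj_one_eq_iff.1 (hT e he _ hd)
  exact ((hde.mul_right ((hcomm d hd).zpow_right l)).mul_left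
    (((hcomm e he).symm.zpow_left k).mul_right
      ((Commute.refl x).zpow_zpow k l))).eq

/-- The elements `d` of a subgroup of signed elements, of sign one, which are fixed by signed
conjugation. -/
def fixedElements (T : Subgroup (G × ℤˣ)) : Subgroup T where
  carrier := {d | d.1.2 = 1 ∧ ∀ p ∈ T, signedConj p d.1.1 = d.1.1}
  one_mem' := ⟨rfl, fun p _ => by simp [signedConj]⟩
  mul_mem' := by
    rintro ⟨⟨d, s⟩, hd⟩ ⟨⟨e, r⟩, he⟩ ⟨hd1, hdT⟩ ⟨he1, heT⟩
    obtain rfl : s = 1 := hd1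
    obtain rfl : r = 1 := he1
    refine ⟨rfl, fun p hp => ?_⟩
    change signedConj p (d * e) = d * e
    rw [signedConj_mul_right p (signedConj_one_eq_iff.1 (heT _ hd)), heT p hp, hdT p hp]
  inv_mem' := by
    rintro ⟨⟨d, s⟩, hd⟩ ⟨hd1, hdT⟩
    obtain rfl : s = 1 := hd1
    refine ⟨rfl, fun p hp => ?_⟩
    change signedConj p d⁻¹ = d⁻¹
    rw [signedConj_inv_right, hdT p hp]

theorem fixedElements_normal (T : Subgroup (G × ℤˣ)) : (fixedElements T).Normal where
  conj_mem := by
    rintro d hd t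
    have e : t * d * t⁻¹ = d ^ (t.1.2 : ℤ) := by
      refine Subtype.ext (Prod.ext ?_ ?_)
      · exact signedConj_eq_iff.1 (hd.2 _ t.2)
      · have := hd.1
        simp [this]
    rw [e]
    exact zpow_mem hd _

theorem exists_signedConj_eq_mul [Finite G] {T : Subgroup (G × ℤˣ)} (hT : IsPGroup 2 T)
    (hne : ∃ d, (d, 1) ∈ T ∧ ∃ p ∈ T, signedConj p d ≠ d) :
    ∃ a, (a, 1) ∈ T ∧ (∃ p ∈ T, signedConj p a ≠ a) ∧ ∀ p ∈ T, ∃ e, (e, 1) ∈ T ∧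
      (∀ r ∈ T, signedConj r e = e) ∧ e * e = 1 ∧ signedConj p a = a * e := by
  have hn := fixedElements_normal T
  obtain ⟨a, haK, haD, haa, hac⟩ := hT.exists_central_modulo (D := fixedElements T)
    (K := (MonoidHom.snd G ℤˣ).ker.subgroupOf T) (fun h => by
      obtain ⟨d, hd, p, hp, hpd⟩ := hne
      exact hpd ((h (show (⟨(d, 1), hd⟩ : T) ∈ _ from rfl)).2 p hp))
  obtain ⟨⟨a, s⟩, ha⟩ := a
  obtain rfl : s = 1 := haK
  refine ⟨a, ha, ?_, fun p hp => ?_⟩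
  · by_contra hall
    push Not at hall
    exact haD ⟨rfl, hall⟩
  have hpa : (signedConj p a, 1) ∈ T := by
    have e : (signedConj p a, 1) = (p * (a, 1) * p⁻¹) ^ (p.2 : ℤ) := Prod.ext rfl (by simp)
    rw [e]
    exact T.zpow_mem (T.mul_mem (T.mul_mem hp ha) (T.inv_mem hp)) _
  have key : (⟨(a, 1), ha⟩ : T)⁻¹ * ⟨(signedConj p a, 1), hpa⟩ ∈ fixedElements T := by
    have hc := hac ⟨p, hp⟩
    have hc' : (⟨(a, 1), ha⟩ : T)⁻¹ * (⟨p, hp⟩ * ⟨(a, 1), ha⟩ * ⟨p, hp⟩⁻¹) ∈ fixedElements T := by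
      have := hn.conj_mem _ hc (⟨(a, 1), ha⟩ : T)⁻¹
      convert this using 1
      group
    rcases Int.units_eq_one_or p.2 with h | h
    · convert hc' using 2
      refine Subtype.ext (Prod.ext ?_ (by simp))
      simp [signedConj, h]
    · have h3 := mul_mem (inv_mem haa) (inv_mem hc)
      convert h3 using 1
      refine Subtype.ext (Prod.ext ?_ (by simp))
      simp only [signedConj, h, Subgroup.coe_mul, Subgroup.coe_inv, Prod.fst_mul, Prod.fst_inv,
        Units.val_neg, Units.val_one, _root_.zpow_neg_one]
      group
  obtain ⟨hmem, hfix⟩ : ∃ h : ((a⁻¹ * signedConj p a, 1) : G × ℤˣ) ∈ T,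
      ∀ r ∈ T, signedConj r (a⁻¹ * signedConj p a) = a⁻¹ * signedConj p a := by
    have e : (a⁻¹ * signedConj p a, 1) = ((a, 1) : G × ℤˣ)⁻¹ * (signedConj p a, 1) :=
      Prod.ext rfl (by simp)
    exact ⟨e ▸ T.mul_mem (T.inv_mem ha) hpa, key.2⟩
  have hae : Commute a (a⁻¹ * signedConj p a) := signedConj_one_eq_iff.1 (hfix _ ha)
  refine ⟨a⁻¹ * signedConj p a, hmem, hfix, ?_, by group⟩
  have h1 : signedConj p (a * a) = a * a := haa.2 p hp
  rw [signedConj_mul_right p (Commute.refl a)] at h1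
  have h2 : signedConj p a = a * (a⁻¹ * signedConj p a) := by group
  generalize a⁻¹ * signedConj p a = e at hae h2 ⊢
  rw [h2] at h1
  have h3 : a * e * (a * e) = a * a * (e * e) := by
    rw [mul_assoc, ← mul_assoc e, ← hae.eq]
    simp only [mul_assoc]
  rw [h3] at h1
  exact mul_eq_left.1 h1

end TwoSubgroups

section InvertingSubgroupsOfIsometries

variable {N F : Type} [Fintype N] [DecidableEq N] [Field F] [Finite F] {J : GL N F}

local notation "Iso" => fixGroup (J : Matrix N N F)
local notation "sg" => MonoidHom.snd (GL N F) ℤˣ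

theorem noQuat_pairStabilizer (h2 : (2 : F) ≠ 0) (hJ : (J : Matrix N N F)ᵀ = J)
    {Γ : Set (GL N F)} {b ε : GL N F} (hε : ε * ε = 1) (hbε : Commute b ε)
    (hεE : ∀ p ∈ invertingSubgroup Iso Γ, Commute p.1 ε)
    (hΓ' : IsCommutingTwoSet Iso (insert b Γ))
    (hM : NoQuat sg (invertingSubgroup Iso (insert b Γ))) :
    NoQuat sg (pairStabilizer (invertingSubgroup Iso Γ) b ε hε hbε hεE) := by
  let _ := Fintype.ofFinite (GL N F × ℤˣ)
  have hP : ∀ p, p ∈ pairStabilizer (invertingSubgroup Iso Γ) b ε hε hbε hεE ↔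
      p ∈ invertingSubgroup Iso Γ ∧ (signedConj p b = b ∨ signedConj p b = b * ε) :=
    fun p => Iff.rfl
  obtain ⟨z, -, hz, -⟩ := exists_involution_inverting h2 hJ hΓ' (one_mem _)
    fun γ _ => Commute.one_right γ
  refine noQuat_of_index_le_two (M := invertingSubgroup Iso (insert b Γ)) ?_ ?_ hz rfl
    (isStronglyReal_invertingSubgroup h2 hJ hΓ') hM
  · intro p hp
    rw [mem_invertingSubgroup_insert] at hp
    exact (hP p).2 ⟨hp.1, Or.inl hp.2⟩
  · intro g hg h hh hgM hhM
    rw [mem_invertingSubgroup_insert] at hgM hhM ⊢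
    have h1 : signedConj g b = b * ε := hg.2.resolve_left fun h => hgM ⟨hg.1, h⟩
    have h2 : signedConj h b = b * ε := hh.2.resolve_left fun h => hhM ⟨hh.1, h⟩
    refine ⟨mul_mem hg.1 (inv_mem hh.1), ?_⟩
    have h3 := (inv_mem hh).2.resolve_left fun h' => by
      have := signedConj_inv_eq h'
      rw [inv_inv] at this
      exact hhM ⟨hh.1, this⟩
    rw [signedConj_mul, h3]
    have h5 : signedConj g (b * ε) = signedConj g b * signedConj g ε :=
      signedConj_mul_right g hbε
    have h6 : signedConj g ε = ε := by
      rw [signedConj_eq_iff, (hεE g hg.1).eq, mul_inv_cancel_right]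
      rcases Int.units_eq_one_or g.2 with h | h <;> simp [h]
      exact eq_inv_of_mul_eq_one_left hε
    rw [h5, h6, h1, mul_assoc, hε, mul_one]

theorem exists_noQuat_overgroup (h2 : (2 : F) ≠ 0) (hJ : (J : Matrix N N F)ᵀ = J)
    {Γ : Set (GL N F)} (hΓ : IsCommutingTwoSet Iso Γ)
    (ih : ∀ Δ, IsCommutingTwoSet Iso Δ → invertingSubgroup Iso Δ < invertingSubgroup Iso Γ →
      NoQuat sg (invertingSubgroup Iso Δ)) {x y : GL N F}
    (hxΓ : (x, 1) ∈ invertingSubgroup Iso Γ) {T : Subgroup (GL N F × ℤˣ)}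
    (hTΓ : T ≤ invertingSubgroup Iso Γ) (hTx : ∀ p ∈ T, signedConj p x = x) (hT : IsPGroup 2 T)
    (hy : (y, -1) ∈ T) (hyy : y * y = 1) :
    ∃ E', T ≤ E' ∧ E' ≤ invertingSubgroup Iso Γ ∧ (x, 1) ∈ E' ∧ NoQuat sg E' := by
  let _ := Fintype.ofFinite (GL N F × ℤˣ)
  have hpow : ∀ d, (d, 1) ∈ T → ∃ k : ℕ, d ^ 2 ^ k = 1 := fun d hd => by
    obtain ⟨k, hk⟩ := hT ⟨_, hd⟩
    exact ⟨k, congrArg (fun t : T => t.1.1) hk⟩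
  have hdΓ : ∀ d, (d, 1) ∈ T → ∀ γ ∈ Γ, Commute d γ := fun d hd γ hγ =>
    signedConj_one_eq_iff.1 ((hTΓ hd).2 γ hγ)
  have hdx : ∀ d, (d, 1) ∈ T → Commute x d := fun d hd =>
    (signedConj_one_eq_iff.1 (hTx _ hd)).symm
  by_cases hA : ∃ d, (d, 1) ∈ T ∧ (∀ p ∈ T, signedConj p d = d) ∧
      ∃ p ∈ invertingSubgroup Iso Γ, signedConj p d ≠ d
  · obtain ⟨d, hd, hdT, p, hp, hpd⟩ := hA
    have hle := invertingSubgroup_anti (H := Iso) (Set.subset_insert d Γ)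
    refine ⟨_, fun t ht => mem_invertingSubgroup_insert.2 ⟨hTΓ ht, hdT t ht⟩, hle,
      mem_invertingSubgroup_insert.2 ⟨hxΓ, signedConj_one_eq_iff.2 (hdx d hd)⟩,
      ih _ (hΓ.insert (hTΓ hd).1 (hdΓ d hd) (hpow d hd)) (lt_of_le_of_ne hle fun h => hpd ?_)⟩
    rw [← h, mem_invertingSubgroup_insert] at hp
    exact hp.2
  push Not at hA
  by_cases hB : ∀ d, (d, 1) ∈ T → ∀ p ∈ T, signedConj p d = d
  · refine ⟨_, le_sup_left, sup_le hTΓ ?_, Subgroup.mem_sup_right (Subgroup.mem_zpowers _),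
      noQuat_sup_zpowers hTx hB hy hyy⟩
    exact (Subgroup.zpowers_le).2 hxΓ
  push Not at hB
  obtain ⟨a, ha, hbad, hpair⟩ := exists_signedConj_eq_mul hT hB
  obtain ⟨k, hk⟩ := hpow a ha
  obtain ⟨b, ε, hbJ, hbk, hε, hεE, hbε, hbT, hbbad, hbcomm⟩ := exists_corner h2 hTΓ
    (J := (J : Matrix N N F))
    (Z := {e | (e, 1) ∈ T ∧ (∀ r ∈ T, signedConj r e = e) ∧ e * e = 1}) (fun e he => he.2.2)
    (fun e he => (hTΓ he.1).1) (fun e he => hTΓ he.1) (fun e he p hp => by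
      have h := signedConj_eq_iff.1 (hA e he.1 he.2.1 p hp)
      have he' : e ^ (p.2 : ℤ) = e := by
        rcases Int.units_eq_one_or p.2 with h | h <;> simp [h]
        exact inv_eq_of_mul_eq_one_left he.2.2
      rw [he'] at h
      exact mul_inv_eq_iff_eq_mul.1 h) (hTΓ ha).1 (hTΓ ha)
    (fun p hp => by
      obtain ⟨e, h1, h2, h3, h4⟩ := hpair p hp
      exact ⟨e, ⟨h1, h2, h3⟩, h4⟩) hbad hk
  have hΓ' : IsCommutingTwoSet Iso (insert b Γ) := by
    refine hΓ.insert hbJ (fun γ hγ => (hbcomm (γ, 1) ⟨hΓ.mem γ hγ, fun δ hδ => ?_⟩ ?_).symm)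
      ⟨k, hbk⟩
    · exact signedConj_one_eq_iff.2 (hΓ.comm γ hγ δ hδ)
    · exact (hdΓ a ha γ hγ).symm
  have hlt : invertingSubgroup Iso (insert b Γ) < invertingSubgroup Iso Γ := by
    refine lt_of_le_of_ne (invertingSubgroup_anti (Set.subset_insert b Γ)) fun h => ?_
    obtain ⟨p, hp, hpb⟩ := hbbad
    have := hTΓ hp
    rw [← h, mem_invertingSubgroup_insert] at this
    exact hpb this.2
  let P := pairStabilizer (invertingSubgroup Iso Γ) b ε hε hbε hεE
  have hP : ∀ p, p ∈ P ↔ p ∈ invertingSubgroup Iso Γ ∧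
      (signedConj p b = b ∨ signedConj p b = b * ε) := fun p => Iff.rfl
  have hxb : signedConj (x, 1) b = b := signedConj_one_eq_iff.2 (hbcomm _ hxΓ (hdx a ha))
  refine ⟨P, fun p hp => (hP p).2 ⟨hTΓ hp, hbT p hp⟩, fun p hp => hp.1,
    (hP _).2 ⟨hxΓ, Or.inl hxb⟩,
    noQuat_pairStabilizer h2 hJ hε hbε hεE hΓ' (ih _ hΓ' hlt)⟩

theorem noQuat_invertingSubgroup (h2 : (2 : F) ≠ 0) (hJ : (J : Matrix N N F)ᵀ = J)
    {Γ : Set (GL N F)} (hΓ : IsCommutingTwoSet Iso Γ) :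
    NoQuat sg (invertingSubgroup Iso Γ) := by
  let _ := Fintype.ofFinite (GL N F × ℤˣ)
  induction hn : Nat.card (invertingSubgroup Iso Γ) using Nat.strong_induction_on
    generalizing Γ with
  | _ n ih =>
  subst hn
  have ih' : ∀ Δ, IsCommutingTwoSet Iso Δ → invertingSubgroup Iso Δ < invertingSubgroup Iso Γ →
      NoQuat sg (invertingSubgroup Iso Δ) := fun Δ hΔ hlt =>
    ih _ (Set.Finite.card_lt_card (Set.toFinite _) hlt) hΔ rfl
  refine noQuat_of_local fun x hx _ => ?_
  obtain ⟨x, s⟩ := x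
  obtain ⟨hx, rfl⟩ : (x, s) ∈ invertingSubgroup Iso Γ ∧ s = 1 := hx
  obtain ⟨y, hyy, hy, hyx⟩ := exists_involution_inverting h2 hJ hΓ hx.1
    fun γ hγ => (signedConj_one_eq_iff.1 (hx.2 γ hγ)).symm
  obtain ⟨T, hTC, hT, hodd, hyT⟩ := exists_sylow_of_involution
    (C := signedCentralizer sg (invertingSubgroup Iso Γ) (x, 1)) (τ := (y, -1))
    ⟨hy, Prod.ext (by simpa using hyx) (by simp)⟩ (Prod.ext hyy (by simp))
  obtain ⟨E', h1, h3, h4, h5⟩ := exists_noQuat_overgroup h2 hJ hΓ ih' hx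
    (fun p hp => (hTC hp).1)
    (fun p hp => signedConj_eq_iff.2 (congrArg Prod.fst (hTC hp).2)) hT hyT hyy
  exact ⟨T, E', h1, h3, h4, hTC, hT, hodd, ⟨_, hyT, rfl⟩, h5⟩

end InvertingSubgroupsOfIsometries

section SimpleObjects

variable {Q : Type} [Group Q]

theorem isSimpleRep_of_simple (V : FDRep ℂ Q) [Simple V] :
    IsSimpleRep (⊤ : Subgroup Q) (fun g => V.ρ g) where
  one := map_one V.ρ
  mul g _ h _ := map_mul V.ρ g h
  nontrivial := by
    by_contra h
    rw [not_nontrivial_iff_subsingleton] at h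
    refine id_nonzero V (Action.hom_ext _ _ ?_)
    ext v
    exact Subsingleton.elim _ _
  eq_bot_or_eq_top W hW := by
    let σ : Representation ℂ Q W :=
      { toFun := fun g => (V.ρ g).restrict (hW g (Subgroup.mem_top g))
        map_one' := by ext; simp
        map_mul' := fun g h => by ext; simp }
    let f : FDRep.of σ ⟶ V :=
      { hom := FGModuleCat.ofHom W.subtype
        comm := fun g => by ext; rfl }
    have hinj : Function.Injective f.hom := W.injective_subtype
    have hf : Mono f := ConcreteCategory.mono_of_injective f hinj
    by_cases h0 : f = 0
    · refine Or.inl ((Submodule.eq_bot_iff W).2 fun w hw => ?_)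
      have h1 : f.hom (⟨w, hw⟩ : W) = (0 : FDRep.of σ ⟶ V).hom (⟨w, hw⟩ : W) := by rw [h0]
      exact h1
    · have hiso : IsIso f := isIso_of_mono_of_nonzero h0
      refine Or.inr (Submodule.eq_top_iff'.2 fun v => ?_)
      have h1 : f.hom ((inv f).hom v) = v := by
        have := congrArg (fun φ : V ⟶ V => φ.hom v) (IsIso.inv_hom_id f)
        exact this
      rw [← h1]
      exact Subtype.property (p := (· ∈ W)) _

theorem simple_of_isSimpleRep [Fintype Q] {U : Type} [AddCommGroup U] [Module ℂ U]
    [FiniteDimensional ℂ U] {ρ : Representation ℂ Q U}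
    (hρ : IsSimpleRep (⊤ : Subgroup Q) (fun g => ρ g)) : Simple (FDRep.of ρ) := by
  rw [FDRep.simple_iff_char_is_norm_one]
  have hcard : Nat.card (⊤ : Subgroup Q) = Nat.card Q := Subgroup.card_top
  have h := congrArg (fun r : ℝ => (r : ℂ)) (hρ.sum_normSq.trans (congrArg Nat.cast hcard))
  simp only [Subgroup.mem_top, Finset.filter_true, Complex.ofReal_sum] at h
  refine Eq.trans (Finset.sum_congr rfl fun g _ => ?_) (h.trans (by simp))
  have h1 : (FDRep.of ρ).character g⁻¹ = starRingEnd ℂ ((FDRep.of ρ).character g) :=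
    hρ.toIsRep.trace_inv (Subgroup.mem_top g)
  rw [h1, Complex.mul_conj]
  rfl

end SimpleObjects

/-- If the signed range of an embedding of `Q` carries no quaternionic representation, then every
irreducible representation of `Q` with real character is defined over the reals. -/
theorem IsSimpleRep.exists_realStructure {Q G : Type} [Group Q] [Group G] [Fintype G] {φ : Q →* G}
    (hφ : Function.Injective φ) (hNQ : NoQuat (MonoidHom.snd G ℤˣ) (φ.range.prod ⊤))
    {U : Type} [AddCommGroup U] [Module ℂ U] [FiniteDimensional ℂ U] {σ : Q → Module.End ℂ U}
    (hσ : IsSimpleRep (⊤ : Subgroup Q) σ)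
    (hreal : IsRealValued fun g => LinearMap.trace ℂ U (σ g)) :
    ∃ J : U →ₛₗ[starRingEnd ℂ] U, (∀ g u, J (σ g u) = σ g (J u)) ∧ ∀ u, J (J u) = u := by
  let _ : Fintype Q := Fintype.ofInjective φ hφ
  let ρ : G × ℤˣ → Module.End ℂ U := fun p => σ (Function.invFun φ p.1)
  have hρφ : ∀ g s, ρ (φ g, s) = σ g := fun g s =>
    congrArg σ (Function.leftInverse_invFun hφ g)
  have hev : ∀ p ∈ evenPart (MonoidHom.snd G ℤˣ) (φ.range.prod ⊤), ∃ g, p = (φ g, 1) := by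
    rintro ⟨x, s⟩ ⟨⟨⟨g, rfl⟩, -⟩, hs⟩
    exact ⟨g, Prod.ext rfl hs⟩
  have hmem : ∀ g, (φ g, 1) ∈ evenPart (MonoidHom.snd G ℤˣ) (φ.range.prod ⊤) := fun g =>
    ⟨⟨⟨g, rfl⟩, Subgroup.mem_top _⟩, rfl⟩
  have hρ : IsSimpleRep (evenPart (MonoidHom.snd G ℤˣ) (φ.range.prod ⊤)) ρ :=
    { one := by
        rw [← hσ.one, ← hρφ 1 1, map_one]
        rfl
      mul := fun p hp r hr => by
        obtain ⟨g, rfl⟩ := hev p hp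
        obtain ⟨h, rfl⟩ := hev r hr
        rw [hρφ, hρφ, ← hσ.mul g (Subgroup.mem_top g) h (Subgroup.mem_top h), ← hρφ (g * h) 1,
          map_mul]
        rfl
      nontrivial := hσ.nontrivial
      eq_bot_or_eq_top := fun W hW => hσ.eq_bot_or_eq_top W fun g _ w hw => by
        rw [← hρφ g 1]
        exact hW _ (hmem g) w hw }
  have hy : ((1 : G), (-1 : ℤˣ)) ∈ φ.range.prod ⊤ := ⟨one_mem _, Subgroup.mem_top _⟩
  have hconj : ∀ p : G × ℤˣ, ((1 : G), (-1 : ℤˣ)) * p * ((1 : G), (-1 : ℤˣ))⁻¹ = p := fun p =>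
    Prod.ext (by simp) (by simp)
  have hstr := (hρ.hasStr_or hy rfl fun p hp => by
    rw [hconj, hρ.toIsRep.trace_inv hp]
    obtain ⟨r, hr⟩ := hreal (Function.invFun φ p.1)
    have : LinearMap.trace ℂ U (ρ p) = r := hr
    rw [this, Complex.conj_ofReal]).resolve_right (hNQ U ρ hρ)
  obtain ⟨J, hJ, hJJ⟩ := hstr.change hρ.toIsRep hy rfl
  refine ⟨J, fun g u => ?_, fun u => ?_⟩
  · have := hJ _ (hmem g) u
    rwa [hconj, hρφ] at this
  · have h1 : ((1 : G), (-1 : ℤˣ)) * ((1 : G), (-1 : ℤˣ)) = 1 := Prod.ext (by simp) (by simp)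
    rw [hJJ, h1, hρ.toIsRep.one, one_smul, Module.End.one_apply]

section SpecialOrthogonal

variable {N F : Type} [Fintype N] [DecidableEq N] [Field F] {J : GL N F}

theorem invertingSubgroup_empty {G : Type} [Group G] (H : Subgroup G) :
    invertingSubgroup H ∅ = H.prod ⊤ := by
  ext p
  simp [mem_invertingSubgroup, Subgroup.mem_prod]

theorem isCommutingTwoSet_empty {G : Type} [Group G] (H : Subgroup G) : IsCommutingTwoSet H ∅ where
  mem := by simp
  comm := by simp
  pow := by simp

theorem det_eq_one_or_of_mem_fixGroup {g : GL N F} (hg : g ∈ fixGroup (J : Matrix N N F)) :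
    (g : Matrix N N F).det = 1 ∨ (g : Matrix N N F).det = -1 := by
  have h := congrArg Matrix.det (show (g : Matrix N N F)ᵀ * (J : Matrix N N F) * g = J from hg)
  rw [Matrix.det_mul, Matrix.det_mul, Matrix.det_transpose] at h
  have hJ : (J : Matrix N N F).det ≠ 0 := ((Matrix.isUnit_iff_isUnit_det _).1 J.isUnit).ne_zero
  refine mul_self_eq_one_iff.1 (mul_right_cancel₀ hJ ?_)
  linear_combination h

theorem noQuat_specialFixGroup [Finite F] (h2 : (2 : F) ≠ 0) (hJ : (J : Matrix N N F)ᵀ = J) :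
    NoQuat (MonoidHom.snd (GL N F) ℤˣ) ((specialFixGroup (J : Matrix N N F)).prod ⊤) := by
  let _ := Fintype.ofFinite (GL N F × ℤˣ)
  have hE := isCommutingTwoSet_empty (fixGroup (J : Matrix N N F))
  have h1 := noQuat_invertingSubgroup h2 hJ hE
  have h3 := isStronglyReal_invertingSubgroup h2 hJ hE
  rw [invertingSubgroup_empty] at h1 h3
  have hdet : ∀ g ∈ fixGroup (J : Matrix N N F), g ∉ specialFixGroup (J : Matrix N N F) →
      (g : Matrix N N F).det = -1 := fun g hg hgS =>
    (det_eq_one_or_of_mem_fixGroup hg).resolve_left fun h => hgS ⟨hg, h⟩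
  have hle : specialFixGroup (J : Matrix N N F) ≤ fixGroup (J : Matrix N N F) :=
    fun g hg => hg.1
  refine noQuat_of_le_index_two (Subgroup.prod_mono hle le_rfl) ?_
    (y := (1, -1)) ⟨one_mem _, Subgroup.mem_top _⟩ rfl h3 h1
  intro g hg h hh hgM hhM
  have hg1 := hdet g.1 hg.1 fun h => hgM ⟨h, Subgroup.mem_top _⟩
  have hh1 := hdet h.1 hh.1 fun h' => hhM ⟨h', Subgroup.mem_top _⟩
  refine ⟨⟨(fixGroup (J : Matrix N N F)).mul_mem hg.1 (Subgroup.inv_mem _ hh.1), ?_⟩,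
    Subgroup.mem_top _⟩
  have h4 : ((g.1 * h.1⁻¹ : GL N F) : Matrix N N F) * (h.1 : Matrix N N F) = g.1 := by
    rw [← Units.val_mul, inv_mul_cancel_right]
  have h5 := congrArg Matrix.det h4
  rw [Matrix.det_mul, hg1, hh1] at h5
  exact mul_right_cancel₀ (neg_ne_zero.2 one_ne_zero) (h5.trans (one_mul _).symm)

end SpecialOrthogonal

section HyperbolicEmbedding

theorem eq_zero_of_smul_eq_neg_smul {K V : Type*} [Field K] [AddCommGroup V] [Module K V] {i : K}
    (hi : i * i = -1) (h2 : (2 : K) ≠ 0) {X : V} (h : i • X = -(i • X)) : X = 0 := by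
  have hi0 : i ≠ 0 := by
    rintro rfl
    simp at hi
  have h3 : ((2 : K) * i) • X = 0 := by
    rw [two_mul, add_smul]
    exact add_eq_zero_iff_eq_neg.2 h
  exact (smul_eq_zero.1 h3).resolve_left (mul_ne_zero h2 hi0)

variable {n K : Type} [Fintype n] [DecidableEq n] [Field K]

/-- The matrix of the hyperbolic form, as an invertible matrix. -/
def hyperbolicForm (n K : Type) [Fintype n] [DecidableEq n] [Field K] : GL (n ⊕ n) K where
  val := fromBlocks 0 1 1 0
  inv := fromBlocks 0 1 1 0
  val_inv := by simp [fromBlocks_multiply]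
  inv_val := by simp [fromBlocks_multiply]

/-- The embedding of the general linear group as a Levi subgroup of the isometry group of the
hyperbolic form. -/
def leviEmbedding (n K : Type) [Fintype n] [DecidableEq n] [Field K] :
    GL n K →* GL (n ⊕ n) K where
  toFun A :=
    { val := fromBlocks A 0 0 (A⁻¹ : GL n K).valᵀ
      inv := fromBlocks (A⁻¹ : GL n K).val 0 0 (A : Matrix n n K)ᵀ
      val_inv := by simp [fromBlocks_multiply, ← transpose_mul]
      inv_val := by simp [fromBlocks_multiply, ← transpose_mul] }
  map_one' := Units.ext (by simp)
  map_mul' A B := Units.ext (by simp [fromBlocks_multiply, _root_.mul_inv_rev])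

theorem coe_leviEmbedding (A : GL n K) : (leviEmbedding n K A : Matrix (n ⊕ n) (n ⊕ n) K) =
    fromBlocks A 0 0 (A⁻¹ : GL n K).valᵀ := rfl

theorem leviEmbedding_injective : Function.Injective (leviEmbedding n K) := fun A B h => by
  have h1 := congrArg Units.val h
  rw [coe_leviEmbedding, coe_leviEmbedding, fromBlocks_inj] at h1
  exact Units.ext h1.1

theorem leviEmbedding_mem (A : GL n K) :
    leviEmbedding n K A ∈ fixGroup (hyperbolicForm n K : Matrix (n ⊕ n) (n ⊕ n) K) := by
  change (fromBlocks (A : Matrix n n K) 0 0 (A⁻¹ : GL n K).valᵀ)ᵀ * fromBlocks 0 1 1 0 *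
    fromBlocks (A : Matrix n n K) 0 0 (A⁻¹ : GL n K).valᵀ = fromBlocks 0 1 1 0
  simp [fromBlocks_multiply, fromBlocks_transpose, ← transpose_mul]

/-- The block scalar matrix with entries `i` and `-i`, for a square root `i` of `-1`. -/
def blockScalar (n : Type) [Fintype n] [DecidableEq n] {i : K} (hi : i * i = -1) :
    GL (n ⊕ n) K where
  val := fromBlocks (i • 1) 0 0 (-(i • 1))
  inv := -fromBlocks (i • 1) 0 0 (-(i • 1))
  val_inv := by simp [fromBlocks_multiply, fromBlocks_neg, smul_smul, hi]
  inv_val := by simp [fromBlocks_multiply, fromBlocks_neg, smul_smul, hi]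

variable {i : K} (hi : i * i = -1)

theorem coe_blockScalar :
    (blockScalar n hi : Matrix (n ⊕ n) (n ⊕ n) K) = fromBlocks (i • 1) 0 0 (-(i • 1)) := rfl

theorem blockScalar_inv : (blockScalar n hi)⁻¹ = blockScalar n hi * -1 :=
  Units.ext (by
    rw [Units.val_mul, Units.val_neg, Units.val_one, mul_neg_one]
    rfl)

theorem blockScalar_mem :
    blockScalar n hi ∈ fixGroup (hyperbolicForm n K : Matrix (n ⊕ n) (n ⊕ n) K) := by
  change (fromBlocks (i • 1) 0 0 (-(i • 1)))ᵀ * fromBlocks 0 1 1 0 *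
    fromBlocks (i • 1) 0 0 (-(i • 1)) = fromBlocks 0 1 1 0
  simp [fromBlocks_multiply, fromBlocks_transpose, smul_smul, hi]

theorem leviEmbedding_commute_blockScalar (A : GL n K) :
    Commute (leviEmbedding n K A) (blockScalar n hi) := by
  refine Units.ext ?_
  rw [Units.val_mul, Units.val_mul, coe_leviEmbedding, coe_blockScalar]
  simp [fromBlocks_multiply]

theorem isCommutingTwoSet_blockScalar :
    IsCommutingTwoSet (fixGroup (hyperbolicForm n K : Matrix (n ⊕ n) (n ⊕ n) K))
      (insert (blockScalar n hi) ∅) := by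
  refine (isCommutingTwoSet_empty _).insert (blockScalar_mem hi) (by simp) ⟨2, ?_⟩
  have h : blockScalar n hi * blockScalar n hi = -1 := by
    refine mul_eq_of_eq_inv_mul ?_
    rw [blockScalar_inv, mul_assoc, neg_mul_neg, one_mul, mul_one]
  rw [pow_two 2, pow_mul, sq (blockScalar n hi), h, sq, neg_mul_neg, one_mul]

theorem mem_range_leviEmbedding (h2 : (2 : K) ≠ 0) {g : GL (n ⊕ n) K}
    (hg : g ∈ fixGroup (hyperbolicForm n K : Matrix (n ⊕ n) (n ⊕ n) K))
    (hc : Commute g (blockScalar n hi)) : g ∈ (leviEmbedding n K).range := by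
  obtain ⟨a, b, c, d, habcd⟩ : ∃ a b c d, (g : Matrix (n ⊕ n) (n ⊕ n) K) = fromBlocks a b c d :=
    ⟨_, _, _, _, (fromBlocks_toBlocks _).symm⟩
  have h1 := congrArg Units.val hc.eq
  rw [Units.val_mul, Units.val_mul, habcd, coe_blockScalar] at h1
  simp only [fromBlocks_multiply, fromBlocks_inj, Matrix.mul_zero, Matrix.zero_mul, add_zero,
    zero_add, Matrix.mul_neg, Matrix.neg_mul, Matrix.mul_smul, Matrix.smul_mul, Matrix.mul_one,
    Matrix.one_mul] at h1
  obtain ⟨-, hb, hc', -⟩ := h1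
  obtain rfl := eq_zero_of_smul_eq_neg_smul hi h2 hb.symm
  obtain rfl := eq_zero_of_smul_eq_neg_smul hi h2 hc'
  change (g : Matrix (n ⊕ n) (n ⊕ n) K)ᵀ * fromBlocks 0 1 1 0 *
    (g : Matrix (n ⊕ n) (n ⊕ n) K) = fromBlocks 0 1 1 0 at hg
  rw [habcd] at hg
  simp only [fromBlocks_multiply, fromBlocks_transpose, fromBlocks_inj, Matrix.mul_zero,
    Matrix.zero_mul, add_zero, zero_add, Matrix.mul_one, transpose_zero] at hg
  obtain ⟨-, had, hda, -⟩ := hg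
  have h3 : dᵀ * a = 1 := hda
  refine ⟨⟨a, dᵀ, mul_eq_one_comm.1 h3, h3⟩, Units.ext ?_⟩
  rw [coe_leviEmbedding, habcd]
  simp

theorem exists_fromBlocks_of_anticommute (h2 : (2 : K) ≠ 0) {g : GL (n ⊕ n) K}
    (hg : g ∈ fixGroup (hyperbolicForm n K : Matrix (n ⊕ n) (n ⊕ n) K))
    (hc : g * blockScalar n hi = blockScalar n hi * -1 * g) :
    ∃ X : GL n K, (g : Matrix (n ⊕ n) (n ⊕ n) K) = fromBlocks 0 X (X⁻¹ : GL n K).valᵀ 0 := by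
  obtain ⟨a, b, c, d, habcd⟩ : ∃ a b c d, (g : Matrix (n ⊕ n) (n ⊕ n) K) = fromBlocks a b c d :=
    ⟨_, _, _, _, (fromBlocks_toBlocks _).symm⟩
  have h1 := congrArg Units.val hc
  rw [Units.val_mul, Units.val_mul, Units.val_mul, habcd, coe_blockScalar, Units.val_neg,
    Units.val_one, mul_neg_one, fromBlocks_neg] at h1
  simp only [fromBlocks_multiply, fromBlocks_inj, Matrix.mul_zero, Matrix.zero_mul, add_zero,
    zero_add, Matrix.mul_neg, Matrix.neg_mul, Matrix.mul_smul, Matrix.smul_mul, Matrix.mul_one,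
    Matrix.one_mul, neg_zero, neg_neg] at h1
  obtain ⟨ha, -, -, hd⟩ := h1
  obtain rfl := eq_zero_of_smul_eq_neg_smul hi h2 ha
  obtain rfl := eq_zero_of_smul_eq_neg_smul hi h2 hd.symm
  change (g : Matrix (n ⊕ n) (n ⊕ n) K)ᵀ * fromBlocks 0 1 1 0 *
    (g : Matrix (n ⊕ n) (n ⊕ n) K) = fromBlocks 0 1 1 0 at hg
  rw [habcd] at hg
  simp only [fromBlocks_multiply, fromBlocks_transpose, fromBlocks_inj, Matrix.mul_zero,
    Matrix.zero_mul, add_zero, zero_add, Matrix.mul_one, transpose_zero] at hg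
  have h3 : cᵀ * b = 1 := hg.2.1
  refine ⟨⟨b, cᵀ, mul_eq_one_comm.1 h3, h3⟩, ?_⟩
  rw [habcd]
  simp

/-- Every invertible matrix is congruent to its transpose, so anticommuting isometries are
inverted by the Levi subgroup. -/
theorem exists_leviEmbedding_inverting [Finite K] (h2 : (2 : K) ≠ 0) {g : GL (n ⊕ n) K}
    {X : GL n K} (hg : (g : Matrix (n ⊕ n) (n ⊕ n) K) = fromBlocks 0 X (X⁻¹ : GL n K).valᵀ 0) :
    ∃ A : GL n K, leviEmbedding n K A * g * (leviEmbedding n K A)⁻¹ = g⁻¹ := by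
  let Xt : GL n K := ⟨(X : Matrix n n K)ᵀ, (X⁻¹ : GL n K).valᵀ,
    by simp [← transpose_mul], by simp [← transpose_mul]⟩
  have hXt : (Xt : Matrix n n K) = (X : Matrix n n K)ᵀ := rfl
  have hXtX : (X⁻¹ : GL n K).valᵀ * (X : Matrix n n K)ᵀ = 1 := by simp [← transpose_mul]
  have hX : (X : Matrix n n K) * (X⁻¹ : GL n K).val = 1 := by simp
  have hu : ((X⁻¹ * Xt : GL n K) : Matrix n n K) = (X⁻¹ : GL n K).val * (X : Matrix n n K)ᵀ := rfl
  obtain ⟨y, -, -, hy⟩ := exists_matrix_antiInvolution h2 ∅ (X⁻¹ * Xt) (X⁻¹ * Xt) (by simp)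
    (by simp) (by simp) (Subgroup.subset_closure (by simp)) X
    (by
      rintro s (hs | rfl)
      · exact absurd hs (Set.notMem_empty s)
      · change ((X⁻¹ * Xt : GL n K) : Matrix n n K)ᵀ * X * ((X⁻¹ * Xt : GL n K) : Matrix n n K) = X
        rw [hu, transpose_mul, transpose_transpose, Matrix.mul_assoc, ← Matrix.mul_assoc _ X.val,
          Matrix.mul_assoc, ← Matrix.mul_assoc X.val, hX, Matrix.one_mul, Matrix.mul_assoc, hXtX,
          Matrix.mul_one])
    (by rw [hu, ← Matrix.mul_assoc, hX, Matrix.one_mul, transpose_transpose])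
  have hyi : (y : Matrix n n K) * (y⁻¹ : GL n K).val = 1 := by simp
  have hyt : (y : Matrix n n K)ᵀ * (X : Matrix n n K)ᵀ * y = X := by
    have := congrArg transpose hy
    rwa [transpose_mul, transpose_mul, transpose_transpose, transpose_transpose,
      ← Matrix.mul_assoc] at this
  let A : GL n K := ⟨(y : Matrix n n K)ᵀ, (y⁻¹ : GL n K).valᵀ,
    by simp [← transpose_mul], by simp [← transpose_mul]⟩
  refine ⟨A, ?_⟩
  rw [mul_inv_eq_iff_eq_mul, eq_inv_mul_iff_mul_eq]
  refine Units.ext ?_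
  rw [Units.val_mul, Units.val_mul, coe_leviEmbedding, hg]
  have hA : (A : Matrix n n K) = (y : Matrix n n K)ᵀ := rfl
  have hA' : (A⁻¹ : GL n K).valᵀ = (y⁻¹ : GL n K).val := transpose_transpose _
  rw [hA, hA']
  simp only [fromBlocks_multiply, Matrix.mul_zero, Matrix.zero_mul, add_zero, zero_add]
  congr 1
  · calc (X : Matrix n n K) * ((y⁻¹ : GL n K).val * (X⁻¹ : GL n K).valᵀ)
        = (y : Matrix n n K)ᵀ * (X : Matrix n n K)ᵀ * (y * (y⁻¹ : GL n K).val) *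
            (X⁻¹ : GL n K).valᵀ := by
          conv_lhs => rw [← hyt]
          simp only [Matrix.mul_assoc]
      _ = _ := by
          have : (X : Matrix n n K)ᵀ * (X⁻¹ : GL n K).valᵀ = 1 := by simp [← transpose_mul]
          rw [hyi, Matrix.mul_one, Matrix.mul_assoc, this, Matrix.mul_one]
  · calc (X⁻¹ : GL n K).valᵀ * ((y : Matrix n n K)ᵀ * X)
        = (X⁻¹ : GL n K).valᵀ * ((y : Matrix n n K)ᵀ * X * y) * (y⁻¹ : GL n K).val := by
          simp only [Matrix.mul_assoc, hyi, Matrix.mul_one]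
      _ = _ := by rw [hy, hXtX, Matrix.one_mul]

theorem noQuat_leviEmbedding [Finite K] {i : K} (hi : i * i = -1) (h2 : (2 : K) ≠ 0) :
    NoQuat (MonoidHom.snd (GL (n ⊕ n) K) ℤˣ) ((leviEmbedding n K).range.prod ⊤) := by
  let _ := Fintype.ofFinite (GL (n ⊕ n) K × ℤˣ)
  have hJ : (hyperbolicForm n K : Matrix (n ⊕ n) (n ⊕ n) K)ᵀ = hyperbolicForm n K := by
    change (fromBlocks 0 1 1 0)ᵀ = fromBlocks 0 1 1 0
    simp [fromBlocks_transpose]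
  have hΓ := isCommutingTwoSet_blockScalar (n := n) hi
  have hεE : ∀ p ∈ invertingSubgroup (fixGroup (hyperbolicForm n K : Matrix (n ⊕ n) (n ⊕ n) K)) ∅,
      Commute p.1 (-1) := fun p _ => Commute.neg_one_right p.1
  have hε : (-1 : GL (n ⊕ n) K) * -1 = 1 := neg_mul_neg 1 1 |>.trans (one_mul 1)
  have hP := noQuat_pairStabilizer h2 hJ hε (Commute.neg_one_right _) hεE hΓ
    (noQuat_invertingSubgroup h2 hJ hΓ)
  have hiff : ∀ p : GL (n ⊕ n) K × ℤˣ, (signedConj p (blockScalar n hi) = blockScalar n hi ∨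
      signedConj p (blockScalar n hi) = blockScalar n hi * -1) ↔
      Commute p.1 (blockScalar n hi) ∨
        p.1 * blockScalar n hi = blockScalar n hi * -1 * p.1 := by
    rintro ⟨g, s⟩
    rcases Int.units_eq_one_or s with rfl | rfl
    · rw [signedConj_one_eq_iff, signedConj_one_right, mul_inv_eq_iff_eq_mul]
    · rw [signedConj_neg_one, inv_eq_iff_eq_inv, inv_eq_iff_eq_inv, ← blockScalar_inv,
        _root_.inv_inv, mul_inv_eq_iff_eq_mul, mul_inv_eq_iff_eq_mul, or_comm]
      rfl
  have hmem : ∀ A s, (leviEmbedding n K A, s) ∈ pairStabilizer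
      (invertingSubgroup (fixGroup (hyperbolicForm n K : Matrix (n ⊕ n) (n ⊕ n) K)) ∅)
      (blockScalar n hi) (-1) hε (Commute.neg_one_right _) hεE := fun A s =>
    ⟨⟨leviEmbedding_mem A, by simp⟩, (hiff _).2 (Or.inl (leviEmbedding_commute_blockScalar hi A))⟩
  refine noQuat_of_le_index_two (y := (1, -1)) ?_ ?_ ⟨one_mem _, Subgroup.mem_top _⟩ rfl ?_ hP
  · rintro ⟨-, s⟩ ⟨⟨A, rfl⟩, -⟩
    exact hmem A s
  · intro g hg h hh hgM hhM
    have hanti : ∀ p ∈ pairStabilizer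
        (invertingSubgroup (fixGroup (hyperbolicForm n K : Matrix (n ⊕ n) (n ⊕ n) K)) ∅)
        (blockScalar n hi) (-1) hε (Commute.neg_one_right _) hεE,
        p ∉ (leviEmbedding n K).range.prod ⊤ →
          p.1 * blockScalar n hi * p.1⁻¹ = blockScalar n hi * -1 := fun p hp hpM =>
      mul_inv_eq_iff_eq_mul.2 (((hiff p).1 hp.2).resolve_left fun hc =>
        hpM ⟨mem_range_leviEmbedding hi h2 hp.1.1 hc, Subgroup.mem_top _⟩)
    refine ⟨mem_range_leviEmbedding hi h2 (mul_mem hg.1.1 (inv_mem hh.1.1)) ?_,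
      Subgroup.mem_top _⟩
    have h1 := hanti g hg hgM
    have h3 := hanti h hh hhM
    have h4 : h.1⁻¹ * blockScalar n hi * h.1 = blockScalar n hi * -1 := by
      have : blockScalar n hi = (h.1 * blockScalar n hi * h.1⁻¹) * -1 := by
        rw [h3, mul_assoc, hε, mul_one]
      conv_lhs => rw [this]
      rw [mul_neg_one, mul_neg, neg_mul, mul_neg_one]
      group
    change g.1 * h.1⁻¹ * blockScalar n hi = blockScalar n hi * (g.1 * h.1⁻¹)
    rw [← mul_inv_eq_iff_eq_mul]
    calc g.1 * h.1⁻¹ * blockScalar n hi * (g.1 * h.1⁻¹)⁻¹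
        = g.1 * (h.1⁻¹ * blockScalar n hi * h.1) * g.1⁻¹ := by group
      _ = g.1 * blockScalar n hi * g.1⁻¹ * -1 := by
          rw [h4, mul_neg_one, mul_neg_one, mul_neg, neg_mul]
      _ = blockScalar n hi := by rw [h1, mul_assoc, hε, mul_one]
  · rintro ⟨g, s⟩ ⟨hg, hs⟩
    obtain rfl : s = 1 := hs
    rcases (hiff _).1 hg.2 with hc | hc
    · obtain ⟨y, hy, hys, hyg⟩ := isStronglyReal_invertingSubgroup h2 hJ hΓ (g, 1)
        ⟨mem_invertingSubgroup_insert.2 ⟨hg.1, signedConj_one_eq_iff.2 hc⟩, rfl⟩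
      rw [mem_invertingSubgroup_insert] at hy
      exact ⟨y, ⟨hy.1, Or.inl hy.2⟩, hys, hyg⟩
    · obtain ⟨X, hX⟩ := exists_fromBlocks_of_anticommute hi h2 hg.1.1 hc
      obtain ⟨A, hA⟩ := exists_leviEmbedding_inverting h2 hX
      exact ⟨_, hmem A (-1), rfl, Prod.ext hA (by simp)⟩

end HyperbolicEmbedding

section InvariantForms

variable {Q U : Type} [AddCommGroup U] [Module ℂ U] {σ : Q → Module.End ℂ U}

/-- The average over the group of the product of two linear forms, as a bilinear form. -/
def averageForm [Fintype Q] (σ : Q → Module.End ℂ U) (l l' : Module.Dual ℂ U) :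
    LinearMap.BilinForm ℂ U :=
  ∑ g : Q, (l ∘ₗ σ g).smulRight (l' ∘ₗ σ g)

theorem averageForm_apply [Fintype Q] (l l' : Module.Dual ℂ U) (x y : U) :
    averageForm σ l l' x y = ∑ g : Q, l (σ g x) * l' (σ g y) := by
  simp [averageForm, LinearMap.sum_apply]

theorem repr_eq_form {ι : Type*} [Fintype ι] [DecidableEq ι] {B : LinearMap.BilinForm ℂ U}
    (hB : B.Nondegenerate) (e : Module.Basis ι ℂ U) (x : U) (i : ι) :
    e.repr x i = B (B.dualBasis hB e i) x := by
  conv_rhs => rw [← e.sum_repr x, map_sum]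
  simp only [map_smul, LinearMap.BilinForm.apply_dualBasis_left, smul_eq_mul]
  simp

theorem trace_eq_sum_form {ι : Type*} [Fintype ι] [DecidableEq ι] {B : LinearMap.BilinForm ℂ U}
    (hB : B.Nondegenerate) (e : Module.Basis ι ℂ U) (T : Module.End ℂ U) :
    LinearMap.trace ℂ U T = ∑ i, B (B.dualBasis hB e i) (T (e i)) := by
  rw [LinearMap.trace_eq_matrix_trace ℂ e, Matrix.trace]
  exact Finset.sum_congr rfl fun i _ =>
    by rw [Matrix.diag_apply, LinearMap.toMatrix_apply, repr_eq_form hB]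

variable [Group Q]

theorem averageForm_invariant [Fintype Q] (hσ : IsRep (⊤ : Subgroup Q) σ) (l l' : Module.Dual ℂ U)
    (g : Q)
    (x y : U) : averageForm σ l l' (σ g x) (σ g y) = averageForm σ l l' x y := by
  rw [averageForm_apply, averageForm_apply]
  refine Fintype.sum_equiv (Equiv.mulRight g) _ _ fun h => ?_
  have e := fun u => hσ.mul_apply (Subgroup.mem_top h) (Subgroup.mem_top g) u
  simp [← e]

variable [FiniteDimensional ℂ U]

theorem IsSimpleRep.nondegenerate_of_invariant (hσ : IsSimpleRep (⊤ : Subgroup Q) σ)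
    {B : LinearMap.BilinForm ℂ U} (hB : ∀ g x y, B (σ g x) (σ g y) = B x y) (h0 : B ≠ 0) :
    B.Nondegenerate := by
  have hker : LinearMap.ker B = ⊥ := by
    refine (hσ.eq_bot_or_eq_top (LinearMap.ker B) fun g _ x hx => ?_).resolve_right fun h =>
      h0 (LinearMap.ker_eq_top.1 h)
    rw [LinearMap.mem_ker] at hx ⊢
    ext y
    rw [← hσ.toIsRep.self_inv_apply (Subgroup.mem_top g) y, hB, hx]
    rfl
  exact LinearMap.BilinForm.nondegenerate_iff_ker_eq_bot.2 hker

theorem IsSimpleRep.trace_inv_eq_of_form (hσ : IsSimpleRep (⊤ : Subgroup Q) σ)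
    {B : LinearMap.BilinForm ℂ U} (hB : ∀ g x y, B (σ g x) (σ g y) = B x y) (h0 : B ≠ 0) (g : Q) :
    LinearMap.trace ℂ U (σ g⁻¹) = LinearMap.trace ℂ U (σ g) := by
  have hnd := hσ.nondegenerate_of_invariant hB h0
  let e := Module.finBasis ℂ U
  rw [trace_eq_sum_form hnd e, LinearMap.trace_eq_matrix_trace ℂ (B.dualBasis hnd e),
    Matrix.trace]
  refine Finset.sum_congr rfl fun i _ => ?_
  rw [Matrix.diag_apply, LinearMap.toMatrix_apply, LinearMap.BilinForm.dualBasis_repr_apply,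
    ← hB g _ (σ g⁻¹ _), hσ.toIsRep.self_inv_apply (Subgroup.mem_top g)]

variable [Fintype Q]

theorem IsSimpleRep.sum_trace_sq_of_not_real (hσ : IsSimpleRep (⊤ : Subgroup Q) σ)
    (hreal : ¬IsRealValued fun g => LinearMap.trace ℂ U (σ g)) :
    ∑ g, LinearMap.trace ℂ U (σ (g * g)) = 0 := by
  have hzero : ∀ B : LinearMap.BilinForm ℂ U, (∀ g x y, B (σ g x) (σ g y) = B x y) → B = 0 := by
    intro B hB
    by_contra h0
    refine hreal fun g => ⟨(LinearMap.trace ℂ U (σ g)).re, ?_⟩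
    refine (Complex.conj_eq_iff_re.1 ?_).symm
    rw [← hσ.toIsRep.trace_inv (Subgroup.mem_top g), hσ.trace_inv_eq_of_form hB h0]
  let e := Module.finBasis ℂ U
  have h1 : ∀ g, LinearMap.trace ℂ U (σ (g * g)) =
      ∑ i, ∑ j, e.coord j (σ g (e i)) * e.coord i (σ g (e j)) := fun g => by
    rw [LinearMap.trace_eq_matrix_trace ℂ e, Matrix.trace]
    refine Finset.sum_congr rfl fun i _ => ?_
    rw [Matrix.diag_apply, LinearMap.toMatrix_apply,
      hσ.toIsRep.mul_apply (Subgroup.mem_top g) (Subgroup.mem_top g)]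
    conv_lhs => rw [← e.sum_repr (σ g (e i)), map_sum, map_sum]
    simp [-Module.Basis.sum_repr]
  simp only [h1]
  rw [Finset.sum_comm]
  refine Finset.sum_eq_zero fun i _ => ?_
  rw [Finset.sum_comm]
  refine Finset.sum_eq_zero fun j _ => ?_
  rw [← averageForm_apply, hzero _ (averageForm_invariant hσ.toIsRep _ _)]
  rfl

theorem IsSimpleRep.sum_form_mul_form (hσ : IsSimpleRep (⊤ : Subgroup Q) σ)
    (l : Module.Dual ℂ U) (x y : U) (l' : Module.Dual ℂ U) :
    Module.finrank ℂ U * ∑ g, l (σ g x) * l' (σ g⁻¹ y) = Nat.card Q * (l' x * l y) := by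
  let T : Module.End ℂ U := ∑ g, (l' ∘ₗ σ g⁻¹).smulRight (σ g x)
  have hT : ∀ u, T u = ∑ g, l' (σ g⁻¹ u) • σ g x := fun u => by simp [T, LinearMap.sum_apply]
  obtain ⟨c, hc⟩ := hσ.eq_smul_of_commute T fun h _ u => by
    rw [hT, hT, map_sum]
    refine Fintype.sum_equiv (Equiv.mulLeft h⁻¹) _ _ fun g => ?_
    rw [map_smul, Equiv.coe_mulLeft, ← hσ.toIsRep.mul_apply (Subgroup.mem_top _)
      (Subgroup.mem_top _), ← hσ.toIsRep.mul_apply (Subgroup.mem_top _) (Subgroup.mem_top _)]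
    simp
  have htr : LinearMap.trace ℂ U T = Nat.card Q * l' x := by
    simp only [T, map_sum, LinearMap.trace_smulRight, LinearMap.comp_apply,
      hσ.toIsRep.inv_apply_self (Subgroup.mem_top _)]
    simp
  have hc' : T = c • 1 := LinearMap.ext hc
  rw [hc', map_smul, LinearMap.trace_one, smul_eq_mul] at htr
  have h1 : ∑ g, l (σ g x) * l' (σ g⁻¹ y) = c * l y := by
    rw [← smul_eq_mul, ← map_smul, ← hc y, hT, map_sum]
    exact Finset.sum_congr rfl fun g _ => by rw [map_smul, smul_eq_mul, mul_comm]
  rw [h1]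
  linear_combination l y * htr

theorem IsSimpleRep.exists_symmetric_form (hσ : IsSimpleRep (⊤ : Subgroup Q) σ)
    {J : U →ₛₗ[starRingEnd ℂ] U} (hJ : ∀ g u, J (σ g u) = σ g (J u)) (hJJ : ∀ u, J (J u) = u) :
    ∃ B : LinearMap.BilinForm ℂ U, B ≠ 0 ∧ (∀ g x y, B (σ g x) (σ g y) = B x y) ∧
      ∀ x y, B x y = B y x := by
  have := hσ.nontrivial
  obtain ⟨x, hx0, hx⟩ : ∃ x : U, x ≠ 0 ∧ J x = x := by
    obtain ⟨v, hv⟩ := exists_ne (0 : U)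
    by_cases h : v + J v = 0
    · refine ⟨Complex.I • v, smul_ne_zero Complex.I_ne_zero hv, ?_⟩
      rw [map_smulₛₗ, Complex.conj_I, eq_neg_of_add_eq_zero_right h, neg_smul, smul_neg, neg_neg]
    · exact ⟨_, h, by rw [map_add, hJJ, add_comm]⟩
  obtain ⟨l, hl⟩ : ∃ l : Module.Dual ℂ U, l x = 1 := by
    obtain ⟨l, hl⟩ := not_forall.1 (mt (Module.forall_dual_apply_eq_zero_iff ℂ x).1 hx0)
    exact ⟨(l x)⁻¹ • l, by simp [inv_mul_cancel₀ hl]⟩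
  let r : Module.Dual ℂ U :=
    { toFun := fun u => l u + starRingEnd ℂ (l (J u))
      map_add' := fun u v => by
        simp only [map_add]
        ring
      map_smul' := fun c u => by simp [map_smulₛₗ, mul_add] }
  have hr : ∀ g, r (σ g x) = ((2 * (l (σ g x)).re : ℝ) : ℂ) := fun g => by
    change l (σ g x) + starRingEnd ℂ (l (J (σ g x))) = _
    rw [hJ, hx, Complex.add_conj]
  refine ⟨averageForm σ r r, fun h0 => ?_, averageForm_invariant hσ.toIsRep r r, fun u v => ?_⟩
  · have h1 : averageForm σ r r x x = 0 := by rw [h0]; rfl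
    rw [averageForm_apply] at h1
    simp only [hr] at h1
    have h2 : ∑ g : Q, (2 * (l (σ g x)).re) * (2 * (l (σ g x)).re) = 0 := by exact_mod_cast h1
    have h3 := (Finset.sum_eq_zero_iff_of_nonneg fun g _ => mul_self_nonneg _).1 h2 1
      (Finset.mem_univ _)
    rw [hσ.toIsRep.one_apply, hl] at h3
    norm_num at h3
  · simp only [averageForm_apply, mul_comm]

theorem IsSimpleRep.sum_trace_sq_of_realStructure (hσ : IsSimpleRep (⊤ : Subgroup Q) σ)
    {J : U →ₛₗ[starRingEnd ℂ] U} (hJ : ∀ g u, J (σ g u) = σ g (J u)) (hJJ : ∀ u, J (J u) = u) :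
    ∑ g, LinearMap.trace ℂ U (σ (g * g)) = Nat.card Q := by
  obtain ⟨B, h0, hB, hsymm⟩ := hσ.exists_symmetric_form hJ hJJ
  have hnd := hσ.nondegenerate_of_invariant hB h0
  have := hσ.nontrivial
  let e := Module.finBasis ℂ U
  let f := B.dualBasis hnd e
  have hd : (Module.finrank ℂ U : ℂ) ≠ 0 := Nat.cast_ne_zero.2 Module.finrank_pos.ne'
  have hexp : ∀ x, ∑ j, B (f j) x • e j = x := fun x => by
    simp only [f, ← repr_eq_form hnd e]
    exact e.sum_repr x
  have h1 : ∀ g, LinearMap.trace ℂ U (σ (g * g)) =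
      ∑ i, ∑ j, B (f j) (σ g (e i)) * B (e j) (σ g⁻¹ (f i)) := fun g => by
    rw [trace_eq_sum_form hnd e]
    refine Finset.sum_congr rfl fun i _ => ?_
    rw [hσ.toIsRep.mul_apply (Subgroup.mem_top g) (Subgroup.mem_top g)]
    conv_lhs => rw [← hexp (σ g (e i))]
    simp only [map_sum, map_smul, smul_eq_mul]
    refine Finset.sum_congr rfl fun j _ => ?_
    rw [hsymm (B.dualBasis hnd e i) (σ g (e j)), ← hB g (e j) (σ g⁻¹ (f i)),
      hσ.toIsRep.self_inv_apply (Subgroup.mem_top g)]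
  refine mul_left_cancel₀ hd ?_
  simp only [h1]
  rw [Finset.sum_comm, Finset.mul_sum]
  have h2 : ∀ i, Module.finrank ℂ U * ∑ g, ∑ j, B (f j) (σ g (e i)) * B (e j) (σ g⁻¹ (f i)) =
      (Nat.card Q : ℂ) := fun i => by
    rw [Finset.sum_comm, Finset.mul_sum]
    simp only [hσ.sum_form_mul_form]
    rw [← Finset.mul_sum]
    have h3 : ∑ j, B (e j) (e i) * B (f j) (f i) = 1 := by
      have h4 : B (∑ j, B (f j) (f i) • e j) (e i) = 1 := by
        rw [hexp, LinearMap.BilinForm.apply_dualBasis_left, if_pos rfl]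
      rw [← h4]
      simp [LinearMap.sum_apply, mul_comm]
    rw [h3, mul_one]
  simp only [h2]
  simp [mul_comm]

end InvariantForms

section RegularCharacter

variable {Q : Type} [Group Q] [Fintype Q]

theorem IsRep.sum_smul_commute {U : Type} [AddCommGroup U] [Module ℂ U] {σ : Q → Module.End ℂ U}
    (hσ : IsRep (⊤ : Subgroup Q) σ) {f : Q → ℂ} (hf : ∀ g h, f (h * g * h⁻¹) = f g)
    (h : Q) (u : U) :
    (∑ g, f g • σ g) (σ h u) = σ h ((∑ g, f g • σ g) u) := by
  simp only [LinearMap.sum_apply, LinearMap.smul_apply, map_sum, map_smul]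
  refine Fintype.sum_equiv (MulAut.conj h⁻¹).toEquiv _ _ fun g => ?_
  have e := fun a b u => hσ.mul_apply (Subgroup.mem_top a) (Subgroup.mem_top b) u
  simp only [MulEquiv.toEquiv_eq_coe, EquivLike.coe_coe, MulAut.conj_apply, ← e]
  rw [hf]
  congr 3
  group

theorem IsSimpleRep.sum_smul_eq_zero {U : Type} [AddCommGroup U] [Module ℂ U]
    [FiniteDimensional ℂ U] {σ : Q → Module.End ℂ U} (hσ : IsSimpleRep (⊤ : Subgroup Q) σ)
    {f : Q → ℂ} (hf : ∀ g h, f (h * g * h⁻¹) = f g)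
    (h0 : ∑ g, f g * LinearMap.trace ℂ U (σ g) = 0) : ∑ g, f g • σ g = 0 := by
  have := hσ.nontrivial
  obtain ⟨c, hc⟩ := hσ.eq_smul_of_commute (∑ g, f g • σ g) fun h _ u =>
    hσ.toIsRep.sum_smul_commute hf h u
  have hc' : ∑ g, f g • σ g = c • 1 := LinearMap.ext hc
  have h1 := congrArg (LinearMap.trace ℂ U) hc'
  simp only [map_sum, map_smul, smul_eq_mul, h0, LinearMap.trace_one] at h1
  have hd : (Module.finrank ℂ U : ℂ) ≠ 0 := Nat.cast_ne_zero.2 Module.finrank_pos.ne'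
  rw [hc', (mul_eq_zero.1 h1.symm).resolve_right hd, zero_smul]

/-- A class function orthogonal to all irreducible characters vanishes. -/
theorem classFunction_eq_zero {f : Q → ℂ} (hf : ∀ g h, f (h * g * h⁻¹) = f g)
    (h0 : ∀ (U : Type) [AddCommGroup U] [Module ℂ U] [FiniteDimensional ℂ U]
      (σ : Q → Module.End ℂ U), IsSimpleRep (⊤ : Subgroup Q) σ →
        ∑ g, f g * LinearMap.trace ℂ U (σ g) = 0) : f = 0 := by
  let ρ : Q → Module.End ℂ (Q → ℂ) := fun g => LinearMap.funLeft ℂ ℂ (· * g)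
  have hρ : IsRep (⊤ : Subgroup Q) ρ := by
    constructor
    · ext
      simp [ρ, LinearMap.funLeft]
    · intro g _ h _
      refine LinearMap.ext fun u => funext fun x => ?_
      simp [ρ, LinearMap.funLeft_apply, Module.End.mul_apply, mul_assoc]
  let T := ∑ g, f g • ρ g
  have hT : ∀ h u, T (ρ h u) = ρ h (T u) := hρ.sum_smul_commute hf
  have hker : LinearMap.ker T = ⊤ := by
    obtain ⟨C, hC, hinv⟩ := hρ.exists_stable_isCompl (W := LinearMap.ker T) fun g _ u hu => by
      rw [LinearMap.mem_ker] at hu ⊢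
      rw [hT, hu, map_zero]
    by_cases hC0 : C = ⊥
    · rw [hC0] at hC
      exact eq_top_of_isCompl_bot hC
    obtain ⟨W, hWC, hW0, hWst, hW⟩ := exists_simple_sub hρ hC0 hinv
    have hz := hW.sum_smul_eq_zero hf (h0 _ _ hW)
    refine absurd ?_ hW0
    refine le_bot_iff.1 fun w hw => hC.disjoint.le_bot ⟨?_, hWC hw⟩
    have h1 := congrArg (fun t : Module.End ℂ W => (t ⟨w, hw⟩ : Q → ℂ)) hz
    refine LinearMap.mem_ker.2 ?_
    have h2 := fun g => compressRep_apply (hWst g (Subgroup.mem_top g)) ⟨w, hw⟩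
    simpa [T, LinearMap.sum_apply, h2] using h1
  funext g
  have h1 : T (Pi.single 1 1) g⁻¹ = 0 := by
    rw [LinearMap.ker_eq_top.1 hker]
    rfl
  simpa [T, ρ, LinearMap.funLeft_apply, LinearMap.sum_apply, Pi.single_apply,
    inv_mul_eq_one] using h1

variable {κ : Type} [Fintype κ] {S : κ → FDRep ℂ Q}

/-- The regular character, expressed through a complete set of irreducible representations. -/
theorem sum_finrank_mul_character (hS : ∀ i, Simple (S i))
    (hdist : ∀ i j : κ, Nonempty (S i ≅ S j) → i = j)
    (hcomplete : ∀ ρ : FDRep ℂ Q, Simple ρ → ∃ i, Nonempty (ρ ≅ S i)) (g : Q) :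
    ∑ j, (Module.finrank ℂ (S j) : ℂ) * (S j).character g =
      if g = 1 then (Nat.card Q : ℂ) else 0 := by
  have hQ : (Nat.card Q : ℂ) ≠ 0 := Nat.cast_ne_zero.2 Nat.card_pos.ne'
  let f : Q → ℂ := fun g => (if g = 1 then (Nat.card Q : ℂ) else 0) -
    ∑ j, (Module.finrank ℂ (S j) : ℂ) * (S j).character g⁻¹
  have hf : f = 0 := by
    refine classFunction_eq_zero (fun g h => ?_) fun U _ _ _ σ hσ => ?_
    · have h1 : (h * g * h⁻¹ = 1) ↔ g = 1 := conj_eq_one_iff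
      have h2 : ∀ j, (S j).character (h * g * h⁻¹)⁻¹ = (S j).character g⁻¹ := fun j => by
        rw [← FDRep.char_conj (S j) g⁻¹ h]
        congr 1
        group
      simp only [f, h1, h2]
    · let ρ : Representation ℂ Q U :=
        { toFun := σ
          map_one' := hσ.one
          map_mul' := fun g h => hσ.mul g (Subgroup.mem_top g) h (Subgroup.mem_top h) }
      obtain ⟨j, ⟨i⟩⟩ := hcomplete (FDRep.of ρ) (simple_of_isSimpleRep hσ)
      have htr : ∀ g, LinearMap.trace ℂ U (σ g) = (S j).character g := fun g =>
        congrFun (FDRep.char_iso i) g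
      let _ : Invertible (Nat.card Q : ℂ) := invertibleOfNonzero hQ
      have horth : ∀ i, ∑ g, (S i).character g⁻¹ * (S j).character g =
          if i = j then (Nat.card Q : ℂ) else 0 := fun i => by
        have h1 := FDRep.char_orthonormal (S j) (S i)
        rw [inv_mul_eq_iff_eq_mul₀ hQ] at h1
        simp only [mul_comm ((S i).character _)]
        rw [h1]
        by_cases hij : i = j
        · subst hij
          rw [if_pos ⟨Iso.refl _⟩, if_pos rfl, mul_one]
        · rw [if_neg fun h => hij (hdist _ _ h).symm, if_neg hij, mul_zero]
      simp only [htr, f, sub_mul, Finset.sum_sub_distrib, Finset.sum_mul]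
      rw [Finset.sum_comm]
      simp only [mul_assoc, ← Finset.mul_sum, horth]
      simp [FDRep.char_one, mul_comm]
  have h1 := congrFun hf g⁻¹
  simp only [f, inv_eq_one, Pi.zero_apply, _root_.inv_inv] at h1
  exact (sub_eq_zero.1 h1).symm

/-- The degrees of the irreducible representations with real character add up to the number of
square roots of `1`, provided that all these representations can be realized over the reals. -/
theorem sum_finrank_of_realStructure (hS : ∀ i, Simple (S i))
    (hdist : ∀ i j : κ, Nonempty (S i ≅ S j) → i = j)
    (hcomplete : ∀ ρ : FDRep ℂ Q, Simple ρ → ∃ i, Nonempty (ρ ≅ S i))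
    (hreal : ∀ j, IsRealValued (S j).character →
      ∃ J : S j →ₛₗ[starRingEnd ℂ] S j, (∀ g u, J ((S j).ρ g u) = (S j).ρ g (J u)) ∧
        ∀ u, J (J u) = u) :
    ∑ j ∈ Finset.univ.filter (fun j => IsRealValued (S j).character),
      (Module.finrank ℂ (S j) : ℝ) = Nat.card {g : Q // g * g = 1} := by
  have hQ : (Nat.card Q : ℂ) ≠ 0 := Nat.cast_ne_zero.2 Nat.card_pos.ne'
  have hind : ∀ j, ∑ g, (S j).character (g * g) =
      if IsRealValued (S j).character then (Nat.card Q : ℂ) else 0 := fun j => by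
    have := hS j
    split_ifs with h
    · obtain ⟨J, hJ, hJJ⟩ := hreal j h
      exact (isSimpleRep_of_simple (S j)).sum_trace_sq_of_realStructure hJ hJJ
    · exact (isSimpleRep_of_simple (S j)).sum_trace_sq_of_not_real h
  have h1 : ∑ g : Q, ∑ j, (Module.finrank ℂ (S j) : ℂ) * (S j).character (g * g) =
      Nat.card Q * Nat.card {g : Q // g * g = 1} := by
    simp only [sum_finrank_mul_character hS hdist hcomplete]
    rw [← Finset.sum_filter, Finset.sum_const, Nat.card_eq_fintype_card (α := {g : Q // g * g = 1}),
      Fintype.card_subtype, nsmul_eq_mul, mul_comm]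
  rw [Finset.sum_comm] at h1
  simp only [← Finset.mul_sum, hind, mul_ite, mul_zero] at h1
  rw [← Finset.sum_filter, ← Finset.sum_mul, mul_comm] at h1
  have h2 := mul_left_cancel₀ hQ h1
  exact_mod_cast h2

end RegularCharacter

section Numerics

theorem gbinom_zero_right (m : ℕ) (Q : ℝ) : gbinom m 0 Q = 1 := by simp [gbinom]

theorem gbinom_succ_succ {Q : ℝ} (hQ : 1 < Q) (m k : ℕ) :
    gbinom (m + 1) (k + 1) Q * (Q ^ (k + 1) - 1) = (Q ^ (m - k + (k + 1)) - 1) * gbinom m k Q := by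
  have h0 : Q ^ (k + 1) - 1 ≠ 0 := (sub_pos.2 (one_lt_pow₀ hQ k.succ_ne_zero)).ne'
  rw [gbinom, Finset.prod_Icc_succ_top (by lia), Nat.add_sub_add_right, ← gbinom.eq_1, mul_assoc,
    div_mul_cancel₀ _ h0, mul_comm]

/-- The number of idempotent matrices of rank `k` and size `m` over the field with `q ^ 2`
elements. -/
def idempotentCount (q m k : ℕ) : ℝ := (q : ℝ) ^ (2 * k * (m - k)) * gbinom m k ((q : ℝ) ^ 2)

theorem idempotentCount_zero_right (q m : ℕ) : idempotentCount q m 0 = 1 := by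
  simp [idempotentCount, gbinom_zero_right]

theorem idempotentCount_succ_succ {q : ℕ} (hq : 1 < q) {m k : ℕ} (hk : k ≤ m) :
    idempotentCount q (m + 1) (k + 1) * ((q : ℝ) ^ (2 * k) * ((q : ℝ) ^ (2 * (k + 1)) - 1)) =
      (q : ℝ) ^ (2 * m) * ((q : ℝ) ^ (2 * (m + 1)) - 1) * idempotentCount q m k := by
  have hQ : (1 : ℝ) < (q : ℝ) ^ 2 := one_lt_pow₀ (by exact_mod_cast hq) two_ne_zero
  have h := gbinom_succ_succ hQ m k
  obtain ⟨l, rfl⟩ := Nat.exists_eq_add_of_le hk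
  simp only [idempotentCount, Nat.add_sub_add_right, Nat.add_sub_cancel_left] at h ⊢
  have e1 : l + (k + 1) = k + l + 1 := by ring
  rw [e1] at h
  simp only [pow_mul (q : ℝ) 2] at h ⊢
  rw [mul_assoc, show ∀ a b c d : ℝ, a * (b * (c * d)) = a * c * (b * d) by intros; ring, h]
  simp only [← pow_mul, mul_assoc]
  ring

end Numerics

section InvolutionOfIsCompl

variable {K V : Type} [Field K] [AddCommGroup V] [Module K V] {p r : Submodule K V}

/-- The involution acting as `-1` on the first and as `1` on the second of two complementary
subspaces. -/
def involutionOfIsCompl (h : IsCompl p r) : Module.End K V :=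
  LinearMap.ofIsCompl h (-p.subtype) r.subtype

theorem involutionOfIsCompl_left (h : IsCompl p r) {x : V} (hx : x ∈ p) :
    involutionOfIsCompl h x = -x :=
  LinearMap.ofIsCompl_apply_left h ⟨x, hx⟩

theorem involutionOfIsCompl_right (h : IsCompl p r) {x : V} (hx : x ∈ r) :
    involutionOfIsCompl h x = x :=
  LinearMap.ofIsCompl_apply_right h ⟨x, hx⟩

theorem exists_add_eq_of_isCompl (h : IsCompl p r) (x : V) : ∃ y ∈ p, ∃ z ∈ r, y + z = x :=
  Submodule.mem_sup.1 (h.sup_eq_top ▸ Submodule.mem_top)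

theorem involutionOfIsCompl_mul_self (h : IsCompl p r) :
    involutionOfIsCompl h * involutionOfIsCompl h = 1 := by
  refine LinearMap.ext fun x => ?_
  obtain ⟨y, hy, z, hz, rfl⟩ := exists_add_eq_of_isCompl h x
  simp [Module.End.mul_apply, involutionOfIsCompl_left h hy, involutionOfIsCompl_right h hz]

theorem involutionOfIsCompl_eq_neg_iff (h2 : (2 : K) ≠ 0) (h : IsCompl p r) {x : V} :
    involutionOfIsCompl h x = -x ↔ x ∈ p := by
  refine ⟨fun hx => ?_, involutionOfIsCompl_left h⟩
  obtain ⟨y, hy, z, hz, rfl⟩ := exists_add_eq_of_isCompl h x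
  rw [map_add, involutionOfIsCompl_left h hy, involutionOfIsCompl_right h hz, neg_add] at hx
  have hz2 : (2 : K) • z = 0 := by
    rw [two_smul]
    nth_rw 1 [add_left_cancel hx]
    rw [neg_add_cancel]
  rw [(smul_eq_zero.1 hz2).resolve_left h2, add_zero]
  exact hy

theorem involutionOfIsCompl_eq_self_iff (h2 : (2 : K) ≠ 0) (h : IsCompl p r) {x : V} :
    involutionOfIsCompl h x = x ↔ x ∈ r := by
  refine ⟨fun hx => ?_, involutionOfIsCompl_right h⟩
  obtain ⟨y, hy, z, hz, rfl⟩ := exists_add_eq_of_isCompl h x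
  rw [map_add, involutionOfIsCompl_left h hy, involutionOfIsCompl_right h hz] at hx
  have hy2 : (2 : K) • y = 0 := by
    rw [two_smul]
    nth_rw 1 [← add_right_cancel hx]
    rw [neg_add_cancel]
  rw [(smul_eq_zero.1 hy2).resolve_left h2, zero_add]
  exact hz

theorem isCompl_ker_of_mul_self_eq_one (h2 : (2 : K) ≠ 0) {T : Module.End K V} (hT : T * T = 1) :
    IsCompl (LinearMap.ker (T + 1)) (LinearMap.ker (T - 1)) := by
  have hTT : ∀ x, T (T x) = x := fun x => LinearMap.congr_fun hT x
  refine ⟨Submodule.disjoint_def.2 fun x hx hx' => ?_,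
    codisjoint_iff.2 (eq_top_iff.2 fun x _ => ?_)⟩
  · have h3 : T x + x = 0 := hx
    have h4 : T x - x = 0 := hx'
    have h5 : (2 : K) • x = 0 := by
      rw [two_smul]
      nth_rw 1 [← sub_eq_zero.1 h4]
      exact h3
    exact (smul_eq_zero.1 h5).resolve_left h2
  · refine Submodule.mem_sup.2 ⟨(2 : K)⁻¹ • (x - T x), ?_, (2 : K)⁻¹ • (x + T x), ?_, ?_⟩
    · refine Submodule.smul_mem _ _ (LinearMap.mem_ker.2 ?_)
      simp [hTT]
    · refine Submodule.smul_mem _ _ (LinearMap.mem_ker.2 ?_)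
      simp [hTT, add_comm]
    · rw [← smul_add, sub_add_add_cancel, ← two_smul K x, smul_smul, inv_mul_cancel₀ h2, one_smul]

theorem involutionOfIsCompl_ker (h2 : (2 : K) ≠ 0) {T : Module.End K V} (hT : T * T = 1) :
    involutionOfIsCompl (isCompl_ker_of_mul_self_eq_one h2 hT) = T := by
  refine LinearMap.ext fun x => ?_
  obtain ⟨y, hy, z, hz, rfl⟩ :=
    exists_add_eq_of_isCompl (isCompl_ker_of_mul_self_eq_one h2 hT) x
  rw [map_add, map_add, involutionOfIsCompl_left _ hy, involutionOfIsCompl_right _ hz,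
    eq_neg_of_add_eq_zero_left (show T y + y = 0 from hy), sub_eq_zero.1 (show T z - z = 0 from hz)]

theorem det_involutionOfIsCompl [FiniteDimensional K V] (h : IsCompl p r) :
    LinearMap.det (involutionOfIsCompl h) = (-1) ^ Module.finrank K p := by
  have h1 : involutionOfIsCompl h = (Submodule.prodEquivOfIsCompl p r h).toLinearMap ∘ₗ
      (LinearMap.prodMap (-1 : Module.End K p) (1 : Module.End K r)) ∘ₗ
        (Submodule.prodEquivOfIsCompl p r h).symm.toLinearMap := by
    refine LinearMap.ext fun x => ?_
    obtain ⟨y, rfl⟩ := (Submodule.prodEquivOfIsCompl p r h).surjective x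
    simp [involutionOfIsCompl_left h y.1.2, involutionOfIsCompl_right h y.2.2]
  rw [h1, LinearMap.det_conj, LinearMap.det_prodMap, map_one, mul_one, ← neg_one_smul K,
    LinearMap.det_smul, map_one, mul_one]

/-- Involutive endomorphisms correspond to decompositions into two complementary subspaces. -/
def involutionEquivIsCompl (h2 : (2 : K) ≠ 0) :
    {P : Submodule K V × Submodule K V // IsCompl P.1 P.2} ≃ {T : Module.End K V // T * T = 1} where
  toFun P := ⟨involutionOfIsCompl P.2, involutionOfIsCompl_mul_self P.2⟩
  invFun T := ⟨(LinearMap.ker (T.1 + 1), LinearMap.ker (T.1 - 1)),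
    isCompl_ker_of_mul_self_eq_one h2 T.2⟩
  left_inv P := by
    refine Subtype.ext (Prod.ext (Submodule.ext fun x => ?_) (Submodule.ext fun x => ?_))
    · rw [← involutionOfIsCompl_eq_neg_iff h2 P.2]
      exact LinearMap.mem_ker.trans add_eq_zero_iff_eq_neg
    · rw [← involutionOfIsCompl_eq_self_iff h2 P.2]
      exact LinearMap.mem_ker.trans sub_eq_zero
  right_inv T := Subtype.ext (involutionOfIsCompl_ker h2 T.2)

end InvolutionOfIsCompl

section ComplementaryPairs

variable {K : Type} [Field K]

/-- The order of the general linear group of degree `n`. -/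
def cardGL (K : Type) [Field K] (n : ℕ) : ℕ := Nat.card (GL (Fin n) K)

variable {V W : Type} [AddCommGroup V] [Module K V] [FiniteDimensional K V] [AddCommGroup W]
  [Module K W] [FiniteDimensional K W]

theorem card_linearEquiv {n : ℕ} (hV : Module.finrank K V = n) (hW : Module.finrank K W = n) :
    Nat.card (V ≃ₗ[K] W) = cardGL K n := by
  let e : V ≃ₗ[K] (Fin n → K) := LinearEquiv.ofFinrankEq _ _ (by simp [hV])
  let f : (Fin n → K) ≃ₗ[K] W := LinearEquiv.ofFinrankEq _ _ (by simp [hW])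
  refine (Nat.card_congr ?_).symm
  exact (Matrix.GeneralLinearGroup.toLin.toEquiv.trans
    (LinearMap.GeneralLinearGroup.generalLinearEquiv K (Fin n → K)).toEquiv).trans
    { toFun := fun g => (e.trans g).trans f
      invFun := fun g => (e.symm.trans g).trans f.symm
      left_inv := fun g => by ext; simp
      right_inv := fun g => by ext; simp }

variable [Fintype K]

theorem cardGL_succ (n : ℕ) :
    (cardGL K (n + 1) : ℝ) =
      (Fintype.card K : ℝ) ^ n * ((Fintype.card K : ℝ) ^ (n + 1) - 1) * cardGL K n := by
  have h1 : ∀ n, (cardGL K n : ℝ) =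
      ∏ i : Fin n, ((Fintype.card K : ℝ) ^ n - (Fintype.card K : ℝ) ^ (i : ℕ)) := fun n => by
    rw [cardGL, Matrix.card_GL_field, Nat.cast_prod]
    refine Finset.prod_congr rfl fun i _ => ?_
    rw [Nat.cast_sub (Nat.pow_le_pow_right Fintype.card_pos i.2.le)]
    push_cast
    rfl
  rw [h1, h1, Fin.prod_univ_succ]
  simp only [Fin.val_zero, pow_zero, Fin.val_succ, pow_succ' _ _, ← mul_sub,
    Finset.prod_mul_distrib, Finset.prod_const, Finset.card_univ, Fintype.card_fin]
  ring

theorem cardGL_pos (n : ℕ) : 0 < cardGL K n := Nat.card_pos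

end ComplementaryPairs

section CountingComplements

variable {K V : Type} [Field K] [AddCommGroup V] [Module K V]

/-- An isomorphism from a product yields two complementary subspaces with bases, and conversely. -/
theorem bijective_prodEquiv {A B : Type} [AddCommGroup A] [Module K A] [AddCommGroup B]
    [Module K B] :
    Function.Bijective fun t : Σ P : {P : Submodule K V × Submodule K V // IsCompl P.1 P.2},
      (A ≃ₗ[K] P.1.1) × (B ≃ₗ[K] P.1.2) =>
        (t.2.1.prodCongr t.2.2).trans (Submodule.prodEquivOfIsCompl _ _ t.1.2) := by
  constructor
  · rintro ⟨⟨⟨p, r⟩, h⟩, a, b⟩ ⟨⟨⟨p', r'⟩, h'⟩, a', b'⟩ heq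
    have ha : ∀ x, (a x : V) = a' x := fun x => by
      simpa using LinearEquiv.congr_fun heq (x, 0)
    have hb : ∀ x, (b x : V) = b' x := fun x => by
      simpa using LinearEquiv.congr_fun heq (0, x)
    have hp : p = p' := by
      ext x
      refine ⟨fun hx => ?_, fun hx => ?_⟩
      · rw [show x = a' (a.symm ⟨x, hx⟩) by rw [← ha, a.apply_symm_apply]]
        exact Subtype.prop _
      · rw [show x = a (a'.symm ⟨x, hx⟩) by rw [ha, a'.apply_symm_apply]]
        exact Subtype.prop _
    have hr : r = r' := by
      ext x
      refine ⟨fun hx => ?_, fun hx => ?_⟩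
      · rw [show x = b' (b.symm ⟨x, hx⟩) by rw [← hb, b.apply_symm_apply]]
        exact Subtype.prop _
      · rw [show x = b (b'.symm ⟨x, hx⟩) by rw [hb, b'.apply_symm_apply]]
        exact Subtype.prop _
    subst hp hr
    rw [show a = a' from LinearEquiv.ext fun x => Subtype.ext (ha x),
      show b = b' from LinearEquiv.ext fun x => Subtype.ext (hb x)]
  · intro e
    have h : IsCompl (LinearMap.range (e.toLinearMap ∘ₗ LinearMap.inl K A B))
        (LinearMap.range (e.toLinearMap ∘ₗ LinearMap.inr K A B)) := by
      rw [LinearMap.range_comp, LinearMap.range_comp]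
      exact (Submodule.orderIsoMapComap e).isCompl LinearMap.isCompl_range_inl_inr
    refine ⟨⟨⟨(_, _), h⟩, LinearEquiv.ofInjective _ (e.injective.comp LinearMap.inl_injective),
      LinearEquiv.ofInjective _ (e.injective.comp LinearMap.inr_injective)⟩, ?_⟩
    refine LinearEquiv.ext fun x => ?_
    change e (x.1, 0) + e (0, x.2) = e x
    simp [← map_add]

variable [FiniteDimensional K V] [Fintype K]

theorem card_isCompl_mul {m k : ℕ} (hV : Module.finrank K V = m) (hk : k ≤ m) :
    Nat.card {P : {P : Submodule K V × Submodule K V // IsCompl P.1 P.2} //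
      Module.finrank K P.1.1 = k} * (cardGL K k * cardGL K (m - k)) = cardGL K m := by
  have : Finite V := Module.finite_of_finite K
  have : Finite (Submodule K V) := Finite.of_injective _ SetLike.coe_injective
  let _ : Fintype {P : Submodule K V × Submodule K V // IsCompl P.1 P.2} := Fintype.ofFinite _
  have h1 := Nat.card_congr (Equiv.ofBijective _
    (bijective_prodEquiv (K := K) (V := V) (A := Fin k → K) (B := Fin (m - k) → K)))
  have h2 : ∀ P : {P : Submodule K V × Submodule K V // IsCompl P.1 P.2},
      Nat.card (((Fin k → K) ≃ₗ[K] P.1.1) × ((Fin (m - k) → K) ≃ₗ[K] P.1.2)) =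
        if Module.finrank K P.1.1 = k then cardGL K k * cardGL K (m - k) else 0 := fun P => by
    split_ifs with hP
    · have h3 := Submodule.finrank_add_eq_of_isCompl P.2
      rw [Nat.card_prod, card_linearEquiv (by simp) hP,
        card_linearEquiv (n := m - k) (by simp) (by lia)]
    · have : IsEmpty ((Fin k → K) ≃ₗ[K] P.1.1) := ⟨fun e => hP (by simpa using e.finrank_eq.symm)⟩
      exact Nat.card_of_isEmpty
  have hfin : ∀ P : {P : Submodule K V × Submodule K V // IsCompl P.1 P.2},
      Finite (((Fin k → K) ≃ₗ[K] P.1.1) × ((Fin (m - k) → K) ≃ₗ[K] P.1.2)) := fun P => by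
    have := DFunLike.finite ((Fin k → K) ≃ₗ[K] P.1.1)
    have := DFunLike.finite ((Fin (m - k) → K) ≃ₗ[K] P.1.2)
    infer_instance
  rw [card_linearEquiv (by simp; lia) hV, Nat.card_sigma] at h1
  simp only [h2] at h1
  rw [← h1, ← Finset.sum_filter, Finset.sum_const, smul_eq_mul, Nat.card_eq_fintype_card,
    Fintype.card_subtype]

theorem cardGL_eq_idempotentCount_mul {q : ℕ} (hq : 1 < q) (hK : Fintype.card K = q ^ 2) {m k : ℕ}
    (hk : k ≤ m) :
    (cardGL K m : ℝ) = idempotentCount q m k * (cardGL K k * cardGL K (m - k)) := by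
  induction k generalizing m with
  | zero =>
    have h0 : (cardGL K 0 : ℝ) = 1 := by
      simp [cardGL]
    rw [idempotentCount_zero_right, h0, one_mul, one_mul, Nat.sub_zero]
  | succ k ih =>
    obtain ⟨m, rfl⟩ := Nat.exists_eq_succ_of_ne_zero (Nat.ne_zero_of_lt hk)
    have hkm : k ≤ m := Nat.succ_le_succ_iff.1 hk
    have h1 := idempotentCount_succ_succ hq hkm
    have h2 := ih hkm
    rw [Nat.succ_eq_add_one, Nat.add_sub_add_right, cardGL_succ, cardGL_succ, hK, h2]
    push_cast
    rw [← pow_mul, ← pow_mul, ← pow_mul, ← pow_mul]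
    linear_combination -(cardGL K k * cardGL K (m - k) : ℝ) * h1

theorem card_mul_self_eq_one {q m : ℕ} (hq : 1 < q) (hK : Fintype.card K = q ^ 2)
    (h2 : (2 : K) ≠ 0) :
    (Nat.card {g : GL (Fin m) K // g * g = 1} : ℝ) =
      ∑ k ∈ Finset.range (m + 1), idempotentCount q m k := by
  let e : {g : GL (Fin m) K // g * g = 1} ≃ {T : Module.End K (Fin m → K) // T * T = 1} :=
    { toFun := fun g => ⟨Matrix.toLin' (g.1 : Matrix (Fin m) (Fin m) K), by
        rw [Module.End.mul_eq_comp, ← Matrix.toLin'_mul, ← Units.val_mul, g.2]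
        exact Matrix.toLin'_one⟩
      invFun := fun T =>
        have h : LinearMap.toMatrix' T.1 * LinearMap.toMatrix' T.1 = 1 := by
          rw [← LinearMap.toMatrix'_mul, T.2, LinearMap.toMatrix'_one]
        ⟨⟨LinearMap.toMatrix' T.1, LinearMap.toMatrix' T.1, h, h⟩, Units.ext h⟩
      left_inv := fun g => by ext; simp
      right_inv := fun T => by ext; simp }
  have : Finite (Submodule K (Fin m → K)) := Finite.of_injective _ SetLike.coe_injective
  let _ : Fintype {P : Submodule K (Fin m → K) × Submodule K (Fin m → K) // IsCompl P.1 P.2} :=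
    Fintype.ofFinite _
  rw [Nat.card_congr (e.trans (involutionEquivIsCompl h2).symm), Nat.card_eq_fintype_card,
    ← Finset.card_univ, Finset.card_eq_sum_card_fiberwise (f := fun P => Module.finrank K P.1.1)
      (t := Finset.range (m + 1)) fun P _ => by
        simpa [Nat.lt_succ_iff] using Submodule.finrank_le P.1.1, Nat.cast_sum]
  refine Finset.sum_congr rfl fun k hk => ?_
  have hk' : k ≤ m := Nat.lt_succ_iff.1 (Finset.mem_range.1 hk)
  have h3 := card_isCompl_mul (K := K) (V := Fin m → K) (m := m) (by simp) hk'
  rw [Nat.card_eq_fintype_card, Fintype.card_subtype] at h3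
  have h4 := cardGL_eq_idempotentCount_mul hq hK hk'
  rw [← h3] at h4
  push_cast at h4
  refine mul_right_cancel₀ ?_ h4
  exact mul_ne_zero (Nat.cast_ne_zero.2 (cardGL_pos _).ne') (Nat.cast_ne_zero.2 (cardGL_pos _).ne')

end CountingComplements

section NondegenerateSubspaces

variable {K V : Type} [Field K] [AddCommGroup V] [Module K V]

/-- The radical of the restriction of the form `B` to the subspace `W` is trivial. -/
def HasTrivialRadical (B : LinearMap.BilinForm K V) (W : Submodule K V) : Prop :=
  ∀ x ∈ W, (∀ y ∈ W, B x y = 0) → x = 0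

variable {B : LinearMap.BilinForm K V} {P W : Submodule K V}

theorem hasTrivialRadical_bot : HasTrivialRadical B ⊥ := fun _ hx _ => (Submodule.mem_bot K).1 hx

theorem hasTrivialRadical_span_singleton {v : V} (hv : B v v ≠ 0) :
    HasTrivialRadical B (Submodule.span K {v}) := by
  intro x hx h
  obtain ⟨a, rfl⟩ := Submodule.mem_span_singleton.1 hx
  have h1 := h v (Submodule.mem_span_singleton_self v)
  rw [map_smul, LinearMap.smul_apply, smul_eq_mul] at h1
  rw [(mul_eq_zero.1 h1).resolve_right hv, zero_smul]

/-- The Gram determinant of two vectors. -/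
def gramDet (B : LinearMap.BilinForm K V) (v w : V) : K := B v v * B w w - B v w * B v w

theorem hasTrivialRadical_span_pair (hB : ∀ x y, B x y = B y x) {v w : V}
    (h : gramDet B v w ≠ 0) : HasTrivialRadical B (Submodule.span K {v, w}) := by
  intro x hx h0
  obtain ⟨a, b, rfl⟩ := Submodule.mem_span_pair.1 hx
  have h1 := h0 v (Submodule.subset_span (by simp))
  have h2 := h0 w (Submodule.subset_span (by simp))
  simp only [map_add, map_smul, LinearMap.add_apply, LinearMap.smul_apply, smul_eq_mul,
    hB w v] at h1 h2
  have ha : a * gramDet B v w = 0 := by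
    rw [gramDet]
    linear_combination B w w * h1 - B v w * h2
  have hb : b * gramDet B v w = 0 := by
    rw [gramDet]
    linear_combination B v v * h2 - B v w * h1
  rw [(mul_eq_zero.1 ha).resolve_right h, (mul_eq_zero.1 hb).resolve_right h]
  simp

variable [FiniteDimensional K V]

theorem HasTrivialRadical.isCompl_orthogonal (hB : ∀ x y, B x y = B y x)
    (hP : HasTrivialRadical B P) : IsCompl P (B.orthogonal P) := by
  refine (LinearMap.BilinForm.isCompl_orthogonal_iff_disjoint fun x y h => by rw [hB, h]).2 ?_
  exact Submodule.disjoint_def.2 fun x hx hx' => hP x hx fun y hy => by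
    rw [hB]
    exact hx' y hy

theorem HasTrivialRadical.sup_inf_orthogonal (hB : ∀ x y, B x y = B y x)
    (hP : HasTrivialRadical B P) (hPW : P ≤ W) : P ⊔ W ⊓ B.orthogonal P = W := by
  rw [inf_comm, ← sup_inf_assoc_of_le _ hPW, (hP.isCompl_orthogonal hB).sup_eq_top, top_inf_eq]

/-- A nondegenerate subspace splits off as an orthogonal direct summand. -/
def HasTrivialRadical.splitEquiv (hB : ∀ x y, B x y = B y x) (hP : HasTrivialRadical B P)
    (hPW : P ≤ W) : (P × (W ⊓ B.orthogonal P : Submodule K V)) ≃ₗ[K] W :=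
  LinearEquiv.ofBijective
    ((Submodule.inclusion hPW).coprod (Submodule.inclusion inf_le_left)) <| by
    constructor
    · refine LinearMap.ker_eq_bot.1 (LinearMap.ker_eq_bot'.2 fun x hx => ?_)
      have h1 : (x.1 : V) + x.2 = 0 := congrArg Subtype.val hx
      have h2 : (x.1 : V) = 0 :=
        Submodule.disjoint_def.1 (hP.isCompl_orthogonal hB).disjoint x.1 x.1.2 (by
          rw [eq_neg_of_add_eq_zero_left h1]
          exact neg_mem x.2.2.2)
      rw [h2, zero_add] at h1
      exact Prod.ext (Subtype.ext h2) (Subtype.ext h1)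
    · intro w
      have hw : (w : V) ∈ P ⊔ W ⊓ B.orthogonal P := by
        rw [hP.sup_inf_orthogonal hB hPW]
        exact w.2
      obtain ⟨y, hy, z, hz, h⟩ := Submodule.mem_sup.1 hw
      exact ⟨(⟨y, hy⟩, ⟨z, hz⟩), Subtype.ext h⟩

theorem HasTrivialRadical.splitEquiv_apply (hB : ∀ x y, B x y = B y x)
    (hP : HasTrivialRadical B P) (hPW : P ≤ W)
    (x : P × (W ⊓ B.orthogonal P : Submodule K V)) :
    (hP.splitEquiv hB hPW x : V) = x.1 + x.2 := rfl

theorem HasTrivialRadical.finrank_add (hB : ∀ x y, B x y = B y x) (hP : HasTrivialRadical B P)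
    (hPW : P ≤ W) :
    Module.finrank K P + Module.finrank K (W ⊓ B.orthogonal P : Submodule K V) =
      Module.finrank K W := by
  rw [← (hP.splitEquiv hB hPW).finrank_eq, Module.finrank_prod]

theorem HasTrivialRadical.inf_orthogonal_iff (hB : ∀ x y, B x y = B y x)
    (hP : HasTrivialRadical B P) (hPW : P ≤ W) :
    HasTrivialRadical B (W ⊓ B.orthogonal P) ↔ HasTrivialRadical B W := by
  have hsup : ∀ w ∈ W, ∃ y ∈ P, ∃ z ∈ W ⊓ B.orthogonal P, y + z = w := fun w hw =>
    Submodule.mem_sup.1 (by rwa [hP.sup_inf_orthogonal hB hPW])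
  constructor
  · intro h w hw h0
    obtain ⟨y, hy, z, hz, rfl⟩ := hsup w hw
    have hy0 : y = 0 := hP y hy fun x hx => by
      have h1 := h0 x (hPW hx)
      rwa [map_add, LinearMap.add_apply, hB z x, show B x z = 0 from hz.2 x hx, add_zero] at h1
    have hz0 : z = 0 := h z hz fun x hx => by
      have h1 := h0 x hx.1
      rwa [hy0, zero_add] at h1
    rw [hy0, hz0, add_zero]
  · intro h z hz h0
    refine h z hz.1 fun w hw => ?_
    obtain ⟨y, hy, x, hx, rfl⟩ := hsup w hw
    rw [map_add, h0 x hx, hB z y, show B y z = 0 from hz.2 y hy, add_zero]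

end NondegenerateSubspaces

section IsotropicVectors

theorem card_subtype_prod {α β : Type} [Fintype α] [Finite β] (r : α → β → Prop) :
    Nat.card {p : α × β // r p.1 p.2} = ∑ a, Nat.card {b // r a b} := by
  rw [← Nat.card_sigma]
  exact Nat.card_congr
    { toFun := fun p => ⟨p.1.1, p.1.2, p.2⟩
      invFun := fun p => ⟨(p.1, p.2.1), p.2.2⟩
      left_inv := fun _ => rfl
      right_inv := fun _ => rfl }

variable {K V : Type} [Field K] [AddCommGroup V] [Module K V] {B : LinearMap.BilinForm K V}
  {W : Submodule K V}

theorem mem_orthogonal_span_pair {v u x : V} :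
    x ∈ B.orthogonal (Submodule.span K {v, u}) ↔ B v x = 0 ∧ B u x = 0 := by
  refine ⟨fun h => ⟨h v (Submodule.subset_span (by simp)), h u (Submodule.subset_span (by simp))⟩,
    fun h y hy => ?_⟩
  obtain ⟨a, b, rfl⟩ := Submodule.mem_span_pair.1 hy
  change B _ x = 0
  simp [h.1, h.2]

theorem mem_orthogonal_span_singleton {v x : V} :
    x ∈ B.orthogonal (Submodule.span K {v}) ↔ B v x = 0 := by
  rw [← Set.pair_eq_singleton, mem_orthogonal_span_pair, and_self_iff]

theorem linearIndependent_of_gramDet_ne_zero {v w : V} (h : gramDet B v w ≠ 0) :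
    LinearIndependent K ![v, w] := by
  refine LinearIndependent.pair_iff.2 fun a b hab => ?_
  have h1 : B v (a • v + b • w) = 0 := by rw [hab, map_zero]
  have h2 : B (a • v + b • w) w = 0 := by rw [hab, map_zero, LinearMap.zero_apply]
  have h3 : B w (a • v + b • w) = 0 := by rw [hab, map_zero]
  have h4 : B (a • v + b • w) v = 0 := by rw [hab, map_zero, LinearMap.zero_apply]
  simp only [map_add, map_smul, LinearMap.add_apply, LinearMap.smul_apply, smul_eq_mul]
    at h1 h2 h3 h4
  have ha : a * gramDet B v w = 0 := by
    rw [gramDet]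
    linear_combination B w w * h1 - B v w * h2
  refine ⟨(mul_eq_zero.1 ha).resolve_right h, ?_⟩
  rw [(mul_eq_zero.1 ha).resolve_right h] at h1 h2
  by_contra hb
  apply h
  simp only [zero_mul, zero_add, mul_eq_zero, hb, false_or] at h1 h2
  rw [gramDet, h1, h2, mul_zero, mul_zero, sub_zero]

theorem finrank_span_pair_of_gramDet_ne_zero {v w : V} (h : gramDet B v w ≠ 0) :
    Module.finrank K (Submodule.span K {v, w}) = 2 := by
  have h1 := finrank_span_eq_card (linearIndependent_of_gramDet_ne_zero h)
  rwa [Matrix.range_cons_cons_empty, Fintype.card_fin] at h1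

theorem HasTrivialRadical.exists_hyperbolic (h2 : (2 : K) ≠ 0) (hB : ∀ x y, B x y = B y x)
    (hW : HasTrivialRadical B W) {v : V} (hv : v ∈ W) (hv0 : v ≠ 0) (hvv : B v v = 0) :
    ∃ u ∈ W, B u u = 0 ∧ B v u = 1 := by
  obtain ⟨y, hy, hvy⟩ : ∃ y ∈ W, B v y ≠ 0 := by
    by_contra! h
    exact hv0 (hW v hv h)
  refine ⟨(B v y)⁻¹ • y - (((B v y)⁻¹ * (B v y)⁻¹ * B y y) / 2) • v,
    sub_mem (W.smul_mem _ hy) (W.smul_mem _ hv), ?_, ?_⟩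
  · simp only [map_sub, map_smul, LinearMap.sub_apply, LinearMap.smul_apply, smul_eq_mul, hB y v,
      hvv]
    field_simp
    ring
  · simp only [map_sub, map_smul, smul_eq_mul, hvv, mul_zero, sub_zero, inv_mul_cancel₀ hvy]

/-- Coordinates with respect to a hyperbolic pair. -/
def hyperbolicEquiv (hB : ∀ x y, B x y = B y x) {v u : V} (hv : v ∈ W) (hu : u ∈ W)
    (hvv : B v v = 0) (huu : B u u = 0) (hvu : B v u = 1) :
    W ≃ (K × (W ⊓ B.orthogonal (Submodule.span K {v, u}) : Submodule K V)) × K where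
  toFun w := ((B w v, ⟨w - B w u • v - B w v • u,
    sub_mem (sub_mem w.2 (W.smul_mem _ hv)) (W.smul_mem _ hu),
    mem_orthogonal_span_pair.2 (by simp [hvv, huu, hvu, hB u v, hB (w : V) v, hB (w : V) u])⟩),
      B w u)
  invFun t := ⟨t.2 • v + t.1.1 • u + t.1.2,
    add_mem (add_mem (W.smul_mem _ hv) (W.smul_mem _ hu)) t.1.2.2.1⟩
  left_inv w := Subtype.ext (by simp)
  right_inv t := by
    obtain ⟨⟨b, x⟩, a⟩ := t
    obtain ⟨h1, h2⟩ := mem_orthogonal_span_pair.1 x.2.2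
    have e1 : B (a • v + b • u + x) v = b := by simp [hvv, hvu, hB u v, hB (x : V) v, h1]
    have e2 : B (a • v + b • u + x) u = a := by simp [huu, hvu, hB (x : V) u, h2]
    simp only [e1, e2, Prod.mk.injEq, and_true, true_and]
    refine Subtype.ext ?_
    change a • v + b • u + (x : V) - a • v - b • u = x
    abel

theorem hyperbolicEquiv_symm_apply_self (hB : ∀ x y, B x y = B y x) {v u : V} (hv : v ∈ W)
    (hu : u ∈ W) (hvv : B v v = 0) (huu : B u u = 0) (hvu : B v u = 1)
    (t : (K × (W ⊓ B.orthogonal (Submodule.span K {v, u}) : Submodule K V)) × K) :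
    B ((hyperbolicEquiv hB hv hu hvv huu hvu).symm t)
      ((hyperbolicEquiv hB hv hu hvv huu hvu).symm t)
      = 2 * (t.2 * t.1.1) + B t.1.2 t.1.2 := by
  obtain ⟨⟨b, x⟩, a⟩ := t
  obtain ⟨h1, h2⟩ := mem_orthogonal_span_pair.1 x.2.2
  change B (a • v + b • u + x) (a • v + b • u + x) = _
  simp only [map_add, map_smul, LinearMap.add_apply, LinearMap.smul_apply, smul_eq_mul,
    hB u v, hB (x : V) v, hB (x : V) u, h1, h2, hvv, huu, hvu]
  ring

variable [FiniteDimensional K V]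

theorem HasTrivialRadical.exists_isotropic [Fintype K] (hK : Fintype.card K % 2 = 1)
    (hB : ∀ x y, B x y = B y x) (hW : 3 ≤ Module.finrank K W) :
    ∃ v ∈ W, v ≠ 0 ∧ B v v = 0 := by
  by_contra! hne
  have step : ∀ U ≤ W, 0 < Module.finrank K U → ∃ u ∈ U, u ≠ 0 ∧ B u u ≠ 0 ∧
      Module.finrank K (U ⊓ B.orthogonal (Submodule.span K {u}) : Submodule K V) + 1 =
        Module.finrank K U := fun U hU h0 => by
    have := Module.finrank_pos_iff.1 h0
    obtain ⟨u, hu⟩ := exists_ne (0 : U)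
    have hu0 : (u : V) ≠ 0 := fun h => hu (Subtype.ext h)
    refine ⟨u, u.2, hu0, hne u (hU u.2) hu0, ?_⟩
    have h1 := (hasTrivialRadical_span_singleton (hne u (hU u.2) hu0)).finrank_add hB
      (W := U) (by simp)
    rwa [finrank_span_singleton hu0, add_comm] at h1
  obtain ⟨u₁, hu₁, -, h₁, hd₁⟩ := step W le_rfl (by lia)
  obtain ⟨u₂, hu₂, -, h₂, hd₂⟩ := step _ inf_le_left (by lia : 0 < Module.finrank K
    (W ⊓ B.orthogonal (Submodule.span K {u₁}) : Submodule K V))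
  obtain ⟨u₃, hu₃, hu0, h₃, -⟩ := step _ (inf_le_left.trans inf_le_left)
    (by lia : 0 < Module.finrank K (W ⊓ B.orthogonal (Submodule.span K {u₁}) ⊓
      B.orthogonal (Submodule.span K {u₂}) : Submodule K V))
  have h12 := mem_orthogonal_span_singleton.1 hu₂.2
  have h13 := mem_orthogonal_span_singleton.1 hu₃.1.2
  have h23 := mem_orthogonal_span_singleton.1 hu₃.2
  obtain ⟨a, b, hab⟩ := FiniteField.exists_root_sum_quadratic
    (f := Polynomial.C (B u₁ u₁) * Polynomial.X ^ 2 + Polynomial.C 0 * Polynomial.X +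
      Polynomial.C (B u₃ u₃))
    (g := Polynomial.C (B u₂ u₂) * Polynomial.X ^ 2 + Polynomial.C 0 * Polynomial.X +
      Polynomial.C 0) (Polynomial.degree_quadratic h₁) (Polynomial.degree_quadratic h₂) hK
  have hx : a • u₁ + b • u₂ + u₃ ≠ 0 := fun h0 => h₃ <| by
    have h1 : B (a • u₁ + b • u₂ + u₃) u₃ = 0 := by rw [h0, map_zero, LinearMap.zero_apply]
    simpa [h13, h23] using h1
  refine hne _ (add_mem (add_mem (W.smul_mem a hu₁) (W.smul_mem b hu₂.1)) hu₃.1.1) hx ?_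
  simp only [Polynomial.eval_add, Polynomial.eval_mul, Polynomial.eval_C, Polynomial.eval_pow,
    Polynomial.eval_X] at hab
  simp only [map_add, map_smul, LinearMap.add_apply, LinearMap.smul_apply, smul_eq_mul,
    hB u₂ u₁, hB u₃ u₁, hB u₃ u₂, h12, h13, h23]
  linear_combination hab

/-- The number of isotropic vectors of a nondegenerate quadratic space of odd dimension. -/
theorem HasTrivialRadical.card_isotropic [Fintype K] (hK : Fintype.card K % 2 = 1)
    (h2 : (2 : K) ≠ 0) (hB : ∀ x y, B x y = B y x) {j : ℕ} (hW : HasTrivialRadical B W)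
    (hj : Module.finrank K W = 2 * j + 1) :
    Nat.card {x : W // B x x = 0} = Fintype.card K ^ (2 * j) := by
  have hVfin : Finite V := Module.finite_of_finite K
  induction j generalizing W with
  | zero =>
    rw [mul_zero, pow_zero, Nat.card_eq_one_iff_unique]
    refine ⟨⟨fun x y => ?_⟩, ⟨0, by simp⟩⟩
    obtain ⟨u, hu, hspan⟩ := finrank_eq_one_iff'.1 hj
    have key : ∀ x : {x : W // B x x = 0}, x = ⟨0, by simp⟩ := fun x => by
      obtain ⟨c, hc⟩ := hspan x.1
      have h0 : x.1 = 0 := Subtype.ext <| hW x.1 x.1.2 fun y hy => by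
        obtain ⟨d, hd⟩ := hspan ⟨y, hy⟩
        have hxx := x.2
        have hd' : y = d • (u : V) := (congrArg Subtype.val hd).symm
        have hc' : (x.1 : V) = c • (u : V) := (congrArg Subtype.val hc).symm
        rw [hc'] at hxx
        rw [hc', hd']
        simp only [map_smul, LinearMap.smul_apply, smul_eq_mul] at hxx ⊢
        rcases mul_eq_zero.1 hxx with h | h
        · simp [h]
        · rcases mul_eq_zero.1 h with h | h <;> simp [h]
      exact Subtype.ext h0
    rw [key x, key y]
  | succ j ih =>
    obtain ⟨v, hv, hv0, hvv⟩ := exists_isotropic (W := W) hK hB (by lia)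
    obtain ⟨u, hu, huu, hvu⟩ := hW.exists_hyperbolic h2 hB hv hv0 hvv
    have hg : gramDet B v u ≠ 0 := by simp [gramDet, hvv, hvu]
    have hP := hasTrivialRadical_span_pair hB hg
    have hPW : Submodule.span K {v, u} ≤ W := Submodule.span_le.2 (Set.pair_subset hv hu)
    have hdim := hP.finrank_add hB hPW
    rw [finrank_span_pair_of_gramDet_ne_zero hg] at hdim
    have hd : Module.finrank K (W ⊓ B.orthogonal (Submodule.span K {v, u}) : Submodule K V) =
        2 * j + 1 := by lia
    have hz := ih ((hP.inf_orthogonal_iff hB hPW).2 hW) hd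
    let W' : Submodule K V := W ⊓ B.orthogonal (Submodule.span K {v, u})
    let _ : Fintype W' := Fintype.ofFinite _
    have hcard : Fintype.card W' = Fintype.card K ^ (2 * j + 1) := by
      rw [Module.card_eq_pow_finrank (K := K)]
      exact congrArg _ hd
    let e := hyperbolicEquiv hB hv hu hvv huu hvu
    rw [Nat.card_congr ((e.symm.subtypeEquiv (p := fun t => 2 * (t.2 * t.1.1) + B t.1.2 t.1.2 = 0)
      fun t => by rw [hyperbolicEquiv_symm_apply_self]).symm),
      card_subtype_prod (fun (s : K × W') (a : K) => 2 * (a * s.1) + B s.2 s.2 = 0),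
      Fintype.sum_prod_type, ← Finset.add_sum_erase _ _ (Finset.mem_univ (0 : K))]
    have h0 : ∑ x : W', Nat.card {a : K // 2 * (a * (0 : K)) + B x x = 0} =
        Fintype.card K * Fintype.card K ^ (2 * j) := by
      rw [← hz, Nat.card_eq_fintype_card (α := {x : W' // B x x = 0}), Fintype.card_subtype,
        Finset.card_filter, Finset.mul_sum]
      refine Finset.sum_congr rfl fun x _ => ?_
      by_cases hx : B (x : V) x = 0 <;> simp [hx]
    have h1 : ∀ b ∈ Finset.univ.erase (0 : K),
        ∑ x : W', Nat.card {a : K // 2 * (a * b) + B x x = 0} = Fintype.card K ^ (2 * j + 1) :=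
      fun b hb => by
        have hb0 : b ≠ 0 := Finset.ne_of_mem_erase hb
        rw [← hcard, Fintype.card_eq_sum_ones]
        refine Finset.sum_congr rfl fun x _ => Nat.card_eq_one_iff_unique.2 ⟨⟨fun s t => ?_⟩,
          ⟨-(B x x) / (2 * b), by field_simp; ring⟩⟩
        refine Subtype.ext (mul_right_cancel₀ hb0 (mul_left_cancel₀ h2 ?_))
        linear_combination s.2 - t.2
    rw [h0, Finset.sum_congr rfl h1, Finset.sum_const, Finset.card_erase_of_mem (Finset.mem_univ _),
      Finset.card_univ, smul_eq_mul]
    obtain ⟨c, hc⟩ := Nat.exists_eq_succ_of_ne_zero (Fintype.card_ne_zero (α := K))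
    rw [hc]
    simp only [Nat.succ_eq_add_one, Nat.add_sub_cancel]
    ring

end IsotropicVectors

section CountingNondegenerateSubspaces

variable {K V : Type} [Field K] [AddCommGroup V] [Module K V] {B : LinearMap.BilinForm K V}

theorem span_pair_eq_of_gramDet_ne_zero [FiniteDimensional K V] {P : Submodule K V}
    (hP : Module.finrank K P = 2) {v w : V} (hv : v ∈ P) (hw : w ∈ P) (h : gramDet B v w ≠ 0) :
    Submodule.span K {v, w} = P :=
  Submodule.eq_of_le_of_finrank_eq (Submodule.span_le.2 (Set.pair_subset hv hw))
    ((finrank_span_pair_of_gramDet_ne_zero h).trans hP.symm)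

/-- The number of nondegenerate subspaces of dimension `d` of `W`. -/
def nondegenerateCount (B : LinearMap.BilinForm K V) (W : Submodule K V) (d : ℕ) : ℕ :=
  Nat.card {U : Submodule K V // U ≤ W ∧ HasTrivialRadical B U ∧ Module.finrank K U = d}

variable [FiniteDimensional K V] {W : Submodule K V}

theorem HasTrivialRadical.bijective_sup (hB : ∀ x y, B x y = B y x) {P : Submodule K V}
    (hP : HasTrivialRadical B P) {n d : ℕ} (hn : Module.finrank K P = n) (hPW : P ≤ W) :
    Function.Bijective fun T : {T : Submodule K V // T ≤ W ⊓ B.orthogonal P ∧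
        HasTrivialRadical B T ∧ Module.finrank K T = d} =>
      (⟨P ⊔ T.1, by
        have h2 : (P ⊔ T.1) ⊓ B.orthogonal P = T.1 := by
          rw [sup_comm, sup_inf_assoc_of_le _ (T.2.1.trans inf_le_right),
            (hP.isCompl_orthogonal hB).inf_eq_bot, sup_bot_eq]
        refine ⟨⟨le_sup_left, sup_le hPW (T.2.1.trans inf_le_left)⟩, ?_, ?_⟩
        · rw [← hP.inf_orthogonal_iff hB le_sup_left, h2]
          exact T.2.2.1
        · rw [← hP.finrank_add hB le_sup_left, h2, hn, T.2.2.2]⟩ :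
      {U : Submodule K V // (P ≤ U ∧ U ≤ W) ∧ HasTrivialRadical B U ∧
        Module.finrank K U = n + d}) := by
  constructor
  · intro T T' h
    have key : ∀ T : Submodule K V, T ≤ W ⊓ B.orthogonal P → (P ⊔ T) ⊓ B.orthogonal P = T :=
      fun T hT => by
        rw [sup_comm, sup_inf_assoc_of_le _ (hT.trans inf_le_right),
          (hP.isCompl_orthogonal hB).inf_eq_bot, sup_bot_eq]
    refine Subtype.ext ?_
    rw [← key T.1 T.2.1, ← key T'.1 T'.2.1, show P ⊔ T.1 = P ⊔ T'.1 from congrArg Subtype.val h]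
  · rintro ⟨U, ⟨hPU, hUW⟩, hU, hd⟩
    refine ⟨⟨U ⊓ B.orthogonal P, inf_le_inf_right _ hUW, (hP.inf_orthogonal_iff hB hPU).2 hU, ?_⟩,
      Subtype.ext (hP.sup_inf_orthogonal hB hPU)⟩
    have := hP.finrank_add hB hPU
    lia

theorem card_gramDet_ne_zero_eq_card_sigma (hB : ∀ x y, B x y = B y x) :
    Nat.card (Σ P : {P : Submodule K V // P ≤ W ∧ HasTrivialRadical B P ∧
      Module.finrank K P = 2}, {p : P.1 × P.1 // gramDet B (p.1 : V) p.2 ≠ 0}) =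
    Nat.card {p : W × W // gramDet B (p.1 : V) p.2 ≠ 0} := by
  refine Nat.card_congr (Equiv.ofBijective (fun t => ⟨(⟨t.2.1.1, t.1.2.1 t.2.1.1.2⟩,
    ⟨t.2.1.2, t.1.2.1 t.2.1.2.2⟩), t.2.2⟩) ⟨?_, ?_⟩)
  · rintro ⟨⟨P, hP⟩, ⟨⟨v, w⟩, h⟩⟩ ⟨⟨P', hP'⟩, ⟨⟨v', w'⟩, h'⟩⟩ heq
    have hv : (v : V) = v' := congrArg (fun p => (p.1.1 : V)) heq
    have hw : (w : V) = w' := congrArg (fun p => (p.1.2 : V)) heq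
    have hPP : P = P' := by
      rw [← span_pair_eq_of_gramDet_ne_zero hP.2.2 v.2 w.2 h,
        ← span_pair_eq_of_gramDet_ne_zero hP'.2.2 v'.2 w'.2 h', hv, hw]
    subst hPP
    obtain rfl := Subtype.ext hv
    obtain rfl := Subtype.ext hw
    rfl
  · rintro ⟨⟨v, w⟩, h⟩
    refine ⟨⟨⟨Submodule.span K {(v : V), (w : V)}, Submodule.span_le.2 (Set.pair_subset v.2 w.2),
      hasTrivialRadical_span_pair hB h, finrank_span_pair_of_gramDet_ne_zero h⟩,
      ⟨(⟨v, Submodule.subset_span (by simp)⟩, ⟨w, Submodule.subset_span (by simp)⟩), h⟩⟩, rfl⟩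

variable [Fintype K]

theorem HasTrivialRadical.card_gramDet_eq_zero (hK : Fintype.card K % 2 = 1) (h2 : (2 : K) ≠ 0)
    (hB : ∀ x y, B x y = B y x) {m : ℕ} (hW : HasTrivialRadical B W)
    (hm : Module.finrank K W = 2 * (m + 1)) {v : V} (hv : v ∈ W) (hv0 : v ≠ 0) :
    Nat.card {w : W // gramDet B v w = 0} = Fintype.card K ^ (2 * m + 1) := by
  have hVfin : Finite V := Module.finite_of_finite K
  by_cases hvv : B v v = 0
  · let f : Module.Dual K W := (B v).domRestrict W
    have hf : f ≠ 0 := fun h => hv0 (hW v hv fun y hy => LinearMap.congr_fun h ⟨y, hy⟩)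
    have h1 := Module.Dual.finrank_ker_add_one_of_ne_zero hf
    rw [hm] at h1
    have h3 : Nat.card (LinearMap.ker f) = Fintype.card K ^ (2 * m + 1) := by
      rw [Module.natCard_eq_pow_finrank (K := K), Nat.card_eq_fintype_card]
      congr 1
      lia
    rw [← h3]
    refine Nat.card_congr (Equiv.subtypeEquivRight fun w => ?_)
    rw [gramDet, hvv, zero_mul, zero_sub, neg_eq_zero, mul_self_eq_zero]
    rfl
  · have hP := hasTrivialRadical_span_singleton hvv
    have hPW : Submodule.span K {v} ≤ W := by simpa using hv
    have hdim := hP.finrank_add hB hPW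
    rw [finrank_span_singleton hv0] at hdim
    have hz := ((hP.inf_orthogonal_iff hB hPW).2 hW).card_isotropic hK h2 hB (j := m) (by lia)
    let W' : Submodule K V := W ⊓ B.orthogonal (Submodule.span K {v})
    have h3 : ∀ t : Submodule.span K {v} × W', B (t.2 : V) t.2 = 0 ↔
        gramDet B v (hP.splitEquiv hB hPW t : W) = 0 := fun t => by
      obtain ⟨⟨y, hy⟩, x⟩ := t
      obtain ⟨a, rfl⟩ := Submodule.mem_span_singleton.1 hy
      have h4 := mem_orthogonal_span_singleton.1 x.2.2
      rw [hP.splitEquiv_apply, show gramDet B v (a • v + x) = B v v * B x x by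
        rw [gramDet]
        simp only [map_add, map_smul, LinearMap.add_apply, LinearMap.smul_apply, smul_eq_mul,
          hB (x : V) v, h4]
        ring]
      simp [hvv]
    let _ : Fintype (Submodule.span K {v}) := Fintype.ofFinite _
    rw [← Nat.card_congr ((hP.splitEquiv hB hPW).toEquiv.subtypeEquiv h3),
      card_subtype_prod (fun (_ : Submodule.span K {v}) (x : W') => B (x : V) x = 0), hz,
      Finset.sum_const, Finset.card_univ, Module.card_eq_pow_finrank (K := K),
      finrank_span_singleton hv0, pow_one, smul_eq_mul, pow_succ']

theorem HasTrivialRadical.card_gramDet_ne_zero (hK : Fintype.card K % 2 = 1) (h2 : (2 : K) ≠ 0)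
    (hB : ∀ x y, B x y = B y x) {m : ℕ} (hW : HasTrivialRadical B W)
    (hm : Module.finrank K W = 2 * (m + 1)) :
    (Nat.card {p : W × W // gramDet B (p.1 : V) p.2 ≠ 0} : ℝ) =
      ((Fintype.card K : ℝ) ^ (2 * (m + 1)) - 1) *
        ((Fintype.card K : ℝ) ^ (2 * (m + 1)) - (Fintype.card K : ℝ) ^ (2 * m + 1)) := by
  have hVfin : Finite V := Module.finite_of_finite K
  let _ : Fintype W := Fintype.ofFinite _
  have hcard : (Fintype.card W : ℝ) = (Fintype.card K : ℝ) ^ (2 * (m + 1)) := by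
    rw [Module.card_eq_pow_finrank (K := K), hm, Nat.cast_pow]
  have h0 : Nat.card {w : W // gramDet B ((0 : W) : V) w ≠ 0} = 0 := by
    simp [gramDet]
  have h1 : ∀ v ∈ Finset.univ.erase (0 : W), (Nat.card {w : W // gramDet B (v : V) w ≠ 0} : ℝ) =
      (Fintype.card K : ℝ) ^ (2 * (m + 1)) - (Fintype.card K : ℝ) ^ (2 * m + 1) := fun v hv => by
    have h3 := hW.card_gramDet_eq_zero hK h2 hB hm v.2
      fun h => Finset.ne_of_mem_erase hv (Subtype.ext h)
    have h4 := Finset.card_filter_add_card_filter_not (s := Finset.univ)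
      (fun w : W => gramDet B (v : V) w = 0)
    rw [Nat.card_eq_fintype_card, Fintype.card_subtype] at h3 ⊢
    rw [h3, Finset.card_univ] at h4
    rw [← hcard, ← h4]
    push_cast
    ring
  rw [card_subtype_prod fun v w : W => gramDet B (v : V) w ≠ 0,
    ← Finset.add_sum_erase _ _ (Finset.mem_univ (0 : W)), h0, zero_add, Nat.cast_sum,
    Finset.sum_congr rfl h1, Finset.sum_const, Finset.card_erase_of_mem (Finset.mem_univ _),
    Finset.card_univ, nsmul_eq_mul, Nat.cast_sub (Nat.one_le_iff_ne_zero.2 Fintype.card_ne_zero),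
    hcard, Nat.cast_one]

theorem HasTrivialRadical.nondegenerateCount_two (hK : Fintype.card K % 2 = 1) (h2 : (2 : K) ≠ 0)
    (hB : ∀ x y, B x y = B y x) {m : ℕ} (hW : HasTrivialRadical B W)
    (hm : Module.finrank K W = 2 * (m + 1)) :
    (nondegenerateCount B W 2 : ℝ) * ((Fintype.card K : ℝ) ^ 2 - 1) =
      (Fintype.card K : ℝ) ^ (2 * m) * ((Fintype.card K : ℝ) ^ (2 * (m + 1)) - 1) := by
  have hVfin : Finite V := Module.finite_of_finite K
  have : Finite (Submodule K V) := Finite.of_injective _ SetLike.coe_injective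
  let _ : Fintype {P : Submodule K V // P ≤ W ∧ HasTrivialRadical B P ∧
    Module.finrank K P = 2} := Fintype.ofFinite _
  have h := hW.card_gramDet_ne_zero hK h2 hB hm
  rw [← card_gramDet_ne_zero_eq_card_sigma hB, Nat.card_sigma, Nat.cast_sum,
    Finset.sum_congr rfl fun P _ => P.2.2.1.card_gramDet_ne_zero hK h2 hB (m := 0) P.2.2.2,
    Finset.sum_const, Finset.card_univ, ← Nat.card_eq_fintype_card, nsmul_eq_mul] at h
  change (nondegenerateCount B W 2 : ℝ) * _ = _ at h
  have hq : (1 : ℝ) < Fintype.card K := by exact_mod_cast Fintype.one_lt_card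
  have h0 : (Fintype.card K : ℝ) * (Fintype.card K - 1) ≠ 0 :=
    mul_ne_zero (by linarith) (sub_pos.2 hq).ne'
  refine mul_right_cancel₀ h0 ?_
  linear_combination h

/-- The number of nondegenerate subspaces of dimension `2 * k` of a nondegenerate quadratic space
of dimension `2 * m`. -/
theorem HasTrivialRadical.nondegenerateCount_eq (hK : Fintype.card K % 2 = 1) (h2 : (2 : K) ≠ 0)
    (hB : ∀ x y, B x y = B y x) {k m : ℕ} (hkm : k ≤ m) (hW : HasTrivialRadical B W)
    (hm : Module.finrank K W = 2 * m) :
    (nondegenerateCount B W (2 * k) : ℝ) = idempotentCount (Fintype.card K) m k := by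
  have hVfin : Finite V := Module.finite_of_finite K
  have : Finite (Submodule K V) := Finite.of_injective _ SetLike.coe_injective
  let _ : Fintype (Submodule K V) := Fintype.ofFinite _
  have hq : 1 < Fintype.card K := Fintype.one_lt_card
  induction k generalizing m W with
  | zero =>
    rw [idempotentCount_zero_right, Nat.cast_eq_one, nondegenerateCount,
      Nat.card_eq_one_iff_unique]
    exact ⟨⟨fun U U' => Subtype.ext <| (Submodule.finrank_eq_zero.1 U.2.2.2).trans
      (Submodule.finrank_eq_zero.1 U'.2.2.2).symm⟩,
      ⟨⊥, bot_le, hasTrivialRadical_bot, finrank_bot K V⟩⟩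
  | succ k ih =>
    obtain ⟨m, rfl⟩ := Nat.exists_eq_succ_of_ne_zero (Nat.ne_zero_of_lt hkm)
    have hkm' : k ≤ m := Nat.succ_le_succ_iff.1 hkm
    let r : Submodule K V → Submodule K V → Prop := fun U P =>
      (U ≤ W ∧ HasTrivialRadical B U ∧ Module.finrank K U = 2 * (k + 1)) ∧
        P ≤ U ∧ HasTrivialRadical B P ∧ Module.finrank K P = 2
    have hq2 : ((Fintype.card K : ℝ) ^ 2 - 1) ≠ 0 :=
      (sub_pos.2 (one_lt_pow₀ (by exact_mod_cast hq) two_ne_zero)).ne'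
    have hU : ∀ U, (Nat.card {P // r U P} : ℝ) * ((Fintype.card K : ℝ) ^ 2 - 1) =
        if U ≤ W ∧ HasTrivialRadical B U ∧ Module.finrank K U = 2 * (k + 1) then
          (Fintype.card K : ℝ) ^ (2 * k) * ((Fintype.card K : ℝ) ^ (2 * (k + 1)) - 1)
        else 0 := fun U => by
      split_ifs with h
      · rw [← h.2.1.nondegenerateCount_two hK h2 hB h.2.2, nondegenerateCount]
        simp only [r, h, true_and]
      · simp [r, h]
    have hP : ∀ P, (Nat.card {U // r U P} : ℝ) =
        if P ≤ W ∧ HasTrivialRadical B P ∧ Module.finrank K P = 2 then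
          idempotentCount (Fintype.card K) m k
        else 0 := fun P => by
      split_ifs with h
      · have hdim := h.2.1.finrank_add hB h.1
        rw [← ih hkm' ((h.2.1.inf_orthogonal_iff hB h.1).2 hW) (by lia), nondegenerateCount,
          Nat.card_congr (Equiv.ofBijective _ (h.2.1.bijective_sup hB h.2.2 h.1)), Nat.cast_inj]
        refine Nat.card_congr (Equiv.subtypeEquivRight fun U => ?_)
        rw [show 2 + 2 * k = 2 * (k + 1) by ring]
        simp only [r, h, and_true]
        tauto
      · rw [Nat.cast_eq_zero]
        refine Nat.card_eq_zero.2 (Or.inl ⟨fun U => h ⟨U.2.2.1.trans U.2.1.1, U.2.2.2⟩⟩)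
    have hswap : ∑ U, Nat.card {P // r U P} = ∑ P, Nat.card {U // r U P} := by
      rw [← card_subtype_prod, ← card_subtype_prod fun P U => r U P]
      exact Nat.card_congr ((Equiv.prodComm _ _).subtypeEquiv fun _ => Iff.rfl)
    have hcount : ∀ d, Finset.card {U : Submodule K V | U ≤ W ∧ HasTrivialRadical B U ∧
        Module.finrank K U = d} = nondegenerateCount B W d := fun d => by
      rw [nondegenerateCount, Nat.card_eq_fintype_card, Fintype.card_subtype]
    have h := congrArg (fun n : ℕ => (n : ℝ) * ((Fintype.card K : ℝ) ^ 2 - 1)) hswap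
    simp only [Nat.cast_sum] at h
    rw [Finset.sum_mul, Finset.sum_congr rfl fun U _ => hU U, Finset.sum_congr rfl fun P _ => hP P,
      ← Finset.sum_filter, ← Finset.sum_filter, Finset.sum_const, Finset.sum_const,
      hcount, hcount, nsmul_eq_mul, nsmul_eq_mul] at h
    have h1 := idempotentCount_succ_succ hq hkm'
    have h3 := hW.nondegenerateCount_two hK h2 hB hm
    have hpos : (Fintype.card K : ℝ) ^ (2 * k) * ((Fintype.card K : ℝ) ^ (2 * (k + 1)) - 1) ≠ 0 :=
      mul_ne_zero (pow_ne_zero _ (by exact_mod_cast (zero_lt_one.trans hq).ne'))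
        (sub_pos.2 (one_lt_pow₀ (by exact_mod_cast hq) (by lia))).ne'
    refine mul_right_cancel₀ hpos ?_
    rw [Nat.succ_eq_add_one, h1, h]
    linear_combination idempotentCount (Fintype.card K) m k * h3

end CountingNondegenerateSubspaces

section SpecialOrthogonalInvolutions

variable {K V : Type} [Field K] [AddCommGroup V] [Module K V] [FiniteDimensional K V]
  {B : LinearMap.BilinForm K V}

/-- Involutive isometries of determinant one correspond to nondegenerate subspaces of even
dimension, by taking the eigenspace for the eigenvalue `-1`. -/
theorem bijective_involutionOfIsCompl_orthogonal (h2 : (2 : K) ≠ 0) (hB : ∀ x y, B x y = B y x)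
    (htop : HasTrivialRadical B ⊤) :
    Function.Bijective
      fun U : {U : Submodule K V // HasTrivialRadical B U ∧ Even (Module.finrank K U)} =>
        (⟨involutionOfIsCompl (U.2.1.isCompl_orthogonal hB), involutionOfIsCompl_mul_self _,
          fun x y => by
            obtain ⟨a, ha, b, hb, rfl⟩ :=
              exists_add_eq_of_isCompl (U.2.1.isCompl_orthogonal hB) x
            obtain ⟨c, hc, d, hd, rfl⟩ :=
              exists_add_eq_of_isCompl (U.2.1.isCompl_orthogonal hB) y
            have h1 : B a d = 0 := hd a ha
            have h3 : B c b = 0 := hb c hc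
            simp [involutionOfIsCompl_left _ ha, involutionOfIsCompl_right _ hb,
              involutionOfIsCompl_left _ hc, involutionOfIsCompl_right _ hd, h1, hB b c, h3],
          by rw [det_involutionOfIsCompl, U.2.2.neg_one_pow]⟩ :
        {T : Module.End K V // T * T = 1 ∧ (∀ x y, B (T x) (T y) = B x y) ∧
          LinearMap.det T = 1}) := by
  constructor
  · intro U U' h
    refine Subtype.ext (Submodule.ext fun x => ?_)
    have h1 := congrArg (fun T => T.1 x) h
    rw [← involutionOfIsCompl_eq_neg_iff h2 (U.2.1.isCompl_orthogonal hB),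
      ← involutionOfIsCompl_eq_neg_iff h2 (U'.2.1.isCompl_orthogonal hB)]
    exact (congrArg (· = -x) h1).to_iff
  · rintro ⟨T, hT, hiso, hdet⟩
    have hc := isCompl_ker_of_mul_self_eq_one h2 hT
    have hperp : ∀ x ∈ LinearMap.ker (T + 1), ∀ y ∈ LinearMap.ker (T - 1), B x y = 0 :=
      fun x hx y hy => by
        have h1 := hiso x y
        rw [eq_neg_of_add_eq_zero_left (show T x + x = 0 from hx),
          sub_eq_zero.1 (show T y - y = 0 from hy), map_neg, LinearMap.neg_apply] at h1
        have h3 : (2 : K) * B x y = 0 := by linear_combination -h1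
        exact (mul_eq_zero.1 h3).resolve_left h2
    have hU : HasTrivialRadical B (LinearMap.ker (T + 1)) := fun x hx h0 =>
      htop x Submodule.mem_top fun y _ => by
        obtain ⟨a, ha, b, hb, rfl⟩ := exists_add_eq_of_isCompl hc y
        rw [map_add, h0 a ha, hperp x hx b hb, add_zero]
    have heq : involutionOfIsCompl (hU.isCompl_orthogonal hB) = T := by
      refine LinearMap.ext fun x => ?_
      obtain ⟨a, ha, b, hb, rfl⟩ := exists_add_eq_of_isCompl hc x
      rw [map_add, map_add, involutionOfIsCompl_left _ ha,
        involutionOfIsCompl_right _ (show b ∈ B.orthogonal (LinearMap.ker (T + 1)) from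
          fun y hy => hperp y hy b hb),
        eq_neg_of_add_eq_zero_left (show T a + a = 0 from ha),
        sub_eq_zero.1 (show T b - b = 0 from hb)]
    have hev : Even (Module.finrank K (LinearMap.ker (T + 1))) := by
      rw [← heq, det_involutionOfIsCompl] at hdet
      refine (neg_one_pow_eq_one_iff_even fun h => h2 ?_).1 hdet
      linear_combination -h
    exact ⟨⟨_, hU, hev⟩, Subtype.ext heq⟩

theorem card_even_hasTrivialRadical [Fintype K] (hK : Fintype.card K % 2 = 1) (h2 : (2 : K) ≠ 0)
    (hB : ∀ x y, B x y = B y x) (htop : HasTrivialRadical B ⊤) {m : ℕ}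
    (hm : Module.finrank K V = 2 * m) :
    (Nat.card {U : Submodule K V // HasTrivialRadical B U ∧ Even (Module.finrank K U)} : ℝ) =
      ∑ k ∈ Finset.range (m + 1), idempotentCount (Fintype.card K) m k := by
  have hVfin : Finite V := Module.finite_of_finite K
  have : Finite (Submodule K V) := Finite.of_injective _ SetLike.coe_injective
  let _ : Fintype (Submodule K V) := Fintype.ofFinite _
  rw [Nat.card_eq_fintype_card, Fintype.card_subtype,
    Finset.card_eq_sum_card_fiberwise (f := fun U : Submodule K V => Module.finrank K U / 2)
      (t := Finset.range (m + 1)) fun U _ => by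
        have := Submodule.finrank_le U
        simp only [Finset.coe_range, Set.mem_Iio]
        lia, Nat.cast_sum]
  refine Finset.sum_congr rfl fun k hk => ?_
  rw [← htop.nondegenerateCount_eq hK h2 hB (Nat.lt_succ_iff.1 (Finset.mem_range.1 hk))
    (by rw [finrank_top, hm]), nondegenerateCount, Nat.card_eq_fintype_card, Fintype.card_subtype,
    Finset.filter_filter]
  congr 2
  refine Finset.filter_congr fun U _ => ?_
  rw [and_assoc, and_iff_right (le_top : U ≤ ⊤)]
  refine and_congr_right fun _ => ⟨?_, fun h => ⟨⟨k, by lia⟩, by lia⟩⟩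
  rintro ⟨⟨l, hl⟩, h⟩
  lia

theorem card_specialFixGroup_mul_self_eq_one [Fintype K] (hK : Fintype.card K % 2 = 1)
    (h2 : (2 : K) ≠ 0) {m : ℕ} {N : Type} [Fintype N] [DecidableEq N]
    (hN : Fintype.card N = 2 * m) {J : Matrix N N K} (hJ : IsUnit J) (hsymm : Jᵀ = J) :
    (Nat.card {g : specialFixGroup J // g * g = 1} : ℝ) =
      ∑ k ∈ Finset.range (m + 1), idempotentCount (Fintype.card K) m k := by
  let B : LinearMap.BilinForm K (N → K) := Matrix.toBilin' J
  have hB : ∀ x y, B x y = B y x := fun x y => by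
    rw [Matrix.toBilin'_apply', Matrix.toBilin'_apply', Matrix.dotProduct_mulVec,
      ← Matrix.mulVec_transpose, hsymm, dotProduct_comm]
  have htop : HasTrivialRadical B ⊤ := fun x _ h =>
    (Matrix.nondegenerate_toBilin'_iff.2
      (Matrix.nondegenerate_of_det_ne_zero ((Matrix.isUnit_iff_isUnit_det J).1 hJ).ne_zero)).1 x
        fun y => h y Submodule.mem_top
  have hiso : ∀ A : Matrix N N K, Aᵀ * J * A = J ↔
      ∀ x y, B (Matrix.toLin' A x) (Matrix.toLin' A y) = B x y := fun A => by
    have h1 : ∀ x y, B (Matrix.toLin' A x) (Matrix.toLin' A y) =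
        Matrix.toBilin' (Aᵀ * J * A) x y := fun x y => by
      rw [← Matrix.toBilin'_comp]
      rfl
    simp only [h1]
    rw [← Matrix.toBilin'.injective.eq_iff]
    exact ⟨fun h x y => by rw [h], fun h => LinearMap.ext₂ h⟩
  let e : {g : specialFixGroup J // g * g = 1} ≃
      {T : Module.End K (N → K) // T * T = 1 ∧ (∀ x y, B (T x) (T y) = B x y) ∧
        LinearMap.det T = 1} :=
    { toFun := fun g => ⟨Matrix.toLin' (g.1.1 : Matrix N N K), by
        rw [Module.End.mul_eq_comp, ← Matrix.toLin'_mul, ← Units.val_mul,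
          show g.1.1 * g.1.1 = 1 from congrArg Subtype.val g.2]
        exact Matrix.toLin'_one, (hiso _).1 g.1.2.1, by
        rw [LinearMap.det_toLin']
        exact g.1.2.2⟩
      invFun := fun T =>
        have h : LinearMap.toMatrix' T.1 * LinearMap.toMatrix' T.1 = 1 := by
          rw [← LinearMap.toMatrix'_mul, T.2.1, LinearMap.toMatrix'_one]
        ⟨⟨⟨LinearMap.toMatrix' T.1, LinearMap.toMatrix' T.1, h, h⟩, (hiso _).2 (by
          rw [Matrix.toLin'_toMatrix']
          exact T.2.2.1), by
          change Matrix.det (LinearMap.toMatrix' T.1) = 1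
          rw [LinearMap.det_toMatrix']
          exact T.2.2.2⟩, Subtype.ext (Units.ext h)⟩
      left_inv := fun g => by
        refine Subtype.ext (Subtype.ext (Units.ext ?_))
        exact LinearMap.toMatrix'_toLin' _
      right_inv := fun T => by
        refine Subtype.ext ?_
        exact Matrix.toLin'_toMatrix' _ }
  rw [Nat.card_congr (e.trans (Equiv.ofBijective _
    (bijective_involutionOfIsCompl_orthogonal h2 hB htop)).symm)]
  exact card_even_hasTrivialRadical hK h2 hB htop (by rw [Module.finrank_fintype_fun_eq_card, hN])

end SpecialOrthogonalInvolutions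

section Counts

theorem card_mul_self_eq_sum_finrank_specialFixGroup {N F : Type} [Fintype N] [DecidableEq N]
    [Field F] [Finite F] (h2 : (2 : F) ≠ 0) {J : Matrix N N F} (hJ : IsUnit J) (hsymm : Jᵀ = J)
    {κ : Type} [Fintype κ] {S : κ → FDRep ℂ ↥(specialFixGroup J)} (hS : ∀ i, Simple (S i))
    (hdist : ∀ i j : κ, Nonempty (S i ≅ S j) → i = j)
    (hcomplete : ∀ ρ : FDRep ℂ ↥(specialFixGroup J), Simple ρ → ∃ i, Nonempty (ρ ≅ S i)) :
    ∑ j ∈ Finset.univ.filter (fun j => IsRealValued (S j).character),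
      (Module.finrank ℂ (S j) : ℝ) = Nat.card {g : specialFixGroup J // g * g = 1} := by
  obtain ⟨J, rfl⟩ := hJ
  let _ := Fintype.ofFinite F
  refine sum_finrank_of_realStructure hS hdist hcomplete fun j hj => ?_
  have := hS j
  exact (isSimpleRep_of_simple (S j)).exists_realStructure (Subgroup.subtype_injective _)
    (by
      rw [Subgroup.range_subtype]
      exact noQuat_specialFixGroup h2 hsymm) hj

theorem card_mul_self_eq_sum_finrank_generalLinearGroup {n K : Type} [Fintype n] [DecidableEq n]
    [Field K] [Fintype K] {i : K} (hi : i * i = -1) (h2 : (2 : K) ≠ 0)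
    {κ : Type} [Fintype κ] {S : κ → FDRep ℂ (GL n K)} (hS : ∀ i, Simple (S i))
    (hdist : ∀ i j : κ, Nonempty (S i ≅ S j) → i = j)
    (hcomplete : ∀ ρ : FDRep ℂ (GL n K), Simple ρ → ∃ i, Nonempty (ρ ≅ S i)) :
    ∑ j ∈ Finset.univ.filter (fun j => IsRealValued (S j).character),
      (Module.finrank ℂ (S j) : ℝ) = Nat.card {g : GL n K // g * g = 1} := by
  refine sum_finrank_of_realStructure hS hdist hcomplete fun j hj => ?_
  have := hS j
  exact (isSimpleRep_of_simple (S j)).exists_realStructure leviEmbedding_injective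
    (noQuat_leviEmbedding hi h2) hj

theorem two_ne_zero_of_card_mod_two {K : Type} [Field K] [Fintype K]
    (hK : Fintype.card K % 2 = 1) : (2 : K) ≠ 0 :=
  Ring.two_ne_zero fun h => by
    have := FiniteField.even_card_of_char_two h
    lia

end Counts

theorem stmt_14 (m : ℕ) (hm : 1 ≤ m) (q : ℕ) (hq : ∃ p r : ℕ, p.Prime ∧ Odd p ∧ 0 < r ∧ q = p ^ r)
    (F : Type) [Field F] [Fintype F] [DecidableEq F] (hF : Fintype.card F = q)
    (E : Type) [Field E] (hE : ∃ _ : Fintype E, Fintype.card E = q ^ 2)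
    (J : Matrix (Fin m ⊕ Fin m) (Fin m ⊕ Fin m) F) (hJunit : IsUnit J) (hJsymm : Jᵀ = J)
    (κ : Type) [Fintype κ] (S : κ → FDRep ℂ ↥(specialFixGroup J))
    (hSsimple : ∀ i, Simple (S i))
    (hSdistinct : ∀ i j : κ, Nonempty (S i ≅ S j) → i = j)
    (hScomplete : ∀ ρ : FDRep ℂ ↥(specialFixGroup J), Simple ρ → ∃ i, Nonempty (ρ ≅ S i))
    (ι : Type) [Fintype ι] (R : ι → FDRep ℂ (GL (Fin m) E))
    (hRsimple : ∀ i, Simple (R i))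
    (hRdistinct : ∀ i j : ι, Nonempty (R i ≅ R j) → i = j)
    (hRcomplete : ∀ ρ : FDRep ℂ (GL (Fin m) E), Simple ρ → ∃ i, Nonempty (ρ ≅ R i)) :
    (∑ j ∈ Finset.univ.filter (fun j => IsRealValued (S j).character),
        (Module.finrank ℂ (S j) : ℝ)
      = ∑ k ∈ Finset.range (m + 1),
          (q : ℝ) ^ (2 * k * (m - k)) * gbinom m k ((q : ℝ) ^ 2)) ∧
    (∑ i ∈ Finset.univ.filter (fun i => IsRealValued (R i).character),
        (Module.finrank ℂ (R i) : ℝ)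
      = ∑ k ∈ Finset.range (m + 1),
          (q : ℝ) ^ (2 * k * (m - k)) * gbinom m k ((q : ℝ) ^ 2)) := by
  have hodd : Fintype.card F % 2 = 1 := by
    obtain ⟨p, r, -, hp, -, rfl⟩ := hq
    rw [hF]
    exact Nat.odd_iff.1 hp.pow
  obtain ⟨_, hE⟩ := hE
  have hoddE : Fintype.card E % 2 = 1 := by
    rw [hE, ← hF]
    exact Nat.odd_iff.1 (Nat.odd_iff.2 hodd).pow
  obtain ⟨i, hi⟩ : IsSquare (-1 : E) := by
    refine FiniteField.isSquare_neg_one_iff.2 ?_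
    obtain ⟨s, hs⟩ := Nat.odd_iff.2 hodd
    rw [hE, ← hF, hs, show (2 * s + 1) ^ 2 = 4 * (s ^ 2 + s) + 1 by ring]
    lia
  have h2F := two_ne_zero_of_card_mod_two hodd
  have h2E := two_ne_zero_of_card_mod_two hoddE
  have hq1 : 1 < q := hF ▸ Fintype.one_lt_card
  constructor
  · rw [card_mul_self_eq_sum_finrank_specialFixGroup h2F hJunit hJsymm hSsimple hSdistinct
      hScomplete, card_specialFixGroup_mul_self_eq_one hodd h2F (m := m)
        (by rw [Fintype.card_sum, Fintype.card_fin, two_mul]) hJunit hJsymm, hF]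
    rfl
  · rw [card_mul_self_eq_sum_finrank_generalLinearGroup hi.symm h2E hRsimple hRdistinct
      hRcomplete, card_mul_self_eq_one hq1 hE h2E]
    rfl

end
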